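/- arXiv:1807.02179 — 2 statements merged into one kernel-verified Lean document; each statement's English description precedes it below -/
import Mathlib

section
/- Let Q be an acyclic quiver on vertex set {1,…,n}, labeled so that h(a) < t(a) for every arrow a. Let Q• = {Q¹,…,Q^ℓ} be an admissible Dynkin subquiver partition of Q and let φ₁ ≺ ⋯ ≺ φ_r be an allowed total order on Φ(Q,Q•). Then in the completed quantum algebra Â_Q one has E(y_{e₁})·E(y_{e₂})⋯E(y_{e_n}) = E(y_{φ₁})·E(y_{φ₂})⋯E(y_{φ_r}); i.e. the product of quantum dilogarithms over the allowed order equals the trivial factorization E(y_{e₁})⋯E(y_{e_n}) of the combinatorial Donaldson–Thomas invariant E_Q of Q. -/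
open scoped BigOperators

/-- A quiver on vertex set `Fin n` with `m` arrows, each arrow `a` having a
tail `ta a` and a head `ha a`. -/
structure Quiv (n : ℕ) where
  m : ℕ
  ta : Fin m → Fin n
  ha : Fin m → Fin n

namespace Quiv

variable {n : ℕ}

/-- Coerce a dimension vector in `ℕⁿ` to `ℤⁿ`. -/
def toZ {n : ℕ} (γ : Fin n → ℕ) : Fin n → ℤ := fun i => (γ i : ℤ)

/-- The Euler form of the subquiver with vertex set `V` and arrow set `A`. -/
def chiSub (Q : Quiv n) (V : Finset (Fin n)) (A : Finset (Fin Q.m))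
    (γ₁ γ₂ : Fin n → ℤ) : ℤ :=
  (∑ i ∈ V, γ₁ i * γ₂ i) - ∑ a ∈ A, γ₁ (Q.ta a) * γ₂ (Q.ha a)

/-- The Euler form `χ` of `Q`. -/
def chi (Q : Quiv n) (γ₁ γ₂ : Fin n → ℤ) : ℤ :=
  Q.chiSub Finset.univ Finset.univ γ₁ γ₂

/-- `λ(γ₁,γ₂) = χ(γ₂,γ₁) − χ(γ₁,γ₂)`, the antisymmetrized Euler form. -/
def lam (Q : Quiv n) (γ₁ γ₂ : Fin n → ℤ) : ℤ := Q.chi γ₂ γ₁ - Q.chi γ₁ γ₂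

/-- `λ_A`, the restriction of `λ` to a subset `A` of the arrows. -/
def lamA (Q : Quiv n) (A : Finset (Fin Q.m)) (γ₁ γ₂ : Fin n → ℤ) : ℤ :=
  ∑ a ∈ A, (γ₁ (Q.ta a) * γ₂ (Q.ha a) - γ₂ (Q.ta a) * γ₁ (Q.ha a))

/-- No directed cycle using only arrows from `A`. -/
def AcyclicOn (Q : Quiv n) (A : Finset (Fin Q.m)) : Prop :=
  ¬ ∃ (k : ℕ) (c : ZMod (k + 1) → Fin Q.m),
      (∀ i, c i ∈ A) ∧ ∀ i, Q.ha (c i) = Q.ta (c (i + 1))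

/-- The quiver `Q` is acyclic: it has no directed cycle. -/
def Acyclic (Q : Quiv n) : Prop := Q.AcyclicOn Finset.univ

/-- Undirected adjacency via an arrow from `A`. -/
def AdjOn (Q : Quiv n) (A : Finset (Fin Q.m)) (x y : Fin n) : Prop :=
  ∃ a ∈ A, (Q.ta a = x ∧ Q.ha a = y) ∨ (Q.ta a = y ∧ Q.ha a = x)

/-- The subquiver `(V, A)` is connected as an undirected graph. -/
def ConnectedOn (Q : Quiv n) (V : Finset (Fin n)) (A : Finset (Fin Q.m)) : Prop :=
  ∀ x ∈ V, ∀ y ∈ V, Relation.ReflTransGen (Q.AdjOn A) x y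

/-- The Tits form of the subquiver `(V,A)` is positive definite. -/
def PosDefOn (Q : Quiv n) (V : Finset (Fin n)) (A : Finset (Fin Q.m)) : Prop :=
  ∀ γ : Fin n → ℤ, (∀ i, i ∉ V → γ i = 0) → γ ≠ 0 → 0 < Q.chiSub V A γ γ

/-- The subquiver `(V,A)` is a (nonempty, connected, acyclic, positive-definite
Tits form) Dynkin quiver. -/
def DynkinOn (Q : Quiv n) (V : Finset (Fin n)) (A : Finset (Fin Q.m)) : Prop :=
  V.Nonempty ∧ (∀ a ∈ A, Q.ta a ∈ V ∧ Q.ha a ∈ V) ∧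
    Q.ConnectedOn V A ∧ Q.AcyclicOn A ∧ Q.PosDefOn V A

/-- The set of positive roots of the subquiver `(V,A)`: nonzero dimension
vectors supported on `V` with `χ(β,β) = 1`. -/
def PosRootsOn (Q : Quiv n) (V : Finset (Fin n)) (A : Finset (Fin Q.m)) :
    Set (Fin n → ℕ) :=
  {β | β ≠ 0 ∧ (∀ i, i ∉ V → β i = 0) ∧ Q.chiSub V A (toZ β) (toZ β) = 1}

/-- A Dynkin subquiver partition `Q• = {Q¹,…,Q^ℓ}` of `Q`: each block is a
subquiver `(V j, A j)`, the vertex sets partition `Q₀`, and each block is a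
nonempty connected Dynkin quiver. -/
structure DSP (Q : Quiv n) (ℓ : ℕ) where
  V : Fin ℓ → Finset (Fin n)
  A : Fin ℓ → Finset (Fin Q.m)
  cover : ∀ i : Fin n, ∃! j, i ∈ V j
  dynkin : ∀ j, Q.DynkinOn (V j) (A j)

/-- Arrows of `Q` not belonging to any block, i.e. arrows of the contracted
quiver `P(Q,Q•)`. -/
def DSP.Cut {Q : Quiv n} {ℓ : ℕ} (P : DSP Q ℓ) (a : Fin Q.m) : Prop :=
  ∀ j, a ∉ P.A j

/-- `Q•` is admissible: the contracted quiver `P(Q,Q•)` is acyclic, i.e. there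
is no cyclic sequence of cut arrows in which the block of the head of each
arrow is the block of the tail of the next one. -/
def DSP.Admissible {Q : Quiv n} {ℓ : ℕ} (P : DSP Q ℓ) : Prop :=
  ¬ ∃ (k : ℕ) (c : ZMod (k + 1) → Fin Q.m),
      (∀ i, P.Cut (c i)) ∧
      ∀ i, ∃ j : Fin ℓ, Q.ha (c i) ∈ P.V j ∧ Q.ta (c (i + 1)) ∈ P.V j

/-- `Q•` is ordered: every cut arrow goes from a higher-indexed block (tail)
to a lower-indexed block (head). -/
def DSP.Ordered {Q : Quiv n} {ℓ : ℕ} (P : DSP Q ℓ) : Prop :=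
  ∀ a : Fin Q.m, P.Cut a →
    ∀ j j' : Fin ℓ, Q.ha a ∈ P.V j → Q.ta a ∈ P.V j' → j < j'

/-- `Φ(Q,Q•) = ∪_j Φ^j`. -/
def DSP.Roots {Q : Quiv n} {ℓ : ℕ} (P : DSP Q ℓ) : Set (Fin n → ℕ) :=
  ⋃ j, Q.PosRootsOn (P.V j) (P.A j)

/-- An allowed total order `φ₁ ≺ ⋯ ≺ φ_r` on `Φ(Q,Q•)`: an enumeration such
that for `u < v`, `λ(φ_u,φ_v) ≥ 0` if `φ_u, φ_v` lie in the same `Φ^j` and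
`λ(φ_u,φ_v) ≤ 0` if they lie in different `Φ^j`'s. -/
def DSP.AllowedOrder {Q : Quiv n} {ℓ : ℕ} (P : DSP Q ℓ) {r : ℕ}
    (φ : Fin r → (Fin n → ℕ)) : Prop :=
  Function.Injective φ ∧ Set.range φ = P.Roots ∧
    ∀ u v : Fin r, u < v →
      ((∃ j, φ u ∈ Q.PosRootsOn (P.V j) (P.A j) ∧
          φ v ∈ Q.PosRootsOn (P.V j) (P.A j)) →
        0 ≤ Q.lam (toZ (φ u)) (toZ (φ v))) ∧
      ((¬ ∃ j, φ u ∈ Q.PosRootsOn (P.V j) (P.A j) ∧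
          φ v ∈ Q.PosRootsOn (P.V j) (P.A j)) →
        Q.lam (toZ (φ u)) (toZ (φ v)) ≤ 0)

end Quiv

noncomputable section

open Quiv

/-- The underlying vector space of the completed quantum algebra `Â_Q`:
functions from dimension vectors to `ℚ(t)`. -/
abbrev AQ (n : ℕ) := (Fin n → ℕ) → RatFunc ℚ

/-- The variable `t = q^{1/2}` of `ℚ(t)`. -/
def tq : RatFunc ℚ := RatFunc.X

/-- The unit of `Â_Q`: the indicator function of the zero dimension vector. -/
def oneQ {n : ℕ} : AQ n := fun γ => if γ = 0 then 1 else 0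

/-- The generator `y_γ = −δ_γ` of the quantum algebra. -/
def yQ {n : ℕ} (γ : Fin n → ℕ) : AQ n := fun δ => if δ = γ then -1 else 0

/-- The twisted convolution product of the quantum algebra:
`(f·g)(γ) = Σ_{γ₁+γ₂=γ} t^{λ(γ₁,γ₂)} f(γ₁) g(γ₂)`. -/
def mulQ {n : ℕ} (Q : Quiv n) (f g : AQ n) : AQ n := fun γ =>
  ∑ γ₁ ∈ Finset.Iic γ,
    tq ^ (Q.lam (toZ γ₁) (toZ (γ - γ₁))) * f γ₁ * g (γ - γ₁)

/-- Ordered product of a list of elements of `Â_Q`. -/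
def prodQ {n : ℕ} (Q : Quiv n) (L : List (AQ n)) : AQ n := L.foldr (mulQ Q) oneQ

/-- Power in the quantum algebra. -/
def powQ {n : ℕ} (Q : Quiv n) (f : AQ n) : ℕ → AQ n
  | 0 => oneQ
  | k + 1 => mulQ Q f (powQ Q f k)

/-- `P_k = Π_{j=1}^k (1 − q^j)⁻¹` with `q = t²`, the Poincaré series of
`H^*(BGL(k,ℂ))`. -/
def Pq (k : ℕ) : RatFunc ℚ := ∏ j ∈ Finset.Icc 1 k, (1 - tq ^ (2 * j))⁻¹

/-- The quantum dilogarithm `E(y_γ) = 1 + Σ_{k≥1} (−1)^k t^{k²} P_k y_γ^k`,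
written out as the function supported on the multiples `k • γ`,
with value `t^{k²} P_k` at `k • γ`  (note `y_γ^k = (−1)^k δ_{kγ}`). -/
def Edl {n : ℕ} (γ : Fin n → ℕ) : AQ n := fun δ =>
  ∑ k ∈ Finset.range ((∑ i, δ i) + 1),
    if δ = k • γ then tq ^ (k ^ 2) * Pq k else 0

end

namespace DT

noncomputable section

variable {M : Type*} [AddCommGroup M]

/-- The antisymmetrised form of a bilinear form. -/
def lm (χ : M →ₗ[ℤ] M →ₗ[ℤ] ℤ) (x y : M) : ℤ := χ y x - χ x y

/-- Twisted convolution of functions on a lattice. -/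
def cv (χ : M →ₗ[ℤ] M →ₗ[ℤ] ℤ) (f g : M → RatFunc ℚ) : M → RatFunc ℚ := fun γ =>
  ∑ᶠ α, tq ^ (lm χ α (γ - α)) * f α * g (γ - α)

open Classical in
/-- The unit of the convolution. -/
def dl : M → RatFunc ℚ := fun γ => if γ = 0 then 1 else 0

/-- Support condition. -/
def SuppIn (f : M → RatFunc ℚ) (C : AddSubmonoid M) : Prop := ∀ x, f x ≠ 0 → x ∈ C

/-- Finite decompositions in `C`. -/
def FinC (C : AddSubmonoid M) : Prop := ∀ γ, {α | α ∈ C ∧ γ - α ∈ C}.Finite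

variable (χ : M →ₗ[ℤ] M →ₗ[ℤ] ℤ)

lemma tq_ne : (tq : RatFunc ℚ) ≠ 0 := RatFunc.X_ne_zero

lemma lm_add_left (x y z : M) : lm χ (x + y) z = lm χ x z + lm χ y z := by
  simp [lm]; ring

lemma lm_add_right (x y z : M) : lm χ x (y + z) = lm χ x y + lm χ x z := by
  simp [lm]; ring

lemma lm_sub_left (x y z : M) : lm χ (x - y) z = lm χ x z - lm χ y z := by
  simp [lm]; ring

lemma lm_sub_right (x y z : M) : lm χ x (y - z) = lm χ x y - lm χ x z := by
  simp [lm]; ring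

lemma lm_self (x : M) : lm χ x x = 0 := by simp [lm]

lemma lm_swap (x y : M) : lm χ x y = - lm χ y x := by simp [lm]

lemma lm_nsmul_left (k : ℕ) (x y : M) : lm χ (k • x) y = k * lm χ x y := by
  simp [lm, mul_sub]

lemma lm_nsmul_right (k : ℕ) (x y : M) : lm χ x (k • y) = k * lm χ x y := by
  simp [lm, mul_sub]

lemma lm_zero_left (x : M) : lm χ 0 x = 0 := by simp [lm]
lemma lm_zero_right (x : M) : lm χ x 0 = 0 := by simp [lm]

lemma cv_eq_sum {f g : M → RatFunc ℚ} {C : AddSubmonoid M} (hf : SuppIn f C) (hg : SuppIn g C)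
    (γ : M) (T : Finset M) (hT : ∀ α, α ∈ C → γ - α ∈ C → α ∈ T) :
    cv χ f g γ = ∑ α ∈ T, tq ^ (lm χ α (γ - α)) * f α * g (γ - α) := by
  unfold cv
  apply finsum_eq_sum_of_support_subset
  intro α hα
  simp only [Function.mem_support, ne_eq, mul_eq_zero, not_or] at hα
  exact hT α (hf _ hα.1.2) (hg _ hα.2)

lemma cv_supp {f g : M → RatFunc ℚ} {C : AddSubmonoid M} (hf : SuppIn f C) (hg : SuppIn g C) :
    SuppIn (cv χ f g) C := by
  intro γ h
  obtain ⟨α, hα⟩ : ∃ α, tq ^ (lm χ α (γ - α)) * f α * g (γ - α) ≠ 0 := by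
    by_contra hcon
    push Not at hcon
    exact h (finsum_eq_zero_of_forall_eq_zero hcon)
  simp only [ne_eq, mul_eq_zero, not_or] at hα
  have := C.add_mem (hf _ hα.1.2) (hg _ hα.2)
  simpa using this

lemma dl_supp (C : AddSubmonoid M) : SuppIn (dl : M → RatFunc ℚ) C := by
  intro x hx
  by_cases h : x = 0
  · subst h; exact C.zero_mem
  · simp [dl, h] at hx

lemma SuppIn.mono {f : M → RatFunc ℚ} {C D : AddSubmonoid M} (hf : SuppIn f C) (h : C ≤ D) :
    SuppIn f D := fun x hx => h (hf x hx)

lemma dl_cv (f : M → RatFunc ℚ) : cv χ dl f = f := by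
  funext γ
  unfold cv
  rw [finsum_eq_single _ 0]
  · simp [dl, lm_zero_left]
  · intro x hx; simp [dl, hx]

lemma cv_dl (f : M → RatFunc ℚ) : cv χ f dl = f := by
  funext γ
  unfold cv
  rw [finsum_eq_single _ γ]
  · simp [dl, lm_zero_right]
  · intro x hx
    have : γ - x ≠ 0 := fun h => hx (sub_eq_zero.1 h).symm
    simp [dl, this]

lemma cv_assoc {f g h : M → RatFunc ℚ} {C : AddSubmonoid M} (hC : FinC C)
    (hf : SuppIn f C) (hg : SuppIn g C) (hh : SuppIn h C) :
    cv χ (cv χ f g) h = cv χ f (cv χ g h) := by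
  funext γ
  set T := (hC γ).toFinset with hT
  have hTm : ∀ α, α ∈ T ↔ α ∈ C ∧ γ - α ∈ C := by intro α; simp [hT]
  rw [cv_eq_sum χ (cv_supp χ hf hg) hh γ T (fun α h1 h2 => (hTm α).2 ⟨h1, h2⟩)]
  rw [cv_eq_sum χ hf (cv_supp χ hg hh) γ T (fun α h1 h2 => (hTm α).2 ⟨h1, h2⟩)]
  have e1 : ∀ α ∈ T, tq ^ (lm χ α (γ - α)) * cv χ f g α * h (γ - α) =
      ∑ β ∈ T, tq ^ (lm χ α (γ - α)) * (tq ^ (lm χ β (α - β)) * f β * g (α - β)) * h (γ - α) := by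
    intro α hα
    rw [cv_eq_sum χ hf hg α T, Finset.mul_sum, Finset.sum_mul]
    intro β h1 h2
    refine (hTm β).2 ⟨h1, ?_⟩
    have := C.add_mem h2 ((hTm α).1 hα).2
    rwa [add_comm, sub_add_sub_cancel] at this
  have e2 : ∀ β ∈ T, tq ^ (lm χ β (γ - β)) * f β * cv χ g h (γ - β) =
      ∑ α ∈ T, tq ^ (lm χ β (γ - β)) * f β *
        (tq ^ (lm χ (α - β) (γ - α)) * g (α - β) * h (γ - α)) := by
    intro β hβ
    rw [← Finset.mul_sum]
    congr 1
    unfold cv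
    rw [← finsum_comp_equiv (Equiv.subRight β)]
    have : ∀ α, γ - β - (Equiv.subRight β) α = γ - α := by intro α; simp
    simp only [this]
    apply finsum_eq_sum_of_support_subset
    intro α hα
    simp only [Function.mem_support, ne_eq, mul_eq_zero, not_or] at hα
    refine (hTm α).2 ⟨?_, hh _ hα.2⟩
    have := C.add_mem (hg _ hα.1.2) ((hTm β).1 hβ).1
    simpa using this
  rw [Finset.sum_congr rfl e1, Finset.sum_congr rfl e2, Finset.sum_comm]
  refine Finset.sum_congr rfl fun β _ => Finset.sum_congr rfl fun α _ => ?_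
  have : tq ^ (lm χ α (γ - α)) * tq ^ (lm χ β (α - β)) =
      tq ^ (lm χ β (γ - β)) * tq ^ (lm χ (α - β) (γ - α)) := by
    rw [← zpow_add₀ tq_ne, ← zpow_add₀ tq_ne]
    congr 1
    simp only [lm_sub_left, lm_sub_right, lm_self]
    ring
  linear_combination (f β * g (α - β) * h (γ - α)) * this

lemma cv_zero {f g : M → RatFunc ℚ} {C : AddSubmonoid M} (hp : ∀ x ∈ C, -x ∈ C → x = 0)
    (hf : SuppIn f C) (hg : SuppIn g C) : cv χ f g 0 = f 0 * g 0 := by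
  rw [cv_eq_sum χ hf hg 0 {0}]
  · simp [lm_zero_left]
  · intro α h1 h2
    simpa using hp α h1 (by simpa using h2)

/-- One-parameter functions from power series. -/
def io (x : M) (p : PowerSeries (RatFunc ℚ)) : M → RatFunc ℚ :=
  Function.extend (fun k : ℕ => k • x) (fun k => PowerSeries.coeff k p) 0

lemma io_ne (x : M) (p) (δ : M) (h : ∀ k : ℕ, δ ≠ k • x) : io x p δ = 0 := by
  unfold io
  rw [Function.extend_apply']
  · rfl
  · rintro ⟨k, hk⟩; exact h k hk.symm

lemma io_supp {x : M} (p) {C : AddSubmonoid M} (hx : x ∈ C) : SuppIn (io x p) C := by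
  intro δ h
  by_contra h'
  apply h
  apply io_ne
  rintro k rfl
  exact h' (C.nsmul_mem hx k)

variable [IsAddTorsionFree M]

lemma smul_inj {x : M} (hx : x ≠ 0) : Function.Injective (fun k : ℕ => k • x) := by
  have key : ∀ k m : ℕ, k ≤ m → k • x = m • x → k = m := by
    intro k m hkm h
    by_contra hne
    have h1 : (m - k) • x = 0 := by
      have : (m - k) • x + k • x = m • x := by rw [← add_nsmul]; congr 1; omega
      rw [h] at this
      simpa using this
    have h2 : (m - k) • x = (m - k) • (0 : M) := by simpa using h1
    exact hx (IsAddTorsionFree.nsmul_right_injective (n := m - k) (by omega) h2)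
  intro k m h
  rcases le_total k m with h' | h'
  · exact key k m h' h
  · exact (key m k h' h.symm).symm

lemma io_smul {x : M} (hx : x ≠ 0) (p) (k : ℕ) : io x p (k • x) = PowerSeries.coeff k p :=
  (smul_inj hx).extend_apply _ _ k

lemma io_zero {x : M} (hx : x ≠ 0) (p) : io x p 0 = PowerSeries.coeff 0 p := by
  have := io_smul hx p 0
  simpa using this

lemma io_cv {x : M} (hx : x ≠ 0) (p) (g : M → RatFunc ℚ) (γ : M) :
    cv χ (io x p) g γ =
      ∑ᶠ k : ℕ, tq ^ (k * lm χ x γ) * PowerSeries.coeff k p * g (γ - k • x) := by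
  have : ∀ k : ℕ, tq ^ (k * lm χ x γ) * PowerSeries.coeff k p * g (γ - k • x) =
      (fun α => tq ^ (lm χ α (γ - α)) * io x p α * g (γ - α)) (k • x) := by
    intro k
    simp only [io_smul hx, lm_sub_right, lm_self, lm_nsmul_left]
    simp
  simp only [this]
  rw [← finsum_mem_range (f := fun α => tq ^ (lm χ α (γ - α)) * io x p α * g (γ - α))
    (smul_inj hx)]
  unfold cv
  classical
  apply finsum_congr
  intro α
  by_cases h : α ∈ Set.range (fun k : ℕ => k • x)
  · rw [finsum_eq_if, if_pos h]
  · rw [finsum_eq_if, if_neg h, io_ne x p α (fun k hk => h ⟨k, hk.symm⟩)]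
    simp

lemma io_mul {x : M} (hx : x ≠ 0) (p p') : cv χ (io x p) (io x p') = io x (p * p') := by
  funext γ
  rw [io_cv χ hx]
  by_cases h : ∃ m : ℕ, γ = m • x
  · obtain ⟨m, rfl⟩ := h
    rw [io_smul hx, PowerSeries.coeff_mul, Finset.Nat.sum_antidiagonal_eq_sum_range_succ_mk]
    rw [finsum_eq_sum_of_support_subset (s := Finset.range m.succ)]
    · refine Finset.sum_congr rfl fun k hk => ?_
      have hk' : k ≤ m := by simpa [Nat.lt_succ_iff] using hk
      have hs : m • x - k • x = (m - k) • x := by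
        rw [sub_eq_iff_eq_add, ← add_nsmul]; congr 1; omega
      rw [hs, io_smul hx]
      simp [lm_nsmul_right, lm_self]
    · intro k hk
      by_contra h'
      apply hk
      simp only
      rw [io_ne x p']
      · simp
      · intro j hj
        rw [sub_eq_iff_eq_add, ← add_nsmul] at hj
        have := smul_inj hx hj
        simp at h'
        omega
  · rw [io_ne x _ γ (fun k hk => h ⟨k, hk⟩)]
    apply finsum_eq_zero_of_forall_eq_zero
    intro k
    rw [io_ne x p']
    · simp
    · intro j hj
      rw [sub_eq_iff_eq_add, ← add_nsmul] at hj
      exact h ⟨_, hj⟩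

lemma io_one {x : M} (hx : x ≠ 0) : io x 1 = dl := by
  funext γ
  by_cases h : ∃ m : ℕ, γ = m • x
  · obtain ⟨m, rfl⟩ := h
    rw [io_smul hx, PowerSeries.coeff_one]
    simp [dl, hx]
  · rw [io_ne x _ γ (fun k hk => h ⟨k, hk⟩)]
    have : γ ≠ 0 := by rintro rfl; exact h ⟨0, by simp⟩
    simp [dl, this]

lemma io_two {x y : M} (hxy : lm χ x y ≠ 0) (p p') (a b : ℕ) :
    cv χ (io x p) (io y p') (a • x + b • y) =
      tq ^ (a * b * lm χ x y) * PowerSeries.coeff a p * PowerSeries.coeff b p' := by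
  have hx : x ≠ 0 := by rintro rfl; simp [lm] at hxy
  have hy : y ≠ 0 := by rintro rfl; simp [lm] at hxy
  rw [io_cv χ hx, finsum_eq_single _ a]
  · rw [add_sub_cancel_left, io_smul hy]
    simp only [lm_add_right, lm_nsmul_right, lm_self]
    ring_nf
  · intro k hk
    rw [io_ne]
    · simp
    · intro j hj
      apply hk
      have := congrArg (fun z => lm χ z y) hj
      simp only [lm_sub_left, lm_add_left, lm_nsmul_left, lm_self] at this
      have h2 : ((a : ℤ) - k) * lm χ x y = 0 := by linarith
      rcases mul_eq_zero.1 h2 with h | h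
      · omega
      · exact absurd h hxy

end

end DT

namespace DT

set_option linter.unusedSectionVars false

noncomputable section

lemma one_sub_ne (j : ℕ) (hj : 0 < j) : (1 - tq ^ (2 * j) : RatFunc ℚ) ≠ 0 := by
  intro h
  have h1 : (tq ^ (2 * j) : RatFunc ℚ) = 1 := (sub_eq_zero.1 h).symm
  have h2 : algebraMap (Polynomial ℚ) (RatFunc ℚ) (Polynomial.X ^ (2 * j)) =
      algebraMap (Polynomial ℚ) (RatFunc ℚ) 1 := by
    rw [map_pow, RatFunc.algebraMap_X, map_one]; exact h1
  have h3 := RatFunc.algebraMap_injective ℚ h2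
  have := congrArg Polynomial.natDegree h3
  simp at this
  omega

lemma Pq_zero : Pq 0 = 1 := by simp [Pq]

lemma Pq_succ (k : ℕ) : (1 - tq ^ (2 * (k + 1))) * Pq (k + 1) = Pq k := by
  unfold Pq
  rw [Finset.prod_Icc_succ_top (by omega)]
  have := one_sub_ne (k + 1) (by omega)
  field_simp

/-- The summand of the finite `q`-identity. -/
def Tm (a b k : ℕ) : RatFunc ℚ :=
  if k ≤ a then tq ^ (2 * ((a - k) * (b - k))) * Pq (a - k) * Pq (b - k) * Pq k else 0

lemma Tm_zero (a b : ℕ) :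
    (1 - tq ^ (2 * (a + 1))) * Tm (a + 1) b 0 = Tm a b 0 - (1 - tq ^ (2 * b)) * Tm a b 0 := by
  simp only [Tm, Nat.zero_le, if_true, Nat.sub_zero]
  rw [← Pq_succ a]
  ring

lemma Tm_succ (a b k : ℕ) (hk : k + 1 ≤ b) :
    (1 - tq ^ (2 * (a + 1))) * Tm (a + 1) b (k + 1) =
      Tm a b (k + 1) - (1 - tq ^ (2 * (b - (k + 1)))) * Tm a b (k + 1)
        + (1 - tq ^ (2 * (b - k))) * Tm a b k := by
  obtain ⟨d, rfl⟩ : ∃ d, b = k + 1 + d := ⟨b - (k + 1), by omega⟩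
  have e1 : k + 1 + d - (k + 1) = d := by omega
  have e2 : k + 1 + d - k = d + 1 := by omega
  rcases lt_trichotomy a k with h | h | h
  · have h1 : ¬ (k + 1 ≤ a + 1) := by omega
    have h2 : ¬ (k + 1 ≤ a) := by omega
    have h3 : ¬ (k ≤ a) := by omega
    simp only [Tm, h1, h2, h3, if_false]; ring
  · subst h
    simp only [Tm, e1, e2, le_refl, if_true, Nat.sub_self]
    rw [← Pq_succ d, ← Pq_succ a]
    simp [Pq_zero]
    ring
  · obtain ⟨c, rfl⟩ : ∃ c, a = k + 1 + c := ⟨a - (k + 1), by omega⟩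
    have h1 : (k + 1 ≤ k + 1 + c + 1) := by omega
    have h2 : (k + 1 ≤ k + 1 + c) := by omega
    have h3 : (k ≤ k + 1 + c) := by omega
    have e3 : k + 1 + c + 1 - (k + 1) = c + 1 := by omega
    have e4 : k + 1 + c - (k + 1) = c := by omega
    have e5 : k + 1 + c - k = c + 1 := by omega
    simp only [Tm, h1, h2, h3, if_true, e1, e2, e3, e4, e5]
    rw [← Pq_succ d, ← Pq_succ c, ← Pq_succ k]
    ring

lemma Tm_partial (a b N : ℕ) (hN : N ≤ b) :
    (1 - tq ^ (2 * (a + 1))) * ∑ k ∈ Finset.range (N + 1), Tm (a + 1) b k =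
      ∑ k ∈ Finset.range (N + 1), Tm a b k - (1 - tq ^ (2 * (b - N))) * Tm a b N := by
  induction N with
  | zero => simp only [zero_add, Finset.sum_range_one]; simpa using Tm_zero a b
  | succ N ih =>
    rw [Finset.sum_range_succ, mul_add, ih (by omega), Finset.sum_range_succ _ (N + 1),
      Tm_succ a b N hN]
    ring

lemma q_identity (a b : ℕ) : Pq a * Pq b = ∑ k ∈ Finset.range (b + 1), Tm a b k := by
  induction a with
  | zero =>
    rw [Finset.sum_eq_single 0]
    · simp [Tm, Pq_zero]
    · intro k _ hk
      have : ¬ (k ≤ 0) := by omega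
      simp [Tm, this]
    · simp
  | succ a ih =>
    have h := Tm_partial a b b le_rfl
    rw [← ih, ← Pq_succ a] at h
    simp only [Nat.sub_self, mul_zero, pow_zero, sub_self, zero_mul, sub_zero] at h
    have hne := one_sub_ne (a + 1) (by omega)
    apply mul_left_cancel₀ hne
    rw [h]; ring

/-- The power series of the quantum dilogarithm. -/
def pE : PowerSeries (RatFunc ℚ) := PowerSeries.mk fun k => tq ^ (k ^ 2) * Pq k

variable {M : Type*} [AddCommGroup M] [IsAddTorsionFree M]

/-- Quantum dilogarithm on a lattice. -/
def EE (x : M) : M → RatFunc ℚ := io x pE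
/-- Inverse quantum dilogarithm. -/
def FF (x : M) : M → RatFunc ℚ := io x pE⁻¹

lemma pE_ne : PowerSeries.constantCoeff pE ≠ 0 := by
  rw [← PowerSeries.coeff_zero_eq_constantCoeff_apply]
  simp [pE, Pq_zero]

variable (χ : M →ₗ[ℤ] M →ₗ[ℤ] ℤ)

lemma EE_FF {x : M} (hx : x ≠ 0) : cv χ (EE x) (FF x) = dl := by
  unfold EE FF
  rw [io_mul χ hx, PowerSeries.mul_inv_cancel _ pE_ne, io_one hx]

lemma FF_EE {x : M} (hx : x ≠ 0) : cv χ (FF x) (EE x) = dl := by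
  unfold EE FF
  rw [io_mul χ hx, PowerSeries.inv_mul_cancel _ pE_ne, io_one hx]

lemma EE_supp {x : M} {C : AddSubmonoid M} (hx : x ∈ C) : SuppIn (EE x) C := io_supp _ hx
lemma FF_supp {x : M} {C : AddSubmonoid M} (hx : x ∈ C) : SuppIn (FF x) C := io_supp _ hx

lemma EE_zero {x : M} (hx : x ≠ 0) : EE x 0 = 1 := by
  unfold EE; rw [io_zero hx]; simp [pE, Pq_zero]
lemma FF_zero {x : M} (hx : x ≠ 0) : FF x 0 = 1 := by
  unfold FF; rw [io_zero hx, PowerSeries.coeff_zero_eq_constantCoeff_apply,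
    PowerSeries.constantCoeff_inv, ← PowerSeries.coeff_zero_eq_constantCoeff_apply]
  simp [pE, Pq_zero]

lemma EE_comm {x y : M} (h : lm χ x y = 0) :
    cv χ (EE x) (EE y) = cv χ (EE y) (EE x) := by
  funext γ
  unfold cv
  rw [← finsum_comp_equiv (Equiv.subLeft γ)]
  apply finsum_congr
  intro α
  simp only [Equiv.subLeft_apply, sub_sub_cancel]
  by_cases h1 : EE x (γ - α) = 0
  · simp [h1]
  by_cases h2 : EE y α = 0
  · simp [h2]
  have k1 : ∃ k : ℕ, γ - α = k • x := by
    by_contra hc; push Not at hc; exact h1 (io_ne _ _ _ hc)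
  have k2 : ∃ k : ℕ, α = k • y := by
    by_contra hc; push Not at hc; exact h2 (io_ne _ _ _ hc)
  obtain ⟨k, hk⟩ := k1
  obtain ⟨m, hm⟩ := k2
  have h' : lm χ y x = 0 := by rw [lm_swap, h]; rfl
  rw [hk, hm]
  simp only [lm_nsmul_left, lm_nsmul_right, h, h', mul_zero, zpow_zero]
  ring

lemma mem_pair {x y z : M} : z ∈ AddSubmonoid.closure ({x, y} : Set M) ↔
    ∃ m n : ℕ, m • x + n • y = z := AddSubmonoid.mem_closure_pair x y z

lemma pentagon {x y : M} (h : lm χ x y = -1) :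
    cv χ (EE x) (EE y) = cv χ (EE y) (cv χ (EE (x + y)) (EE x)) := by
  have hyx : lm χ y x = 1 := by rw [lm_swap, h]; rfl
  have hsx : lm χ (x + y) x = 1 := by rw [lm_add_left, lm_self, hyx]; rfl
  have hy : y ≠ 0 := by rintro rfl; simp [lm] at h
  have mx : x ∈ AddSubmonoid.closure ({x, y} : Set M) := AddSubmonoid.subset_closure (by simp)
  have my : y ∈ AddSubmonoid.closure ({x, y} : Set M) := AddSubmonoid.subset_closure (by simp)
  have s1 := cv_supp χ (EE_supp mx) (EE_supp my)
  have s2 := cv_supp χ (EE_supp my)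
    (cv_supp χ (EE_supp (AddSubmonoid.add_mem _ mx my)) (EE_supp mx))
  have s3 : SuppIn (cv χ (EE (x + y)) (EE x)) (AddSubmonoid.closure ({x + y, x} : Set M)) :=
    cv_supp χ (EE_supp (AddSubmonoid.subset_closure (by simp)))
      (EE_supp (AddSubmonoid.subset_closure (by simp)))
  have indep : ∀ a b a' b' : ℤ, a • x + b • y = a' • x + b' • y → a = a' ∧ b = b' := by
    intro a b a' b' e
    have e1 := congrArg (fun z => lm χ z y) e
    have e2 := congrArg (fun z => lm χ z x) e
    simp only [lm_add_left] at e1 e2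
    have z1 : ∀ (c : ℤ) (u v : M), lm χ (c • u) v = c * lm χ u v := by
      intro c u v; simp [lm, mul_sub]
    simp only [z1, lm_self, h, hyx] at e1 e2
    constructor <;> linarith
  funext γ
  by_cases hγ : γ ∈ AddSubmonoid.closure ({x, y} : Set M)
  swap
  · have z1 : cv χ (EE x) (EE y) γ = 0 := by by_contra hc; exact hγ (s1 _ hc)
    have z2 : cv χ (EE y) (cv χ (EE (x + y)) (EE x)) γ = 0 := by
      by_contra hc; exact hγ (s2 _ hc)
    rw [z1, z2]
  obtain ⟨a, b, rfl⟩ := mem_pair.1 hγ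
  have L1 : cv χ (EE x) (EE y) (a • x + b • y) =
      tq ^ (-(a * b) + a ^ 2 + b ^ 2 : ℤ) * (Pq a * Pq b) := by
    unfold EE
    rw [io_two χ (by rw [h]; decide), h]
    simp only [pE, PowerSeries.coeff_mk]
    have : ∀ k : ℕ, (tq ^ (k ^ 2) : RatFunc ℚ) = tq ^ ((k : ℤ) ^ 2) := by
      intro k; rw [← zpow_natCast]; push_cast; rfl
    rw [this, this, zpow_add₀ tq_ne, zpow_add₀ tq_ne]
    ring_nf
  rw [L1, q_identity]
  have R1 : cv χ (EE y) (cv χ (EE (x + y)) (EE x)) (a • x + b • y) =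
      ∑ m ∈ Finset.range (b + 1), tq ^ (m * (a : ℤ)) * (tq ^ (m ^ 2) * Pq m) *
        cv χ (EE (x + y)) (EE x) (a • x + b • y - m • y) := by
    conv_lhs => unfold EE
    rw [io_cv χ hy]
    rw [finsum_eq_sum_of_support_subset (s := Finset.range (b + 1))]
    · refine Finset.sum_congr rfl fun m hm => ?_
      simp only [lm_add_right, lm_nsmul_right, lm_self, hyx, pE, PowerSeries.coeff_mk]
      ring_nf
      rfl
    · intro m hm
      have hne : cv χ (EE (x + y)) (EE x) (a • x + b • y - m • y) ≠ 0 := by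
        intro hc; apply hm
        have hc' : cv χ (io (x + y) pE) (io x pE) (a • x + b • y - m • y) = 0 := hc
        simp only [hc', mul_zero]
      obtain ⟨p, r, hpr⟩ := mem_pair.1 (s3 _ hne)
      have := indep (p + r) p a (b - m) (by
        simp only [add_smul, sub_smul, natCast_zsmul]
        rw [smul_add] at hpr
        rw [← add_sub_assoc, ← hpr]; abel)
      simp
      omega
  rw [R1]
  conv_rhs => rw [← Finset.sum_range_reflect]
  rw [Finset.mul_sum]
  refine Finset.sum_congr rfl fun k hk => ?_
  have hk' : k ≤ b := by simpa [Nat.lt_succ_iff] using hk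
  have e0 : b + 1 - 1 - k = b - k := by omega
  obtain ⟨d, rfl⟩ : ∃ d, b = k + d := ⟨b - k, by omega⟩
  have e1 : k + d - k = d := by omega
  have e2 : a • x + (k + d) • y - d • y = a • x + k • y := by
    rw [add_nsmul]; abel
  rw [e0, e1, e2]
  by_cases hka : k ≤ a
  · obtain ⟨c, rfl⟩ : ∃ c, a = k + c := ⟨a - k, by omega⟩
    have e3 : (k + c) • x + k • y = k • (x + y) + c • x := by
      rw [add_nsmul, smul_add]; abel
    rw [e3]
    conv_rhs => unfold EE
    rw [io_two χ (by rw [hsx]; decide), hsx]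
    have e4 : k + c - k = c := by omega
    simp only [Tm, if_pos hka, pE, PowerSeries.coeff_mk, e4, e1]
    have : ∀ k : ℕ, (tq ^ k : RatFunc ℚ) = tq ^ (k : ℤ) := by
      intro k; rw [← zpow_natCast]
    simp only [this]
    have key : (tq : RatFunc ℚ) ^ (-(((k + c : ℕ) : ℤ) * ((k + d : ℕ) : ℤ)) + ((k + c : ℕ) : ℤ) ^ 2 +
        ((k + d : ℕ) : ℤ) ^ 2 : ℤ) * tq ^ ((2 * (c * d) : ℕ) : ℤ) =
        tq ^ ((d : ℤ) * ((k + c : ℕ) : ℤ)) * tq ^ ((d ^ 2 : ℕ) : ℤ) * tq ^ ((k : ℤ) * c * 1) *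
          tq ^ ((k ^ 2 : ℕ) : ℤ) * tq ^ ((c ^ 2 : ℕ) : ℤ) := by
      simp only [← zpow_add₀ tq_ne]
      congr 1
      push_cast
      ring
    linear_combination (Pq c * Pq d * Pq k) * key
  · have z : cv χ (EE (x + y)) (EE x) (a • x + k • y) = 0 := by
      by_contra hne
      obtain ⟨p, r, hpr⟩ := mem_pair.1 (s3 _ hne)
      have := indep (p + r) p a k (by
        simp only [add_smul, natCast_zsmul]
        rw [smul_add] at hpr
        rw [← hpr]; abel)
      omega
    rw [z]
    simp [Tm, hka]

end

end DT

namespace DT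
set_option linter.unusedSectionVars false

noncomputable section

variable {M : Type*} [AddCommGroup M] [IsAddTorsionFree M] (χ : M →ₗ[ℤ] M →ₗ[ℤ] ℤ)

/-- Ordered product of dilogarithms. -/
def PE : List M → (M → RatFunc ℚ)
  | [] => dl
  | x :: l => cv χ (EE x) (PE l)

lemma PE_supp {C : AddSubmonoid M} : ∀ (l : List M), (∀ x ∈ l, x ∈ C) → SuppIn (PE χ l) C
  | [], _ => dl_supp C
  | x :: l, h => cv_supp χ (EE_supp (h x (by simp)))
      (PE_supp l (fun y hy => h y (by simp [hy])))

lemma PE_append {C : AddSubmonoid M} (hC : FinC C) (l l' : List M) (h : ∀ x ∈ l, x ∈ C)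
    (h' : ∀ x ∈ l', x ∈ C) : PE χ (l ++ l') = cv χ (PE χ l) (PE χ l') := by
  induction l with
  | nil => simp [PE, dl_cv]
  | cons x l ih =>
    have h2 : ∀ y ∈ l, y ∈ C := fun y hy => h y (by simp [hy])
    simp only [List.cons_append, PE]
    rw [ih h2, cv_assoc χ hC (EE_supp (h x (by simp))) (PE_supp χ l h2) (PE_supp χ l' h')]

lemma PE_singleton (x : M) : PE χ [x] = EE x := by simp [PE, cv_dl]

/-- Commuting an element through a list. -/
lemma PE_comm {C : AddSubmonoid M} (hC : FinC C) (x : M) (l : List M) (hx : x ∈ C)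
    (h : ∀ y ∈ l, y ∈ C) (hl : ∀ y ∈ l, lm χ y x = 0) :
    cv χ (PE χ l) (EE x) = cv χ (EE x) (PE χ l) := by
  induction l with
  | nil => simp [PE, dl_cv, cv_dl]
  | cons y l ih =>
    have h2 : ∀ y ∈ l, y ∈ C := fun y hy => h y (by simp [hy])
    have hy := h y (by simp)
    simp only [PE]
    rw [cv_assoc χ hC (EE_supp hy) (PE_supp χ l h2) (EE_supp hx),
      ih h2 (fun z hz => hl z (by simp [hz])),
      ← cv_assoc χ hC (EE_supp hy) (EE_supp hx) (PE_supp χ l h2),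
      EE_comm χ (hl y (by simp)),
      cv_assoc χ hC (EE_supp hx) (EE_supp hy) (PE_supp χ l h2)]

lemma PE_front {C : AddSubmonoid M} (hC : FinC C) (x : M) (l l' : List M) (hx : x ∈ C)
    (h : ∀ y ∈ l, y ∈ C) (h' : ∀ y ∈ l', y ∈ C) (hl : ∀ y ∈ l, lm χ y x = 0) :
    PE χ (l ++ x :: l') = PE χ (x :: (l ++ l')) := by
  have h3 : ∀ y ∈ x :: l', y ∈ C := by simpa using ⟨hx, h'⟩
  rw [PE_append χ hC l _ h h3]
  simp only [PE]
  rw [PE_append χ hC l l' h h', ← cv_assoc χ hC (PE_supp χ l h) (EE_supp hx) (PE_supp χ l' h'),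
    PE_comm χ hC x l hx h hl, cv_assoc χ hC (EE_supp hx) (PE_supp χ l h) (PE_supp χ l' h')]

/-- Two orderings differing only by commutations have the same product. -/
lemma PE_reorder {C : AddSubmonoid M} (hC : FinC C) (S : M → M → Prop)
    (hS : ∀ x y, S x y → S y x → lm χ x y = 0) (l : List M) :
    ∀ l' : List M, l.Perm l' → (∀ x ∈ l, x ∈ C) → l.Pairwise S → l'.Pairwise S →
      PE χ l = PE χ l' := by
  induction l with
  | nil => intro l' h _ _ _; rw [List.nil_perm.1 h]
  | cons x l ih =>
    intro l' hp hm h1 h2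
    have hxl : x ∈ l' := hp.subset (by simp)
    obtain ⟨A, B, rfl⟩ := List.append_of_mem hxl
    have hp' : l.Perm (A ++ B) := by
      have := hp.trans List.perm_middle
      exact (List.perm_cons x).1 this
    have hA : ∀ y ∈ A, y ∈ l := fun y hy => hp'.symm.subset (by simp [hy])
    have hB : ∀ y ∈ B, y ∈ l := fun y hy => hp'.symm.subset (by simp [hy])
    have hm' : ∀ y ∈ l, y ∈ C := fun y hy => hm y (by simp [hy])
    rw [List.pairwise_cons] at h1
    rw [List.pairwise_append] at h2
    obtain ⟨hAp, hBp, hAB⟩ := h2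
    rw [List.pairwise_cons] at hBp
    rw [PE_front χ hC x A B (hm x (by simp)) (fun y hy => hm' y (hA y hy))
      (fun y hy => hm' y (hB y hy))]
    · simp only [PE]
      rw [ih (A ++ B) hp' hm' h1.2]
      rw [List.pairwise_append]
      exact ⟨hAp, hBp.2, fun a ha b hb => hAB a ha b (by simp [hb])⟩
    · intro y hy
      exact hS y x (hAB y hy x (by simp)) (h1.1 y (hA y hy))

/-- The reflection in `x`. -/
def rf (x : M) : M →ₗ[ℤ] M where
  toFun z := z - (χ z x + χ x z) • x
  map_add' a b := by simp only [map_add, LinearMap.add_apply, add_smul]; abel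
  map_smul' c a := by
    simp only [map_smul, LinearMap.smul_apply, RingHom.id_apply, smul_sub, smul_smul, smul_eq_mul,
      mul_add]

lemma rf_apply (x z : M) : rf χ x z = z - (χ z x + χ x z) • x := rfl

lemma rf_self {x : M} (hx : χ x x = 1) : rf χ x x = -x := by
  rw [rf_apply, hx]; module

lemma rf_rf {x : M} (hx : χ x x = 1) (z : M) : rf χ x (rf χ x z) = z := by
  conv_lhs => rw [rf_apply χ x z]
  rw [map_sub, map_smul, rf_self χ hx, rf_apply]; module

lemma rf_form {x : M} (hx : χ x x = 1) (y z : M) :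
    χ (rf χ x y) (rf χ x z) + χ (rf χ x z) (rf χ x y) = χ y z + χ z y := by
  simp only [rf_apply, map_sub, map_smul, LinearMap.sub_apply, LinearMap.smul_apply, hx,
    smul_eq_mul]
  ring

lemma rf_conj {x : M} (hx : χ x x = 1) (y z : M) :
    rf χ (rf χ x y) z = rf χ x (rf χ y (rf χ x z)) := by
  have h := rf_form χ hx y (rf χ x z)
  rw [rf_rf χ hx] at h
  rw [rf_apply χ y (rf χ x z), map_sub, map_smul, rf_rf χ hx, rf_apply χ (rf χ x y) z]
  congr 2
  linarith

lemma rf_form_self {x : M} (hx : χ x x = 1) (y : M) : χ (rf χ x y) (rf χ x y) = χ y y := by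
  have := rf_form χ hx y y
  linarith

/-- The cone generated by a list. -/
def cone (b : List M) : AddSubmonoid M := AddSubmonoid.closure {x | x ∈ b}

lemma mem_cone {b : List M} {x : M} (h : x ∈ b) : x ∈ cone b := AddSubmonoid.subset_closure h

lemma cone_le {b : List M} {C : AddSubmonoid M} (h : ∀ x ∈ b, x ∈ C) : cone b ≤ C :=
  AddSubmonoid.closure_le.2 h

/-- A simple system in the set of roots `Rt`, listed as an exceptional sequence. -/
structure GoodB (Rt : Set M) (b : List M) : Prop where
  mem : ∀ x ∈ b, x ∈ Rt
  exc : b.Pairwise (fun x y => χ x y = 0 ∧ (χ y x = 0 ∨ χ y x = -1))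
  fin : FinC (cone b)
  pt : ∀ x ∈ cone b, -x ∈ cone b → x = 0
  coh : ∀ β ∈ Rt, β ∈ cone b ∨ -β ∈ cone b
  refl : ∀ β ∈ Rt, β ∈ cone b → ∀ x ∈ b, β ≠ x → rf χ x β ∈ cone b

variable {χ}

lemma GoodB.toFront {Rt : Set M} {A B : List M} {x : M} (h : GoodB χ Rt (A ++ x :: B))
    (hA : ∀ a ∈ A, lm χ a x = 0) : GoodB χ Rt (x :: (A ++ B)) := by
  have hmem : ∀ y, y ∈ x :: (A ++ B) ↔ y ∈ A ++ x :: B := by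
    intro y; simp; tauto
  have hc : cone (x :: (A ++ B)) = cone (A ++ x :: B) := by
    unfold cone; congr 1; ext y; exact hmem y
  refine ⟨fun y hy => h.mem y ((hmem y).1 hy), ?_, ?_, ?_, ?_, ?_⟩
  · have := h.exc
    rw [List.pairwise_append, List.pairwise_cons] at this
    obtain ⟨h1, ⟨h2, h3⟩, h4⟩ := this
    rw [List.pairwise_cons, List.pairwise_append]
    refine ⟨?_, h1, h3, fun a ha b hb => h4 a ha b (by simp [hb])⟩
    intro y hy
    rcases List.mem_append.1 hy with hy | hy
    · have e1 := hA y hy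
      have e2 := (h4 y hy x (by simp)).1
      unfold lm at e1
      exact ⟨by omega, Or.inl e2⟩
    · exact h2 y hy
  · rw [hc]; exact h.fin
  · rw [hc]; exact h.pt
  · rw [hc]; exact h.coh
  · rw [hc]; intro β h1 h2 y hy; exact h.refl β h1 h2 y ((hmem y).1 hy)

/-- The reflected simple system. -/
def newB (χ : M →ₗ[ℤ] M →ₗ[ℤ] ℤ) (x : M) (l : List M) : List M := l.map (rf χ x) ++ [-x]

lemma mem_newB_cone {x : M} (hx : χ x x = 1) (l : List M) (z : M) :
    z ∈ cone (newB χ x l) ↔ rf χ x z ∈ cone (x :: l) := by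
  have key : cone (newB χ x l) = (cone (x :: l)).map (rf χ x).toAddMonoidHom := by
    unfold cone
    rw [AddMonoidHom.map_mclosure]
    congr 1
    ext y
    simp only [newB, Set.mem_ofPred_eq, List.mem_append, List.mem_map, List.not_mem_nil, or_false,
      Set.mem_image, List.mem_cons]
    constructor
    · rintro (⟨a, ha, rfl⟩ | rfl)
      · exact ⟨a, Or.inr ha, rfl⟩
      · exact ⟨x, Or.inl rfl, rf_self χ hx⟩
    · rintro ⟨a, rfl | ha, rfl⟩
      · right; exact rf_self χ hx
      · left; exact ⟨a, ha, rfl⟩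
  rw [key, AddSubmonoid.mem_map]
  constructor
  · rintro ⟨a, ha, rfl⟩
    have : rf χ x ((rf χ x).toAddMonoidHom a) = a := rf_rf χ hx a
    rwa [this]
  · intro h
    exact ⟨_, h, rf_rf χ hx z⟩

lemma GoodB.reflect {Rt : Set M} (hR1 : ∀ x ∈ Rt, χ x x = 1)
    (hR2 : ∀ x ∈ Rt, ∀ y ∈ Rt, rf χ x y ∈ Rt) {x : M} {l : List M} (h : GoodB χ Rt (x :: l)) :
    GoodB χ Rt (newB χ x l) := by
  have hxR := h.mem x (by simp)
  have hx := hR1 x hxR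
  have hc := mem_newB_cone hx l
  have hmem : ∀ y ∈ newB χ x l, ∃ z ∈ x :: l, y = rf χ x z := by
    intro y hy
    simp only [newB, List.mem_append, List.mem_map, List.mem_singleton] at hy
    rcases hy with ⟨a, ha, rfl⟩ | rfl
    · exact ⟨a, by simp [ha], rfl⟩
    · exact ⟨x, by simp, (rf_self χ hx).symm⟩
  have hexc := h.exc
  rw [List.pairwise_cons] at hexc
  refine ⟨?_, ?_, ?_, ?_, ?_, ?_⟩
  · intro y hy
    obtain ⟨z, hz, rfl⟩ := hmem y hy
    exact hR2 x hxR z (h.mem z hz)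
  · unfold newB
    rw [List.pairwise_append]
    refine ⟨?_, by simp, ?_⟩
    · rw [List.pairwise_map]
      refine List.Pairwise.imp_of_mem ?_ hexc.2
      intro a b ha hb hab
      have h1 := (hexc.1 a ha).1
      have h2 := (hexc.1 b hb).1
      have e1 : χ (rf χ x a) (rf χ x b) = χ a b := by
        simp only [rf_apply, map_sub, map_smul, LinearMap.sub_apply, LinearMap.smul_apply, hx,
          smul_eq_mul, h1, h2]
        ring
      have e2 : χ (rf χ x b) (rf χ x a) = χ b a := by
        simp only [rf_apply, map_sub, map_smul, LinearMap.sub_apply, LinearMap.smul_apply, hx,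
          smul_eq_mul, h1, h2]
        ring
      rw [e1, e2]; exact hab
    · intro y hy z hz
      simp only [List.mem_singleton] at hz
      subst hz
      obtain ⟨a, ha, rfl⟩ := List.mem_map.1 hy
      have h1 := (hexc.1 a ha).1
      have e1 : χ (rf χ x a) (-x) = 0 := by
        simp only [rf_apply, map_sub, map_smul, LinearMap.sub_apply, LinearMap.smul_apply, hx,
          smul_eq_mul, h1, map_neg]
        ring
      have e2 : χ (-x) (rf χ x a) = χ a x := by
        simp only [rf_apply, map_sub, map_smul, hx,
          smul_eq_mul, h1, map_neg, LinearMap.neg_apply]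
        ring
      rw [e1, e2]; exact ⟨rfl, (hexc.1 a ha).2⟩
  · intro γ
    refine Set.Finite.subset ((h.fin (rf χ x γ)).image (rf χ x)) ?_
    rintro α ⟨h1, h2⟩
    refine ⟨rf χ x α, ⟨(hc _).1 h1, ?_⟩, rf_rf χ hx α⟩
    rw [← map_sub]; exact (hc _).1 h2
  · intro z h1 h2
    have := h.pt (rf χ x z) ((hc _).1 h1) (by rw [← map_neg]; exact (hc _).1 h2)
    rw [← rf_rf χ hx z, this, map_zero]
  · intro β hβ
    rw [hc, hc, map_neg]
    exact h.coh _ (hR2 x hxR β hβ)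
  · intro β hβ h1 y hy hne
    obtain ⟨z, hz, rfl⟩ := hmem y hy
    rw [hc, rf_conj χ hx, rf_rf χ hx]
    refine h.refl _ (hR2 x hxR β hβ) ((hc _).1 h1) z hz ?_
    rintro rfl
    exact hne (rf_rf χ hx β).symm

/-- The intermediate list `G`. -/
def midL (χ : M →ₗ[ℤ] M →ₗ[ℤ] ℤ) (x : M) : List M → List M
  | [] => []
  | y :: l => if χ y x = 0 then y :: midL χ x l else y :: (y + x) :: midL χ x l

lemma midL_mem (x : M) {C : AddSubmonoid M} : ∀ (l : List M), (∀ y ∈ l, y ∈ C) →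
    (∀ y ∈ l, χ y x ≠ 0 → y + x ∈ C) → ∀ y ∈ midL χ x l, y ∈ C
  | [], _, _ => by simp [midL]
  | y :: l, h1, h2 => by
    have ih := midL_mem x l (fun z hz => h1 z (by simp [hz])) (fun z hz => h2 z (by simp [hz]))
    unfold midL
    split_ifs with h
    · simpa using ⟨h1 y (by simp), ih⟩
    · simpa using ⟨h1 y (by simp), h2 y (by simp) h, ih⟩

lemma mid_right {x : M} (hx : χ x x = 1) {C : AddSubmonoid M} (hC : FinC C) (hxC : x ∈ C) :
    ∀ (l : List M), (∀ y ∈ l, y ∈ C) → (∀ y ∈ l, χ x y = 0 ∧ (χ y x = 0 ∨ χ y x = -1)) →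
    cv χ (EE x) (PE χ l) = cv χ (PE χ (midL χ x l)) (EE x)
  | [], _, _ => by simp [midL, PE, dl_cv, cv_dl]
  | y :: l, h1, h2 => by
    have l1 : ∀ z ∈ l, z ∈ C := fun z hz => h1 z (by simp [hz])
    have ih := mid_right hx hC hxC l l1 (fun z hz => h2 z (by simp [hz]))
    have hy := h1 y (by simp)
    have hyx : y + x ∈ C := C.add_mem hy hxC
    have hm := PE_supp χ _ (midL_mem (χ := χ) x l l1 (fun z hz _ => C.add_mem (l1 z hz) hxC))
    obtain ⟨h3, h4⟩ := h2 y (by simp)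
    have sx : SuppIn (EE x) C := EE_supp hxC
    have sy : SuppIn (EE y) C := EE_supp hy
    have sxy : SuppIn (EE (y + x)) C := EE_supp hyx
    have sl := PE_supp χ l l1
    by_cases h : χ y x = 0
    · simp only [midL, if_pos h, PE]
      rw [cv_assoc χ hC sy hm sx, ← ih, ← cv_assoc χ hC sx sy sl,
        EE_comm χ (x := x) (y := y) (by simp [lm, h, h3]), cv_assoc χ hC sy sx sl]
    · simp only [midL, if_neg h, PE]
      have h5 : χ y x = -1 := by tauto
      rw [cv_assoc χ hC sy (cv_supp χ sxy hm) sx, cv_assoc χ hC sxy hm sx, ← ih,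
        ← cv_assoc χ hC sx sy sl, pentagon χ (x := x) (y := y) (by simp [lm, h5, h3]),
        add_comm x y, cv_assoc χ hC sy (cv_supp χ sxy sx) sl, cv_assoc χ hC sxy sx sl]

lemma mid_left {x : M} (hx : χ x x = 1) {C : AddSubmonoid M} (hC : FinC C) (hxC : -x ∈ C) :
    ∀ (l : List M), (∀ y ∈ l, rf χ x y ∈ C) →
    (∀ y ∈ l, χ x y = 0 ∧ (χ y x = 0 ∨ χ y x = -1)) →
    cv χ (EE (-x)) (PE χ (midL χ x l)) = cv χ (PE χ (l.map (rf χ x))) (EE (-x))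
  | [], _, _ => by simp [midL, PE, dl_cv, cv_dl]
  | y :: l, h1, h2 => by
    have l1 : ∀ z ∈ l, rf χ x z ∈ C := fun z hz => h1 z (by simp [hz])
    have l2 := fun z (hz : z ∈ l) => h2 z (by simp [hz])
    have ih := mid_left hx hC hxC l l1 l2
    have r0 : ∀ z, χ x z = 0 → χ z x = 0 → rf χ x z = z := by
      intro z e1 e2; rw [rf_apply, e1, e2]; simp
    have r1 : ∀ z, χ x z = 0 → χ z x = -1 → rf χ x z = z + x := by
      intro z e1 e2; rw [rf_apply, e1, e2]; simp
    have hm := PE_supp χ _ (midL_mem (χ := χ) (C := C) x l (fun z hz => by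
        have := l1 z hz
        obtain ⟨e1, e2 | e2⟩ := l2 z hz
        · rwa [r0 z e1 e2] at this
        · rw [r1 z e1 e2] at this
          simpa using C.add_mem this hxC) (fun z hz hne => by
        have := l1 z hz
        obtain ⟨e1, e2 | e2⟩ := l2 z hz
        · exact absurd e2 hne
        · rwa [r1 z e1 e2] at this))
    obtain ⟨h3, h4⟩ := h2 y (by simp)
    have hy := h1 y (by simp)
    have sx : SuppIn (EE (-x)) C := EE_supp hxC
    have sl := PE_supp χ (l.map (rf χ x)) (C := C) (by simpa using l1)
    by_cases h : χ y x = 0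
    · have sy : SuppIn (EE y) C := EE_supp (by rwa [r0 y h3 h] at hy)
      simp only [midL, if_pos h, PE, List.map_cons]
      rw [r0 y h3 h, cv_assoc χ hC sy sl sx, ← ih, ← cv_assoc χ hC sx sy hm,
        EE_comm χ (x := -x) (y := y) (by simp [lm, h, h3]), cv_assoc χ hC sy sx hm]
    · have h5 : χ y x = -1 := by tauto
      rw [r1 y h3 h5] at hy
      have hy' : y ∈ C := by simpa using C.add_mem hy hxC
      have sy : SuppIn (EE y) C := EE_supp hy'
      have sxy : SuppIn (EE (y + x)) C := EE_supp hy
      simp only [midL, if_neg h, PE, List.map_cons]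
      have pent := pentagon χ (x := y + x) (y := -x) (by simp [lm, h5, h3, hx])
      rw [add_neg_cancel_right] at pent
      rw [r1 y h3 h5, cv_assoc χ hC sxy sl sx, ← ih, ← cv_assoc χ hC sxy sx hm, pent,
        cv_assoc χ hC sx (cv_supp χ sy sxy) hm, cv_assoc χ hC sy sxy hm]

end

end DT

namespace DT
set_option linter.unusedSectionVars false

noncomputable section

variable {M : Type*} [AddCommGroup M] [IsAddTorsionFree M] {χ : M →ₗ[ℤ] M →ₗ[ℤ] ℤ}

/-- Split a list at the first element satisfying a predicate. -/
lemma split_first (p : M → Prop) : ∀ (l : List M), (∃ x ∈ l, p x) →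
    ∃ A x B, l = A ++ x :: B ∧ p x ∧ ∀ a ∈ A, ¬ p a
  | [], h => by simp at h
  | y :: l, h => by
    by_cases hy : p y
    · exact ⟨[], y, l, rfl, hy, by simp⟩
    · have : ∃ x ∈ l, p x := by
        obtain ⟨x, hx, hpx⟩ := h
        rcases List.mem_cons.1 hx with rfl | hx
        · exact absurd hpx hy
        · exact ⟨x, hx, hpx⟩
      obtain ⟨A, x, B, rfl, h1, h2⟩ := split_first p l this
      refine ⟨y :: A, x, B, rfl, h1, ?_⟩
      intro a ha
      rcases List.mem_cons.1 ha with rfl | ha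
      · exact hy
      · exact h2 a ha

lemma PE_at_zero {C : AddSubmonoid M} (hp : ∀ x ∈ C, -x ∈ C → x = 0) :
    ∀ (l : List M), (∀ x ∈ l, x ∈ C) → (∀ x ∈ l, x ≠ 0) → PE χ l 0 = 1
  | [], _, _ => by simp [PE, dl]
  | x :: l, h, h0 => by
    have l1 : ∀ z ∈ l, z ∈ C := fun z hz => h z (by simp [hz])
    simp only [PE]
    rw [cv_zero χ hp (EE_supp (h x (by simp))) (PE_supp χ l l1), EE_zero (h0 x (by simp)),
      PE_at_zero hp l l1 (fun z hz => h0 z (by simp [hz])), one_mul]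

theorem core {Rt : Set M} (hR1 : ∀ x ∈ Rt, χ x x = 1)
    (hR2 : ∀ x ∈ Rt, ∀ y ∈ Rt, rf χ x y ∈ Rt)
    {C : AddSubmonoid M} (hCp : ∀ x ∈ C, -x ∈ C → x = 0)
    (hCc : ∀ β ∈ Rt, β ∈ C ∨ -β ∈ C) :
    ∀ (N : ℕ) (L R b : List M) (U : M → RatFunc ℚ), L.length = N → GoodB χ Rt b →
      (∀ x ∈ L, x ∈ Rt ∧ x ∈ C ∧ x ∈ cone b) →
      (∀ x ∈ R, x ∈ Rt ∧ x ∈ C ∧ -x ∈ cone b) →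
      (∀ β ∈ Rt, β ∈ C → β ∈ L ∨ β ∈ R) →
      L.Pairwise (fun x y => 0 ≤ lm χ x y) →
      (∀ x ∈ L, ∀ y ∈ R, 0 ≤ lm χ x y) → L.Nodup →
      SuppIn U (cone (R.map (fun x => -x))) → U 0 = 1 →
      SuppIn (cv χ U (PE χ b)) C →
      cv χ U (PE χ b) = PE χ L := by
  have hneg : ∀ x ∈ Rt, -x ∈ Rt := by
    intro x hx
    have := hR2 x hx x hx
    rwa [rf_self χ (hR1 x hx)] at this
  have hne : ∀ x ∈ Rt, x ≠ 0 := by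
    rintro x hx rfl
    have := hR1 0 hx
    simp at this
  intro N
  induction N with
  | zero =>
    intro L R b U hN hb hL hR hcov _ _ _ hU hU0 hX
    have hL0 : L = [] := List.length_eq_zero_iff.1 hN
    subst hL0
    have hUb : SuppIn U (cone b) := hU.mono (cone_le (by
      intro x hx
      obtain ⟨y, hy, rfl⟩ := List.mem_map.1 hx
      exact (hR y hy).2.2))
    have hbm : ∀ x ∈ b, x ∈ cone b := fun x hx => mem_cone hx
    have hPb := PE_supp χ b hbm
    have hbneg : ∀ x ∈ b, -x ∈ C := by
      intro x hx
      rcases hCc x (hb.mem x hx) with h | h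
      · rcases hcov x (hb.mem x hx) h with h' | h'
        · simp at h'
        · exact absurd (hb.pt x (hbm x hx) (hR x h').2.2) (hne x (hb.mem x hx))
      · exact h
    have hcb : ∀ x ∈ cone b, -x ∈ C := by
      intro x hx
      induction hx using AddSubmonoid.closure_induction with
      | mem x hx => exact hbneg x hx
      | zero => simpa using C.zero_mem
      | add x y _ _ h1 h2 => rw [neg_add]; exact C.add_mem h1 h2
    have hXb := cv_supp χ hUb hPb
    funext γ
    by_cases hγ : γ = 0
    · subst hγ
      rw [cv_zero χ hb.pt hUb hPb, hU0,
        PE_at_zero hb.pt b hbm (fun x hx => hne x (hb.mem x hx))]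
      simp [PE, dl]
    · have : cv χ U (PE χ b) γ = 0 := by
        by_contra hc
        exact hγ (hCp γ (hX γ hc) (hcb γ (hXb γ hc)))
      rw [this]
      simp [PE, dl, hγ]
  | succ N ih =>
    intro L R b0 U hN hb0 hL0 hR0 hcov hLp hLR hLn hU hU0 hX0
    -- find the first simple root in `C`
    have hex : ∃ x ∈ b0, x ∈ C := by
      by_contra hcon
      push Not at hcon
      have hcb : ∀ x ∈ cone b0, -x ∈ C := by
        intro x hx
        induction hx using AddSubmonoid.closure_induction with
        | mem x hx => exact (hCc x (hb0.mem x hx)).resolve_left (hcon x hx)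
        | zero => simpa using C.zero_mem
        | add x y _ _ h1 h2 => rw [neg_add]; exact C.add_mem h1 h2
      obtain ⟨y, hy⟩ : ∃ y, y ∈ L := by
        rcases L with _ | ⟨y, l⟩
        · simp at hN
        · exact ⟨y, by simp⟩
      obtain ⟨y1, y2, y3⟩ := hL0 y hy
      exact hne y y1 (hCp y y2 (hcb y y3))
    obtain ⟨A, x, B, rfl, hxC, hA⟩ := split_first (fun z => z ∈ C) b0 hex
    have hxR : x ∈ Rt := hb0.mem x (by simp)
    have hxx := hR1 x hxR
    have hx0 := hne x hxR
    have hxL : x ∈ L := by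
      rcases hcov x hxR hxC with h | h
      · exact h
      · exact absurd (hb0.pt x (mem_cone (by simp)) (hR0 x h).2.2) hx0
    have hA0 : ∀ a ∈ A, lm χ a x = 0 := by
      intro a ha
      have haR : a ∈ Rt := hb0.mem a (by simp [ha])
      have hac : a ∈ cone (A ++ x :: B) := mem_cone (by simp [ha])
      have h1 : -a ∈ C := (hCc a haR).resolve_left (hA a ha)
      have h2 : -a ∈ R := by
        rcases hcov (-a) (hneg a haR) h1 with h | h
        · exact absurd (hb0.pt a hac (hL0 _ h).2.2) (hne a haR)
        · exact h
      have h3 := hLR x hxL (-a) h2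
      have h4 := hb0.exc
      rw [List.pairwise_append] at h4
      have h5 := h4.2.2 a ha x (by simp)
      simp only [lm, map_neg, LinearMap.neg_apply] at h3 ⊢
      omega
    have hb := hb0.toFront hA0
    have hcm : ∀ z, z ∈ cone (A ++ x :: B) ↔ z ∈ cone (x :: (A ++ B)) := by
      intro z
      have : cone (x :: (A ++ B)) = cone (A ++ x :: B) := by
        unfold cone; congr 1; ext y
        show y ∈ _ ↔ y ∈ _
        simp; tauto
      rw [this]
    have hfront : PE χ (A ++ x :: B) = PE χ (x :: (A ++ B)) :=
      PE_front χ hb0.fin x A B (mem_cone (by simp)) (fun y hy => mem_cone (by simp [hy]))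
        (fun y hy => mem_cone (by simp [hy])) hA0
    rw [hfront] at hX0 ⊢
    simp only [hcm] at hL0 hR0
    clear hcm hfront hb0 hex hA0 hA
    generalize A ++ B = l at *
    -- now the simple system is `x :: l`
    have hb' := hb.reflect hR1 hR2
    have hexc := hb.exc
    rw [List.pairwise_cons] at hexc
    have hmc := mem_newB_cone (χ := χ) hxx l
    have hxc : x ∈ cone (x :: l) := mem_cone (by simp)
    have hlc : ∀ y ∈ l, y ∈ cone (x :: l) := fun y hy => mem_cone (by simp [hy])
    have hxc' : -x ∈ cone (newB χ x l) := mem_cone (by simp [newB])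
    have hlc' : ∀ y ∈ l, rf χ x y ∈ cone (newB χ x l) :=
      fun y hy => mem_cone (by simp only [newB, List.mem_append, List.mem_map]; exact Or.inl ⟨y, hy, rfl⟩)
    have hmid : ∀ y ∈ midL χ x l, y ∈ cone (x :: l) :=
      midL_mem x l hlc (fun y hy _ => AddSubmonoid.add_mem _ (hlc y hy) hxc)
    have r0 : ∀ z, χ x z = 0 → χ z x = 0 → rf χ x z = z := by
      intro z e1 e2; rw [rf_apply, e1, e2]; simp
    have r1 : ∀ z, χ x z = 0 → χ z x = -1 → rf χ x z = z + x := by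
      intro z e1 e2; rw [rf_apply, e1, e2]; simp
    have hmid' : ∀ y ∈ midL χ x l, y ∈ cone (newB χ x l) := by
      refine midL_mem x l ?_ ?_
      · intro z hz
        have := hlc' z hz
        obtain ⟨e1, e2 | e2⟩ := hexc.1 z hz
        · rwa [r0 z e1 e2] at this
        · rw [r1 z e1 e2] at this
          simpa using AddSubmonoid.add_mem _ this hxc'
      · intro z hz hn
        have := hlc' z hz
        obtain ⟨e1, e2 | e2⟩ := hexc.1 z hz
        · exact absurd e2 hn
        · rwa [r1 z e1 e2] at this
    have sG := PE_supp χ _ hmid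
    have sG' := PE_supp χ _ hmid'
    have hkeep : ∀ β ∈ Rt, β ∈ cone (x :: l) → β ≠ x → β ∈ cone (newB χ x l) := by
      intro β h1 h2 h3
      rw [hmc]
      exact hb.refl β h1 h2 x (by simp) h3
    have hRx : ∀ y ∈ R, -y ∈ cone (newB χ x l) := by
      intro y hy
      obtain ⟨y1, y2, y3⟩ := hR0 y hy
      refine hkeep (-y) (hneg y y1) y3 ?_
      intro e
      have : -y ∈ C := by rw [e]; exact hxC
      exact hne y y1 (hCp y y2 this)
    have sU : SuppIn U (cone (x :: l)) := hU.mono (cone_le (by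
      intro z hz
      obtain ⟨y, hy, rfl⟩ := List.mem_map.1 hz
      exact (hR0 y hy).2.2))
    have sU' : SuppIn U (cone (newB χ x l)) := hU.mono (cone_le (by
      intro z hz
      obtain ⟨y, hy, rfl⟩ := List.mem_map.1 hz
      exact hRx y hy))
    have sx : SuppIn (EE x) (cone (x :: l)) := EE_supp hxc
    have sFx : SuppIn (FF x) (cone (x :: l)) := FF_supp hxc
    have sx' : SuppIn (EE (-x)) (cone (newB χ x l)) := EE_supp hxc'
    have sFx' : SuppIn (FF (-x)) (cone (newB χ x l)) := FF_supp hxc'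
    have hnx0 : -x ≠ 0 := neg_ne_zero.2 hx0
    -- the two expressions
    have e1 : cv χ U (PE χ (x :: l)) = cv χ (cv χ U (PE χ (midL χ x l))) (EE x) := by
      show cv χ U (cv χ (EE x) (PE χ l)) = _
      rw [mid_right hxx hb.fin hxc l hlc hexc.1, cv_assoc χ hb.fin sU sG sx]
    have e2 : cv χ (cv χ U (FF (-x))) (PE χ (newB χ x l)) = cv χ U (PE χ (midL χ x l)) := by
      have : PE χ (newB χ x l) = cv χ (EE (-x)) (PE χ (midL χ x l)) := by
        rw [mid_left hxx hb'.fin hxc' l hlc' hexc.1]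
        unfold newB
        rw [PE_append χ hb'.fin _ _ (by simpa using hlc') (by simpa using hxc'), PE_singleton]
      rw [this, cv_assoc χ hb'.fin sU' sFx' (cv_supp χ sx' sG'),
        ← cv_assoc χ hb'.fin sFx' sx' sG', FF_EE χ hnx0, dl_cv]
    have e3 : SuppIn (cv χ U (PE χ (midL χ x l))) C := by
      have : cv χ U (PE χ (midL χ x l)) = cv χ (cv χ U (PE χ (x :: l))) (FF x) := by
        rw [e1, cv_assoc χ hb.fin (cv_supp χ sU sG) sx sFx, EE_FF χ hx0, cv_dl]
      rw [this]
      exact cv_supp χ hX0 (FF_supp hxC)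
    obtain ⟨L1, L2, rfl⟩ := List.append_of_mem hxL
    have hnd := hLn
    rw [List.nodup_middle, List.nodup_cons] at hnd
    have hLp2 := hLp
    rw [List.pairwise_append, List.pairwise_cons] at hLp2
    obtain ⟨p1, ⟨p2, p3⟩, p4⟩ := hLp2
    have hLm : ∀ y ∈ L1 ++ L2, y ∈ L1 ++ x :: L2 := by
      intro y hy; rcases List.mem_append.1 hy with h | h <;> simp [h]
    -- elements after `x` commute with `x`
    have hle : ∀ β ∈ cone (x :: l), lm χ x β ≤ 0 := by
      intro β hβ
      induction hβ using AddSubmonoid.closure_induction with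
      | mem z hz =>
        rcases List.mem_cons.1 hz with rfl | hz
        · rw [lm_self]
        · have := hexc.1 z hz
          unfold lm
          omega
      | zero => rw [lm_zero_right]
      | add y z _ _ h1 h2 => rw [lm_add_right]; omega
    have hL2 : ∀ y ∈ L2, lm χ y x = 0 := by
      intro y hy
      have h1 := p2 y hy
      have h2 := hle y (hL0 y (by simp [hy])).2.2
      rw [lm_swap]; omega
    have e4 : PE χ (L1 ++ x :: L2) = cv χ (PE χ (L1 ++ L2)) (EE x) := by
      have c1 : ∀ y ∈ L1, y ∈ cone (x :: l) := fun y hy => (hL0 y (by simp [hy])).2.2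
      have c2 : ∀ y ∈ L2, y ∈ cone (x :: l) := fun y hy => (hL0 y (by simp [hy])).2.2
      have c3 : ∀ y ∈ x :: L2, y ∈ cone (x :: l) := by simpa using ⟨hxc, c2⟩
      rw [PE_append χ hb.fin L1 _ c1 c3, PE_append χ hb.fin L1 L2 c1 c2,
        cv_assoc χ hb.fin (PE_supp χ _ c1) (PE_supp χ _ c2) sx, PE_comm χ hb.fin x L2 hxc c2 hL2]
      rfl
    rw [e1, e4, ← e2]
    congr 1
    refine ih (L1 ++ L2) (x :: R) (newB χ x l) (cv χ U (FF (-x))) ?_ hb' ?_ ?_ ?_ ?_ ?_ hnd.2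
      ?_ ?_ ?_
    · simp at hN ⊢; omega
    · intro y hy
      obtain ⟨y1, y2, y3⟩ := hL0 y (hLm y hy)
      refine ⟨y1, y2, hkeep y y1 y3 ?_⟩
      rintro rfl
      exact hnd.1 hy
    · intro y hy
      rcases List.mem_cons.1 hy with rfl | hy
      · exact ⟨hxR, hxC, hxc'⟩
      · exact ⟨(hR0 y hy).1, (hR0 y hy).2.1, hRx y hy⟩
    · intro β h1 h2
      have := hcov β h1 h2
      simp only [List.mem_append, List.mem_cons] at this ⊢
      tauto
    · rw [List.pairwise_append]
      exact ⟨p1, p3, fun a ha c hc => p4 a ha c (by simp [hc])⟩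
    · intro y hy z hz
      rcases List.mem_cons.1 hz with rfl | hz
      · rcases List.mem_append.1 hy with hy | hy
        · exact p4 y hy z (by simp)
        · rw [hL2 y hy]
      · exact hLR y (hLm y hy) z hz
    · refine cv_supp χ (hU.mono (cone_le ?_)) (FF_supp (mem_cone (by simp)))
      intro z hz
      exact mem_cone (by simp only [List.map_cons, List.mem_cons]; exact Or.inr hz)
    · rw [cv_zero χ hb'.pt sU' sFx', hU0, FF_zero hnx0, one_mul]
    · rw [e2]; exact e3

end

end DT

namespace DT

set_option linter.unusedSectionVars false

noncomputable section


variable {n : ℕ} (Q : Quiv n)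

lemma chi_eq (x y : Fin n → ℤ) :
    Q.chi x y = (∑ i, x i * y i) - ∑ a, x (Q.ta a) * y (Q.ha a) := rfl

/-- The Euler form as a bilinear map. -/
def chiL : (Fin n → ℤ) →ₗ[ℤ] (Fin n → ℤ) →ₗ[ℤ] ℤ :=
  LinearMap.mk₂ ℤ Q.chi
    (by intro x y z; simp only [chi_eq, Pi.add_apply, add_mul, Finset.sum_add_distrib]; ring)
    (by
      intro c x y
      simp only [chi_eq, Pi.smul_apply, smul_eq_mul, mul_sub, Finset.mul_sum, mul_assoc])
    (by intro x y z; simp only [chi_eq, Pi.add_apply, mul_add, Finset.sum_add_distrib]; ring)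
    (by
      intro c x y
      simp only [chi_eq, Pi.smul_apply, smul_eq_mul, mul_sub, Finset.mul_sum, mul_left_comm])

lemma chiL_apply (x y : Fin n → ℤ) : chiL Q x y = Q.chi x y := rfl

lemma lm_chiL (x y : Fin n → ℤ) : lm (chiL Q) x y = Q.lam x y := rfl

/-- The nonnegative orthant. -/
def orth (n : ℕ) : AddSubmonoid (Fin n → ℤ) where
  carrier := {x | ∀ i, 0 ≤ x i}
  zero_mem' := fun i => le_refl _
  add_mem' := fun {x y} hx hy i => add_nonneg (hx i) (hy i)

lemma mem_orth {x : Fin n → ℤ} : x ∈ orth n ↔ ∀ i, 0 ≤ x i := Iff.rfl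

lemma orth_fin : FinC (orth n) := by
  intro γ
  refine (Set.finite_Icc (0 : Fin n → ℤ) γ).subset ?_
  rintro α ⟨h1, h2⟩
  refine ⟨fun i => h1 i, fun i => ?_⟩
  have := h2 i
  exact sub_nonneg.1 this

lemma FinC.mono {M : Type*} [AddCommGroup M] {C D : AddSubmonoid M} (hD : FinC D) (h : C ≤ D) :
    FinC C := fun γ => (hD γ).subset fun _ hα => ⟨h hα.1, h hα.2⟩

lemma toZ_mem (γ : Fin n → ℕ) : Quiv.toZ γ ∈ orth n := fun i => by simp [Quiv.toZ]

lemma toZ_inj : Function.Injective (Quiv.toZ : (Fin n → ℕ) → _) := by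
  intro a b h
  funext i
  have := congrFun h i
  simpa [Quiv.toZ] using this

lemma toZ_surj {x : Fin n → ℤ} (hx : x ∈ orth n) : ∃ γ, Quiv.toZ γ = x :=
  ⟨fun i => (x i).toNat, by funext i; simp [Quiv.toZ, hx i]⟩

lemma toZ_zero : Quiv.toZ (0 : Fin n → ℕ) = 0 := by funext i; simp [Quiv.toZ]

lemma toZ_nsmul (k : ℕ) (γ : Fin n → ℕ) : Quiv.toZ (k • γ) = k • Quiv.toZ γ := by
  funext i; simp [Quiv.toZ]

lemma toZ_sub {α γ : Fin n → ℕ} (h : α ≤ γ) : Quiv.toZ (γ - α) = Quiv.toZ γ - Quiv.toZ α := by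
  funext i
  simp only [Quiv.toZ, Pi.sub_apply]
  exact Nat.cast_sub (h i)

/-- Extension by zero. -/
def xt (f : AQ n) : (Fin n → ℤ) → RatFunc ℚ := Function.extend Quiv.toZ f 0

lemma xt_toZ (f : AQ n) (γ : Fin n → ℕ) : xt f (Quiv.toZ γ) = f γ := toZ_inj.extend_apply _ _ _

lemma xt_supp (f : AQ n) : SuppIn (xt f) (orth n) := by
  intro x hx
  by_contra h
  apply hx
  unfold xt
  rw [Function.extend_apply' _ _ _ (by rintro ⟨γ, rfl⟩; exact h (toZ_mem γ))]
  rfl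

lemma xt_inj {f g : AQ n} (h : xt f = xt g) : f = g := by
  funext γ
  rw [← xt_toZ f, ← xt_toZ g, h]

lemma xt_ext {f : AQ n} {g : (Fin n → ℤ) → RatFunc ℚ} (hg : SuppIn g (orth n))
    (h : ∀ γ, f γ = g (Quiv.toZ γ)) : xt f = g := by
  funext x
  by_cases hx : x ∈ orth n
  · obtain ⟨γ, rfl⟩ := toZ_surj hx
    rw [xt_toZ, h]
  · have h1 : xt f x = 0 := by
      by_contra h'; exact hx (xt_supp f x h')
    have h2 : g x = 0 := by
      by_contra h'; exact hx (hg x h')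
    rw [h1, h2]

lemma xt_one : xt (oneQ : AQ n) = dl := by
  refine xt_ext (dl_supp _) fun γ => ?_
  unfold oneQ dl
  by_cases h : γ = 0
  · simp [h, toZ_zero]
  · have : Quiv.toZ γ ≠ 0 := fun h' => h (toZ_inj (h'.trans toZ_zero.symm))
    simp [h, this]

lemma xt_mul (f g : AQ n) : xt (mulQ Q f g) = cv (chiL Q) (xt f) (xt g) := by
  refine xt_ext (cv_supp _ (xt_supp f) (xt_supp g)) fun γ => ?_
  rw [cv_eq_sum (chiL Q) (xt_supp f) (xt_supp g) (Quiv.toZ γ) ((Finset.Iic γ).image Quiv.toZ)]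
  · rw [Finset.sum_image (fun a _ b _ h => toZ_inj h)]
    unfold mulQ
    refine Finset.sum_congr rfl fun α hα => ?_
    have hα' := Finset.mem_Iic.1 hα
    rw [← toZ_sub hα', xt_toZ, xt_toZ, lm_chiL]
  · intro α h1 h2
    obtain ⟨a, rfl⟩ := toZ_surj h1
    refine Finset.mem_image_of_mem _ (Finset.mem_Iic.2 fun i => ?_)
    have := h2 i
    have h3 : ((a i : ℕ) : ℤ) ≤ ((γ i : ℕ) : ℤ) := sub_nonneg.1 this
    exact_mod_cast h3

lemma xt_E {γ : Fin n → ℕ} (hγ : γ ≠ 0) : xt (Edl γ) = EE (Quiv.toZ γ) := by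
  have hz : Quiv.toZ γ ≠ 0 := fun h' => hγ (toZ_inj (h'.trans toZ_zero.symm))
  refine xt_ext (EE_supp (toZ_mem γ)) fun δ => ?_
  unfold Edl EE
  by_cases h : ∃ k : ℕ, δ = k • γ
  · obtain ⟨k, rfl⟩ := h
    rw [toZ_nsmul, io_smul hz, pE, PowerSeries.coeff_mk, Finset.sum_eq_single k]
    · simp
    · intro b _ hb
      rw [if_neg]
      intro h
      have := congrArg Quiv.toZ h
      rw [toZ_nsmul, toZ_nsmul] at this
      exact hb (smul_inj hz this).symm
    · intro h
      exfalso
      apply h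
      rw [Finset.mem_range]
      obtain ⟨i, hi⟩ : ∃ i, γ i ≠ 0 := by
        by_contra! h'; exact hγ (funext h')
      have h1 : (k • γ) i ≤ ∑ i, (k • γ) i :=
        Finset.single_le_sum (f := k • γ) (fun _ _ => Nat.zero_le _) (Finset.mem_univ i)
      have h2 : k ≤ (k • γ) i := by
        simp only [Pi.smul_apply, smul_eq_mul]
        exact Nat.le_mul_of_pos_right _ (Nat.pos_of_ne_zero hi)
      omega
  · push Not at h
    rw [io_ne]
    · exact Finset.sum_eq_zero fun k _ => if_neg (h k)
    · intro k hk
      rw [← toZ_nsmul] at hk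
      exact h k (toZ_inj hk)

lemma xt_prod (L : List (Fin n → ℕ)) (h : ∀ γ ∈ L, γ ≠ 0) :
    xt (prodQ Q (L.map Edl)) = PE (chiL Q) (L.map Quiv.toZ) := by
  induction L with
  | nil => simpa [prodQ, PE] using xt_one
  | cons γ L ih =>
    have h1 : prodQ Q ((γ :: L).map Edl) = mulQ Q (Edl γ) (prodQ Q (L.map Edl)) := rfl
    rw [h1, xt_mul, xt_E (h γ (by simp)), ih fun x hx => h x (by simp [hx])]
    rfl

end

end DT

namespace DT

set_option linter.unusedSectionVars false

noncomputable section

variable {n : ℕ} (Q : Quiv n)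

/-- The ordered list of simple roots supported on `V`. -/
def eV (V : Finset (Fin n)) : List (Fin n → ℤ) :=
  ((List.finRange n).filter (· ∈ V)).map (fun i => Pi.single i 1)

/-- The roots supported on `V`. -/
def RtV (V : Finset (Fin n)) : Set (Fin n → ℤ) :=
  {x | (∀ i, i ∉ V → x i = 0) ∧ chiL Q x x = 1}

lemma mem_eV {V : Finset (Fin n)} {x : Fin n → ℤ} :
    x ∈ eV V ↔ ∃ i ∈ V, Pi.single i 1 = x := by
  simp [eV]

lemma single_orth (i : Fin n) : (Pi.single i 1 : Fin n → ℤ) ∈ orth n := by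
  intro k
  by_cases h : k = i
  · subst h; simp
  · simp [h]

/-- Vectors supported on `V`. -/
def supV (V : Finset (Fin n)) : AddSubmonoid (Fin n → ℤ) where
  carrier := {x | ∀ i, i ∉ V → x i = 0}
  zero_mem' := fun _ _ => rfl
  add_mem' := fun {x y} hx hy i hi => by
    have h1 := hx i hi
    have h2 := hy i hi
    simp [h1, h2]

lemma mem_cone_eV {V : Finset (Fin n)} {x : Fin n → ℤ} :
    x ∈ cone (eV V) ↔ x ∈ orth n ∧ ∀ i, i ∉ V → x i = 0 := by
  constructor
  · intro hx
    have h : cone (eV V) ≤ (orth n ⊓ supV V : AddSubmonoid (Fin n → ℤ)) := by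
      apply cone_le
      intro y hy
      obtain ⟨i, hi, rfl⟩ := mem_eV.1 hy
      refine ⟨single_orth i, fun k hk => ?_⟩
      have : k ≠ i := by rintro rfl; exact hk hi
      simp [this]
    exact h hx
  · rintro ⟨h1, h2⟩
    have e : x = ∑ i, (x i).toNat • (Pi.single i 1 : Fin n → ℤ) := by
      funext k
      simp [Finset.sum_apply, Pi.single_apply, h1 k]
    rw [e]
    refine AddSubmonoid.sum_mem _ fun i _ => ?_
    by_cases hi : i ∈ V
    · exact AddSubmonoid.nsmul_mem _ (mem_cone (mem_eV.2 ⟨i, hi, rfl⟩)) _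
    · rw [h2 i hi]
      simp

variable {Q}

lemma chi_nonpos {x y : Fin n → ℤ} (hx : x ∈ orth n) (hy : y ∈ orth n)
    (h : ∀ i, x i * y i = 0) : chiL Q x y ≤ 0 := by
  rw [chiL_apply, chi_eq, Finset.sum_eq_zero fun i _ => h i]
  have : 0 ≤ ∑ a, x (Q.ta a) * y (Q.ha a) :=
    Finset.sum_nonneg fun a _ => mul_nonneg (hx _) (hy _)
  omega

lemma chi_single_self (hlt : ∀ a : Fin Q.m, Q.ha a < Q.ta a) (i : Fin n) :
    chiL Q (Pi.single i 1) (Pi.single i 1) = 1 := by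
  rw [chiL_apply, chi_eq]
  have h2 : ∑ a, (Pi.single i 1 : Fin n → ℤ) (Q.ta a) * (Pi.single i 1 : Fin n → ℤ) (Q.ha a) = 0 := by
    refine Finset.sum_eq_zero fun a _ => ?_
    have := hlt a
    by_cases h : Q.ta a = i
    · have : Q.ha a ≠ i := by rintro h'; rw [h, h'] at this; exact lt_irrefl _ this
      simp [this]
    · simp [h]
  rw [h2]
  simp [Pi.single_apply]

lemma chi_single_lt (hlt : ∀ a : Fin Q.m, Q.ha a < Q.ta a) {i k : Fin n} (hik : i < k) :
    chiL Q (Pi.single i 1) (Pi.single k 1) = 0 := by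
  rw [chiL_apply, chi_eq]
  have h2 : ∑ a, (Pi.single i 1 : Fin n → ℤ) (Q.ta a) * (Pi.single k 1 : Fin n → ℤ) (Q.ha a) = 0 := by
    refine Finset.sum_eq_zero fun a _ => ?_
    have := hlt a
    by_cases h : Q.ta a = i
    · have : Q.ha a ≠ k := by
        rintro h'; rw [h, h'] at this; exact lt_asymm hik this
      simp [this]
    · simp [h]
  rw [h2]
  simp [Pi.single_apply, hik.ne, hik.ne']

lemma single_mul_single {i k : Fin n} (h : i ≠ k) (l : Fin n) :
    (Pi.single i 1 : Fin n → ℤ) l * (Pi.single k 1 : Fin n → ℤ) l = 0 := by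
  by_cases hl : l = i
  · subst hl; simp [h]
  · simp [hl]

lemma root_coh {V : Finset (Fin n)}
    (hpos : ∀ γ : Fin n → ℤ, (∀ i, i ∉ V → γ i = 0) → γ ≠ 0 → 0 < chiL Q γ γ)
    {β : Fin n → ℤ} (hβ : β ∈ RtV Q V) : β ∈ orth n ∨ -β ∈ orth n := by
  set p : Fin n → ℤ := fun i => max (β i) 0 with hp
  set m : Fin n → ℤ := fun i => max (-β i) 0 with hm
  have hpo : p ∈ orth n := fun i => le_max_right _ _
  have hmo : m ∈ orth n := fun i => le_max_right _ _
  have e : β = p - m := by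
    funext i
    simp only [hp, hm, Pi.sub_apply]
    omega
  have hz : ∀ i, p i * m i = 0 := by
    intro i
    rcases le_total (β i) 0 with h | h
    · simp [hp, h]
    · simp [hm, h]
  have hz' : ∀ i, m i * p i = 0 := fun i => by rw [mul_comm]; exact hz i
  have c1 := chi_nonpos (Q := Q) hpo hmo hz
  have c2 := chi_nonpos (Q := Q) hmo hpo hz'
  have c3 := hβ.2
  by_cases h1 : p = 0
  · right; rw [e, h1]; simpa using hmo
  by_cases h2 : m = 0
  · left; rw [e, h2]; simpa using hpo
  exfalso
  have d1 := hpos p (fun i hi => by simp [hp, hβ.1 i hi]) h1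
  have d2 := hpos m (fun i hi => by simp [hm, hβ.1 i hi]) h2
  rw [e] at c3
  simp only [map_sub, LinearMap.sub_apply] at c3
  linarith

lemma RtV_refl {V : Finset (Fin n)} {x y : Fin n → ℤ} (hx : x ∈ RtV Q V) (hy : y ∈ RtV Q V) :
    rf (chiL Q) x y ∈ RtV Q V := by
  refine ⟨fun i hi => ?_, ?_⟩
  · simp [rf_apply, hx.1 i hi, hy.1 i hi]
  · rw [rf_form_self _ hx.2, hy.2]

lemma single_RtV (hlt : ∀ a : Fin Q.m, Q.ha a < Q.ta a) {V : Finset (Fin n)} {i : Fin n}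
    (hi : i ∈ V) : (Pi.single i 1 : Fin n → ℤ) ∈ RtV Q V := by
  refine ⟨fun k hk => ?_, chi_single_self hlt i⟩
  have : k ≠ i := by rintro rfl; exact hk hi
  simp [this]

lemma eV_good (hlt : ∀ a : Fin Q.m, Q.ha a < Q.ta a) {V : Finset (Fin n)}
    (hpos : ∀ γ : Fin n → ℤ, (∀ i, i ∉ V → γ i = 0) → γ ≠ 0 → 0 < chiL Q γ γ) :
    GoodB (chiL Q) (RtV Q V) (eV V) where
  mem := by
    intro x hx
    obtain ⟨i, hi, rfl⟩ := mem_eV.1 hx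
    exact single_RtV hlt hi
  exc := by
    unfold eV
    rw [List.pairwise_map]
    have h0 : ((List.finRange n).filter (· ∈ V)).Pairwise (· < ·) :=
      (List.pairwise_lt_finRange n).filter _
    refine h0.imp_of_mem ?_
    intro i k hi hk hik
    simp only [List.mem_filter, List.mem_finRange, true_and, decide_eq_true_eq] at hi hk
    refine ⟨chi_single_lt hlt hik, ?_⟩
    have c1 := chi_nonpos (Q := Q) (single_orth k) (single_orth i)
      (single_mul_single hik.ne')
    have c2 := hpos (Pi.single i 1 + Pi.single k 1) (fun l hl => by
      have h1 : l ≠ i := by rintro rfl; exact hl hi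
      have h2 : l ≠ k := by rintro rfl; exact hl hk
      simp [h1, h2]) (fun h => by
        have := congrFun h i
        simp [Pi.single_apply, hik.ne] at this)
    simp only [map_add, LinearMap.add_apply] at c2
    rw [chi_single_self hlt, chi_single_self hlt, chi_single_lt hlt hik] at c2
    omega
  fin := orth_fin.mono fun x hx => (mem_cone_eV.1 hx).1
  pt := by
    intro x h1 h2
    funext i
    have a1 := (mem_cone_eV.1 h1).1 i
    have a2 : 0 ≤ - x i := (mem_cone_eV.1 h2).1 i
    have : x i = 0 := by omega
    exact this
  coh := by
    intro β hβ
    rcases root_coh hpos hβ with h | h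
    · exact Or.inl (mem_cone_eV.2 ⟨h, hβ.1⟩)
    · exact Or.inr (mem_cone_eV.2 ⟨h, fun i hi => by simp [hβ.1 i hi]⟩)
  refl := by
    intro β hβ hc x hx hne
    obtain ⟨i, hi, rfl⟩ := mem_eV.1 hx
    have ho := (mem_cone_eV.1 hc).1
    obtain ⟨k, hk, hk0⟩ : ∃ k, k ≠ i ∧ β k ≠ 0 := by
      by_contra! h
      apply hne
      have e : β = (β i) • (Pi.single i 1 : Fin n → ℤ) := by
        funext k
        by_cases hk : k = i
        · subst hk; simp
        · simp [hk, h k hk]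
      have h1 := hβ.2
      have h2 : (β i) * (β i) = 1 := by
        rw [e, LinearMap.map_smul₂, map_smul, chi_single_self hlt] at h1
        simpa using h1
      have h3 : β i = 1 := by
        have := ho i
        nlinarith
      rw [e, h3, one_smul]
    have hr := RtV_refl (single_RtV hlt hi) hβ
    have hrk : rf (chiL Q) (Pi.single i 1) β k = β k := by
      simp [rf_apply, hk]
    refine mem_cone_eV.2 ⟨?_, hr.1⟩
    rcases root_coh hpos hr with h | h
    · exact h
    · exfalso
      have := h k
      have h' : 0 ≤ - rf (chiL Q) (Pi.single i 1) β k := this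
      rw [hrk] at h'
      have := ho k
      omega

/-- The Dynkin case. -/
lemma block_identity (hlt : ∀ a : Fin Q.m, Q.ha a < Q.ta a) {V : Finset (Fin n)}
    (hpos : ∀ γ : Fin n → ℤ, (∀ i, i ∉ V → γ i = 0) → γ ≠ 0 → 0 < chiL Q γ γ)
    (L : List (Fin n → ℤ)) (hL : ∀ x, x ∈ L ↔ x ∈ RtV Q V ∧ x ∈ orth n)
    (hp : L.Pairwise (fun x y => 0 ≤ lm (chiL Q) x y)) (hn : L.Nodup) :
    PE (chiL Q) (eV V) = PE (chiL Q) L := by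
  have hg := eV_good hlt hpos
  have hLc : ∀ x ∈ L, x ∈ cone (eV V) := fun x hx =>
    mem_cone_eV.2 ⟨((hL x).1 hx).2, ((hL x).1 hx).1.1⟩
  have := core (χ := chiL Q) (Rt := RtV Q V) (fun x hx => hx.2)
    (fun x hx y hy => RtV_refl hx hy) (C := cone (eV V)) hg.pt hg.coh L.length L [] (eV V) dl rfl hg
    (fun x hx => ⟨((hL x).1 hx).1, hLc x hx, hLc x hx⟩) (by simp)
    (fun β h1 h2 => Or.inl ((hL β).2 ⟨h1, (mem_cone_eV.1 h2).1⟩)) hp (by simp) hn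
    (dl_supp _) (by simp [dl]) (by rw [dl_cv]; exact PE_supp _ _ fun x hx => mem_cone hx)
  rwa [dl_cv] at this

end

end DT

namespace DT

set_option linter.unusedSectionVars false

noncomputable section

variable {n ℓ : ℕ} {Q : Quiv n} (P : Quiv.DSP Q ℓ)

/-- The block containing a vertex. -/
def bl (i : Fin n) : Fin ℓ := (P.cover i).choose

lemma bl_mem (i : Fin n) : i ∈ P.V (bl P i) := (P.cover i).choose_spec.1

lemma bl_eq {i : Fin n} {j : Fin ℓ} (h : i ∈ P.V j) : bl P i = j :=
  ((P.cover i).choose_spec.2 j h).symm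

lemma cut_of_ne {a : Fin Q.m} (h : bl P (Q.ta a) ≠ bl P (Q.ha a)) : P.Cut a := by
  intro j hj
  have := (P.dynkin j).2.1 a hj
  exact h ((bl_eq P this.1).trans (bl_eq P this.2).symm)

variable {P}

lemma mem_A (hadm : P.Admissible) {a : Fin Q.m} {j : Fin ℓ} (h1 : Q.ta a ∈ P.V j)
    (h2 : Q.ha a ∈ P.V j) : a ∈ P.A j := by
  by_contra h
  refine hadm ⟨0, fun _ => a, fun _ j' hj' => ?_, fun _ => ⟨j, h2, h1⟩⟩
  have h3 := ((P.dynkin j').2.1 a hj').1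
  have : j' = j := (bl_eq P h3).symm.trans (bl_eq P h1)
  exact h (this ▸ hj')

lemma chiSub_eq (hadm : P.Admissible) {j : Fin ℓ} {x y : Fin n → ℤ}
    (hx : ∀ i, i ∉ P.V j → x i = 0) (hy : ∀ i, i ∉ P.V j → y i = 0) :
    Q.chiSub (P.V j) (P.A j) x y = chiL Q x y := by
  rw [chiL_apply, chi_eq, Quiv.chiSub]
  congr 1
  · refine Finset.sum_subset (Finset.subset_univ _) fun i _ hi => ?_
    rw [hx i hi, zero_mul]
  · refine Finset.sum_subset (Finset.subset_univ _) fun a _ ha => ?_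
    by_cases h1 : Q.ta a ∈ P.V j
    · by_cases h2 : Q.ha a ∈ P.V j
      · exact absurd (mem_A hadm h1 h2) ha
      · rw [hy _ h2, mul_zero]
    · rw [hx _ h1, zero_mul]

variable (P)

/-- Cut arrows, as a relation on blocks. -/
def rel (j j' : Fin ℓ) : Prop := ∃ a, P.Cut a ∧ bl P (Q.ha a) = j ∧ bl P (Q.ta a) = j'

lemma rel_path {x y : Fin ℓ} (h : Relation.TransGen (rel P) x y) :
    ∃ (k : ℕ) (g : ℕ → Fin Q.m), (∀ i, P.Cut (g i)) ∧ bl P (Q.ta (g 0)) = y ∧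
      bl P (Q.ha (g k)) = x ∧ ∀ i < k, bl P (Q.ha (g i)) = bl P (Q.ta (g (i + 1))) := by
  induction h using Relation.TransGen.head_induction_on with
  | single h =>
    obtain ⟨a, h1, h2, h3⟩ := h
    exact ⟨0, fun _ => a, fun _ => h1, h3, h2, by simp⟩
  | head h _ ih =>
    obtain ⟨a, h1, h2, h3⟩ := h
    obtain ⟨k, g, g1, g2, g3, g4⟩ := ih
    refine ⟨k + 1, fun i => if i ≤ k then g i else a, ?_, ?_, ?_, ?_⟩
    · intro i
      dsimp only
      split_ifs
      · exact g1 i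
      · exact h1
    · simpa using g2
    · simpa using h2
    · intro i hi
      have hi' : i ≤ k := by omega
      simp only [hi', if_true]
      by_cases hk : i + 1 ≤ k
      · simp only [hk, if_true]
        exact g4 i (by omega)
      · have : i = k := by omega
        subst this
        simp only [hk, if_false]
        rw [g3, h3]

variable {P}

lemma rel_irrefl (hadm : P.Admissible) (x : Fin ℓ) : ¬ Relation.TransGen (rel P) x x := by
  intro h
  obtain ⟨k, g, g1, g2, g3, g4⟩ := rel_path P h
  refine hadm ⟨k, fun i => g i.val, fun i => g1 _, fun i => ⟨bl P (Q.ha (g i.val)), bl_mem P _, ?_⟩⟩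
  have hv : (i + 1).val = (i.val + 1) % (k + 1) := by
    rw [ZMod.val_add, ZMod.val_one_eq_one_mod]
    simp
  have hlt : i.val < k + 1 := ZMod.val_lt i
  have e : bl P (Q.ha (g i.val)) = bl P (Q.ta (g (i + 1).val)) := by
    by_cases hik : i.val = k
    · rw [hv, hik, Nat.mod_self, g3, g2]
    · have : i.val < k := by omega
      rw [hv, Nat.mod_eq_of_lt (by omega)]
      exact g4 _ this
  rw [e]
  exact bl_mem P _

open Classical in
/-- A rank function on blocks. -/
lemma exists_rank (hadm : P.Admissible) :
    ∃ f : Fin ℓ → ℕ, ∀ a, bl P (Q.ta a) ≠ bl P (Q.ha a) → f (bl P (Q.ha a)) < f (bl P (Q.ta a)) := by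
  refine ⟨fun j => (Finset.univ.filter fun j' => Relation.TransGen (rel P) j' j).card, ?_⟩
  intro a ha
  have hr : rel P (bl P (Q.ha a)) (bl P (Q.ta a)) := ⟨a, cut_of_ne P ha, rfl, rfl⟩
  apply Finset.card_lt_card
  rw [Finset.ssubset_iff_of_subset]
  · refine ⟨bl P (Q.ha a), ?_, ?_⟩
    · simpa using Relation.TransGen.single hr
    · simpa using rel_irrefl hadm _
  · intro j hj
    simp only [Finset.mem_filter, Finset.mem_univ, true_and] at hj ⊢
    exact hj.tail hr

lemma exists_order (hadm : P.Admissible) :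
    ∃ js : List (Fin ℓ), js.Nodup ∧ (∀ j, j ∈ js) ∧ js.Pairwise fun j j' =>
      ∀ a, Q.ta a ∈ P.V j → Q.ha a ∈ P.V j' → False := by
  obtain ⟨f, hf⟩ := exists_rank hadm
  let js := (List.finRange ℓ).mergeSort (fun j j' => decide (f j ≤ f j'))
  have hp : js.Perm (List.finRange ℓ) := List.mergeSort_perm _ _
  have hn : js.Nodup := hp.nodup_iff.2 (List.nodup_finRange ℓ)
  refine ⟨js, hn, fun j => hp.mem_iff.2 (List.mem_finRange j), ?_⟩
  have hs : js.Pairwise (fun j j' => decide (f j ≤ f j') = true) :=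
    List.pairwise_mergeSort (fun a b c h1 h2 => by simp at h1 h2 ⊢; omega)
      (fun a b => by simp; omega) _
  refine (hs.and hn).imp ?_
  rintro j j' ⟨h1, h2⟩ a ha hb
  have e1 := bl_eq P ha
  have e2 := bl_eq P hb
  have := hf a (by rw [e1, e2]; exact h2)
  rw [e1, e2] at this
  simp at h1
  omega

/-- Cross-block sign. -/
lemma cross {j j' : Fin ℓ} (hj : j ≠ j') (h : ∀ a, Q.ta a ∈ P.V j → Q.ha a ∈ P.V j' → False)
    {x y : Fin n → ℤ} (hx : ∀ i, i ∉ P.V j → x i = 0) (hy : ∀ i, i ∉ P.V j' → y i = 0)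
    (hxo : x ∈ orth n) (hyo : y ∈ orth n) : lm (chiL Q) x y ≤ 0 := by
  have hz : ∀ i, x i * y i = 0 := by
    intro i
    by_cases h1 : i ∈ P.V j
    · have : i ∉ P.V j' := fun h2 => hj ((bl_eq P h1).symm.trans (bl_eq P h2))
      rw [hy i this, mul_zero]
    · rw [hx i h1, zero_mul]
  have c1 := chi_nonpos (Q := Q) hyo hxo (fun i => by rw [mul_comm]; exact hz i)
  have c2 : chiL Q x y = 0 := by
    rw [chiL_apply, chi_eq, Finset.sum_eq_zero fun i _ => hz i, Finset.sum_eq_zero, sub_zero]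
    intro a _
    by_cases h1 : Q.ta a ∈ P.V j
    · rw [hy _ (fun h2 => h a h1 h2), mul_zero]
    · rw [hx _ h1, zero_mul]
  unfold lm
  omega

lemma PE_flatMap {M : Type*} [AddCommGroup M] [IsAddTorsionFree M] (χ : M →ₗ[ℤ] M →ₗ[ℤ] ℤ)
    {C : AddSubmonoid M} (hC : FinC C) {ι : Type*} (A B : ι → List M) (js : List ι)
    (hA : ∀ j, ∀ x ∈ A j, x ∈ C) (hB : ∀ j, ∀ x ∈ B j, x ∈ C)
    (h : ∀ j ∈ js, PE χ (A j) = PE χ (B j)) : PE χ (js.flatMap A) = PE χ (js.flatMap B) := by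
  induction js with
  | nil => rfl
  | cons j js ih =>
    rw [List.flatMap_cons, List.flatMap_cons, PE_append χ hC _ _ (hA j), PE_append χ hC _ _ (hB j),
      h j (by simp), ih fun j' hj' => h j' (by simp [hj'])]
    · intro x hx
      obtain ⟨j', _, h'⟩ := List.mem_flatMap.1 hx
      exact hB j' x h'
    · intro x hx
      obtain ⟨j', _, h'⟩ := List.mem_flatMap.1 hx
      exact hA j' x h'

/-- Reordering a list block by block. -/
lemma perm_flatMap {α ι : Type*} (F : List α) (hF : F.Nodup) (js : List ι)
    (hjs : js.Nodup) (A : ι → List α) (hA : ∀ j, (A j).Nodup)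
    (h1 : ∀ j ∈ js, ∀ x ∈ A j, x ∈ F) (h2 : ∀ x ∈ F, ∃ j ∈ js, x ∈ A j)
    (h3 : ∀ j j' x, x ∈ A j → x ∈ A j' → j = j') : F.Perm (js.flatMap A) := by
  rw [List.perm_ext_iff_of_nodup hF]
  · intro x
    rw [List.mem_flatMap]
    exact ⟨h2 x, fun ⟨j, hj, hx⟩ => h1 j hj x hx⟩
  · rw [List.nodup_flatMap]
    refine ⟨fun j _ => hA j, hjs.imp ?_⟩
    intro j j' hne x hx hx'
    exact hne (h3 j j' x hx hx')

lemma lm_single (hlt : ∀ a : Fin Q.m, Q.ha a < Q.ta a) {i k : Fin n} (hik : i < k) :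
    lm (chiL Q) (Pi.single i 1) (Pi.single k 1) ≤ 0 := by
  have c1 := chi_nonpos (Q := Q) (single_orth k) (single_orth i) (single_mul_single hik.ne')
  have c2 := chi_single_lt hlt hik
  unfold lm
  omega

lemma single_injective : Function.Injective (fun i : Fin n => (Pi.single i 1 : Fin n → ℤ)) := by
  intro i k h
  by_contra hne
  have := congrFun h i
  simp [hne] at this

lemma simple_side (hlt : ∀ a : Fin Q.m, Q.ha a < Q.ta a) (js : List (Fin ℓ)) (hn : js.Nodup)
    (hall : ∀ j, j ∈ js) (hjs : js.Pairwise fun j j' =>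
      ∀ a, Q.ta a ∈ P.V j → Q.ha a ∈ P.V j' → False) :
    PE (chiL Q) ((List.finRange n).map fun i => Pi.single i 1) =
      PE (chiL Q) (js.flatMap fun j => eV (P.V j)) := by
  have hsupp : ∀ j, ∀ x ∈ eV (P.V j), x ∈ orth n ∧ ∀ i, i ∉ P.V j → x i = 0 := by
    intro j x hx
    exact mem_cone_eV.1 (mem_cone hx)
  refine PE_reorder (chiL Q) orth_fin (fun x y => lm (chiL Q) x y ≤ 0) ?_ _ _ ?_ ?_ ?_ ?_
  · intro x y h1 h2
    rw [lm_swap] at h2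
    omega
  · refine perm_flatMap _ ((List.nodup_finRange n).map single_injective) js hn _ ?_ ?_ ?_ ?_
    · intro j
      exact ((List.nodup_finRange n).filter _).map single_injective
    · intro j _ x hx
      obtain ⟨i, _, rfl⟩ := mem_eV.1 hx
      simp
    · intro x hx
      obtain ⟨i, _, rfl⟩ := List.mem_map.1 hx
      exact ⟨bl P i, hall _, mem_eV.2 ⟨i, bl_mem P i, rfl⟩⟩
    · intro j j' x hx hx'
      obtain ⟨i, hi, rfl⟩ := mem_eV.1 hx
      obtain ⟨k, hk, e⟩ := mem_eV.1 hx'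
      have : k = i := single_injective e
      subst this
      exact (bl_eq P hi).symm.trans (bl_eq P hk)
  · intro x hx
    obtain ⟨i, _, rfl⟩ := List.mem_map.1 hx
    exact single_orth i
  · rw [List.pairwise_map]
    exact (List.pairwise_lt_finRange n).imp fun h => lm_single hlt h
  · rw [List.pairwise_flatMap]
    constructor
    · intro j _
      unfold eV
      rw [List.pairwise_map]
      exact ((List.pairwise_lt_finRange n).filter _).imp fun h => lm_single hlt h
    · refine (hjs.and hn).imp ?_
      rintro j j' ⟨h1, h2⟩ x hx y hy
      exact cross h2 h1 (hsupp j x hx).2 (hsupp j' y hy).2 (hsupp j x hx).1 (hsupp j' y hy).1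

open Classical in
lemma root_side {r : ℕ} (hlt : ∀ a : Fin Q.m, Q.ha a < Q.ta a) (hadm : P.Admissible)
    (φ : Fin r → (Fin n → ℕ)) (hφ : P.AllowedOrder φ)
    (js : List (Fin ℓ)) (hn : js.Nodup)
    (hall : ∀ j, j ∈ js) (hjs : js.Pairwise fun j j' =>
      ∀ a, Q.ta a ∈ P.V j → Q.ha a ∈ P.V j' → False) :
    PE (chiL Q) ((List.finRange r).map fun u => Quiv.toZ (φ u)) =
      PE (chiL Q) (js.flatMap fun j => eV (P.V j)) := by
  obtain ⟨hinj, hrange, hord⟩ := hφ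
  set F := (List.finRange r).map fun u => Quiv.toZ (φ u) with hF
  let I : Fin ℓ → (Fin n → ℤ) → Prop := fun j x => ∀ i, i ∉ P.V j → x i = 0
  have hIu : ∀ j j' x, x ≠ 0 → I j x → I j' x → j = j' := by
    intro j j' x hx h1 h2
    obtain ⟨i, hi⟩ : ∃ i, x i ≠ 0 := by
      by_contra! h'; exact hx (funext h')
    have a1 : i ∈ P.V j := by by_contra h; exact hi (h1 i h)
    have a2 : i ∈ P.V j' := by by_contra h; exact hi (h2 i h)
    exact (bl_eq P a1).symm.trans (bl_eq P a2)
  have hroot : ∀ u, ∃ j, φ u ∈ Q.PosRootsOn (P.V j) (P.A j) := by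
    intro u
    have : φ u ∈ P.Roots := hrange ▸ Set.mem_range_self u
    simpa [Quiv.DSP.Roots] using this
  have hne : ∀ u, Quiv.toZ (φ u) ≠ 0 := by
    intro u h
    obtain ⟨j, hj⟩ := hroot u
    exact hj.1 (toZ_inj (h.trans toZ_zero.symm))
  have hprI : ∀ u j, φ u ∈ Q.PosRootsOn (P.V j) (P.A j) → I j (Quiv.toZ (φ u)) := by
    intro u j h i hi
    simp [Quiv.toZ, h.2.1 i hi]
  have hIpr : ∀ u j, I j (Quiv.toZ (φ u)) → φ u ∈ Q.PosRootsOn (P.V j) (P.A j) := by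
    intro u j h
    obtain ⟨j', hj'⟩ := hroot u
    have := hIu j j' _ (hne u) h (hprI u j' hj')
    rwa [this]
  have hFnd : F.Nodup := (List.nodup_finRange r).map (toZ_inj.comp hinj)
  have hmF : ∀ j x, (x ∈ F ∧ I j x) ↔ x ∈ RtV Q (P.V j) ∧ x ∈ orth n := by
    intro j x
    constructor
    · rintro ⟨h1, h2⟩
      obtain ⟨u, _, rfl⟩ := List.mem_map.1 h1
      have := hIpr u j h2
      refine ⟨⟨h2, ?_⟩, toZ_mem _⟩
      rw [← chiSub_eq hadm h2 h2]
      exact this.2.2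
    · rintro ⟨h1, h2⟩
      obtain ⟨γ, rfl⟩ := toZ_surj h2
      refine ⟨?_, h1.1⟩
      have : γ ∈ P.Roots := by
        refine Set.mem_iUnion.2 ⟨j, ?_, ?_, ?_⟩
        · rintro rfl
          have := h1.2
          rw [toZ_zero] at this
          simp at this
        · intro i hi
          have := h1.1 i hi
          simpa [Quiv.toZ] using this
        · rw [chiSub_eq hadm h1.1 h1.1]
          exact h1.2
      rw [← hrange] at this
      obtain ⟨u, rfl⟩ := this
      exact List.mem_map.2 ⟨u, List.mem_finRange u, rfl⟩
  let S : (Fin n → ℤ) → (Fin n → ℤ) → Prop := fun x y =>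
    ((∃ j, I j x ∧ I j y) → 0 ≤ lm (chiL Q) x y) ∧
    ((¬ ∃ j, I j x ∧ I j y) → lm (chiL Q) x y ≤ 0)
  have hSF : F.Pairwise S := by
    rw [hF, List.pairwise_map]
    refine (List.pairwise_lt_finRange r).imp ?_
    intro u v huv
    obtain ⟨o1, o2⟩ := hord u v huv
    have hiff : (∃ j, I j (Quiv.toZ (φ u)) ∧ I j (Quiv.toZ (φ v))) ↔
        ∃ j, φ u ∈ Q.PosRootsOn (P.V j) (P.A j) ∧ φ v ∈ Q.PosRootsOn (P.V j) (P.A j) :=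
      ⟨fun ⟨j, h1, h2⟩ => ⟨j, hIpr u j h1, hIpr v j h2⟩,
        fun ⟨j, h1, h2⟩ => ⟨j, hprI u j h1, hprI v j h2⟩⟩
    exact ⟨fun h => o1 (hiff.1 h), fun h => o2 (fun h' => h (hiff.2 h'))⟩
  have hFo : ∀ x ∈ F, x ∈ orth n ∧ x ≠ 0 := by
    intro x hx
    obtain ⟨u, _, rfl⟩ := List.mem_map.1 hx
    exact ⟨toZ_mem _, hne u⟩
  have hFe : ∀ x ∈ F, ∃ j, I j x := by
    intro x hx
    obtain ⟨u, _, rfl⟩ := List.mem_map.1 hx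
    obtain ⟨j, hj⟩ := hroot u
    exact ⟨j, hprI u j hj⟩
  let B : Fin ℓ → List (Fin n → ℤ) := fun j => F.filter (fun x => I j x)
  have hB : ∀ j x, x ∈ B j ↔ x ∈ F ∧ I j x := by
    intro j x
    simp only [B, List.mem_filter, decide_eq_true_eq]
  have e1 : PE (chiL Q) F = PE (chiL Q) (js.flatMap B) := by
    refine PE_reorder (chiL Q) orth_fin S ?_ _ _ ?_ (fun x hx => (hFo x hx).1) hSF ?_
    · intro x y h1 h2
      have hsw := lm_swap (chiL Q) x y
      by_cases h : ∃ j, I j x ∧ I j y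
      · have a1 := h1.1 h
        have a2 := h2.1 (by obtain ⟨j, p, q⟩ := h; exact ⟨j, q, p⟩)
        omega
      · have a1 := h1.2 h
        have a2 := h2.2 (by rintro ⟨j, p, q⟩; exact h ⟨j, q, p⟩)
        omega
    · refine perm_flatMap F hFnd js hn B (fun j => hFnd.filter _) ?_ ?_ ?_
      · intro j _ x hx
        exact ((hB j x).1 hx).1
      · intro x hx
        obtain ⟨j, hj⟩ := hFe x hx
        exact ⟨j, hall j, (hB j x).2 ⟨hx, hj⟩⟩
      · intro j j' x hx hx'
        have a1 := (hB j x).1 hx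
        have a2 := (hB j' x).1 hx'
        exact hIu j j' x (hFo x a1.1).2 a1.2 a2.2
    · rw [List.pairwise_flatMap]
      refine ⟨fun j _ => hSF.filter _, (hjs.and hn).imp ?_⟩
      rintro j j' ⟨h1, h2⟩ x hx y hy
      have a1 := (hB j x).1 hx
      have a2 := (hB j' y).1 hy
      refine ⟨?_, fun _ => cross h2 h1 a1.2 a2.2 (hFo x a1.1).1 (hFo y a2.1).1⟩
      rintro ⟨k, p, q⟩
      exact absurd ((hIu j k x (hFo x a1.1).2 a1.2 p).trans (hIu j' k y (hFo y a2.1).2 a2.2 q).symm) h2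
  rw [e1]
  refine (PE_flatMap (chiL Q) orth_fin _ _ js ?_ ?_ ?_).symm
  · intro j x hx
    exact (mem_cone_eV.1 (mem_cone hx)).1
  · intro j x hx
    exact (hFo x ((hB j x).1 hx).1).1
  · intro j _
    refine block_identity hlt ?_ (B j) (fun x => (hB j x).trans (hmF j x)) ?_ (hFnd.filter _)
    · intro γ h1 h2
      rw [← chiSub_eq hadm h1 h1]
      exact (P.dynkin j).2.2.2.2 γ h1 h2
    · refine (hSF.filter _).imp_of_mem ?_
      intro x y hx hy hS
      exact hS.1 ⟨j, ((hB j x).1 hx).2, ((hB j y).1 hy).2⟩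

theorem final {r : ℕ} (hlt : ∀ a : Fin Q.m, Q.ha a < Q.ta a) (hadm : P.Admissible)
    (φ : Fin r → (Fin n → ℕ)) (hφ : P.AllowedOrder φ) :
    prodQ Q (List.ofFn fun i : Fin n => Edl (Pi.single i 1)) =
      prodQ Q (List.ofFn fun u : Fin r => Edl (φ u)) := by
  obtain ⟨js, hn, hall, hjs⟩ := exists_order hadm
  apply xt_inj
  have h1 : (List.ofFn fun i : Fin n => Edl (Pi.single i 1 : Fin n → ℕ)) =
      ((List.finRange n).map fun i => (Pi.single i 1 : Fin n → ℕ)).map Edl := by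
    rw [List.ofFn_eq_map, List.map_map]; rfl
  have h2 : (List.ofFn fun u : Fin r => Edl (φ u)) =
      ((List.finRange r).map φ).map Edl := by
    rw [List.ofFn_eq_map, List.map_map]; rfl
  rw [h1, h2, xt_prod, xt_prod, List.map_map, List.map_map]
  · have e : (Quiv.toZ ∘ fun i => (Pi.single i 1 : Fin n → ℕ)) =
        fun i => (Pi.single i 1 : Fin n → ℤ) := by
      funext i k
      by_cases h : k = i
      · subst h; simp [Quiv.toZ]
      · simp [Quiv.toZ, h]
    rw [e]
    exact (simple_side hlt js hn hall hjs).trans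
      (root_side hlt hadm φ hφ js hn hall hjs).symm
  · intro γ hγ
    obtain ⟨u, _, rfl⟩ := List.mem_map.1 hγ
    have : φ u ∈ P.Roots := hφ.2.1 ▸ Set.mem_range_self u
    obtain ⟨j, hj⟩ := Set.mem_iUnion.1 this
    exact hj.1
  · intro γ hγ
    obtain ⟨i, _, rfl⟩ := List.mem_map.1 hγ
    intro h
    have := congrFun h i
    simp at this

end

end DT

/-- For an acyclic quiver `Q` labeled head-before-tail, an
admissible Dynkin subquiver partition `Q•` and an allowed total order
`φ₁ ≺ ⋯ ≺ φ_r` on `Φ(Q,Q•)`, the product of quantum dilogarithms over the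
allowed order equals the trivial factorization
`E(y_{e₁})⋯E(y_{e_n})` of the combinatorial DT invariant `E_Q`. -/
theorem statement0 {n ℓ r : ℕ} (Q : Quiv n)
    (hlt : ∀ a : Fin Q.m, Q.ha a < Q.ta a) (hacyc : Q.Acyclic)
    (P : Quiv.DSP Q ℓ) (hadm : P.Admissible)
    (φ : Fin r → (Fin n → ℕ)) (hφ : P.AllowedOrder φ) :
    prodQ Q (List.ofFn fun i : Fin n => Edl (Pi.single i 1)) =
      prodQ Q (List.ofFn fun u : Fin r => Edl (φ u)) := by
  exact DT.final hlt hadm φ hφ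
end

section
/- Let Q be a Dynkin quiver on vertex set {1,…,n}, labeled so that h(a) < t(a) for every arrow a, and let Φ = {β₁,…,β_N} be its set of positive roots, enumerated so that λ(β_u,β_v) ≥ 0 whenever u < v. Then in the completed quantum algebra Â_Q one has E(y_{e₁})·E(y_{e₂})⋯E(y_{e_n}) = E(y_{β₁})·E(y_{β₂})⋯E(y_{β_N}). -/
open scoped BigOperators

noncomputable section Aux

namespace Quiv

/-- Integral bilinear forms on `ℤⁿ`. -/
abbrev BF (n : ℕ) := (Fin n → ℤ) →ₗ[ℤ] (Fin n → ℤ) →ₗ[ℤ] ℤ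

theorem toZ_add {n : ℕ} (a b : Fin n → ℕ) : toZ (a + b) = toZ a + toZ b := by
  funext i; simp [toZ]

theorem toZ_sub {n : ℕ} {a b : Fin n → ℕ} (h : b ≤ a) : toZ (a - b) = toZ a - toZ b := by
  funext i
  have : b i ≤ a i := h i
  simp only [toZ, Pi.sub_apply]
  omega

theorem toZ_smul {n : ℕ} (k : ℕ) (b : Fin n → ℕ) : toZ (k • b) = (k : ℤ) • toZ b := by
  funext i; simp [toZ]

theorem toZ_zero {n : ℕ} : toZ (0 : Fin n → ℕ) = 0 := by
  funext i; simp [toZ]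

theorem toZ_inj {n : ℕ} {a b : Fin n → ℕ} (h : toZ a = toZ b) : a = b := by
  funext i
  have := congrFun h i
  simpa [toZ] using this

theorem toZ_single {n : ℕ} (i : Fin n) (k : ℕ) :
    toZ (Pi.single i k : Fin n → ℕ) = Pi.single i (k : ℤ) := by
  funext j
  by_cases h : j = i
  · subst h; simp [toZ]
  · simp [toZ, h]

theorem toZ_nonneg {n : ℕ} (a : Fin n → ℕ) : 0 ≤ toZ a := by
  intro i; simp [toZ]

theorem tq_ne : tq ≠ 0 := RatFunc.X_ne_zero

/-- twisted product for a general bilinear form -/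
def mulL {n : ℕ} (lam : BF n) (f g : AQ n) : AQ n := fun γ =>
  ∑ γ₁ ∈ Finset.Iic γ,
    tq ^ (lam (toZ γ₁) (toZ (γ - γ₁))) * f γ₁ * g (γ - γ₁)

def prodL {n : ℕ} (lam : BF n) (L : List (AQ n)) : AQ n := L.foldr (mulL lam) oneQ

theorem mulL_one {n : ℕ} (lam : BF n) (f : AQ n) : mulL lam f oneQ = f := by
  funext γ
  unfold mulL
  rw [Finset.sum_eq_single γ]
  · simp [oneQ, toZ_zero]
  · intro b hb hne
    have hb' : b ≤ γ := Finset.mem_Iic.1 hb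
    have : γ - b ≠ 0 := by
      intro h
      apply hne
      exact le_antisymm hb' (tsub_eq_zero_iff_le.1 h)
    simp [oneQ, this]
  · intro h; simp at h

theorem one_mulL {n : ℕ} (lam : BF n) (f : AQ n) : mulL lam oneQ f = f := by
  funext γ
  unfold mulL
  rw [Finset.sum_eq_single 0]
  · simp [oneQ, toZ_zero]
  · intro b hb hne
    simp [oneQ, hne]
  · intro h; simp at h

theorem mulL_assoc {n : ℕ} (lam : BF n) (f g h : AQ n) :
    mulL lam (mulL lam f g) h = mulL lam f (mulL lam g h) := by
  funext γ
  unfold mulL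
  simp only [Finset.mul_sum, Finset.sum_mul]
  rw [Finset.sum_sigma', Finset.sum_sigma']
  refine Finset.sum_bij' (fun p _ => ⟨p.2, p.1 - p.2⟩) (fun p _ => ⟨p.1 + p.2, p.1⟩) ?_ ?_ ?_ ?_ ?_
  · rintro ⟨a, b⟩ hp
    simp only [Finset.mem_sigma, Finset.mem_Iic] at hp ⊢
    exact ⟨hp.2.trans hp.1, tsub_le_tsub_right hp.1 _⟩
  · rintro ⟨a, b⟩ hp
    simp only [Finset.mem_sigma, Finset.mem_Iic] at hp ⊢
    refine ⟨?_, le_self_add⟩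
    have := add_le_add_right hp.2 a
    rwa [add_tsub_cancel_of_le hp.1] at this
  · rintro ⟨a, b⟩ hp
    simp only [Finset.mem_sigma, Finset.mem_Iic] at hp ⊢
    simp [add_tsub_cancel_of_le hp.2]
  · rintro ⟨a, b⟩ hp
    simp only [Finset.mem_sigma, Finset.mem_Iic] at hp ⊢
    simp
  · rintro ⟨a, b⟩ hp
    simp only [Finset.mem_sigma, Finset.mem_Iic] at hp ⊢
    obtain ⟨h1, h2⟩ := hp
    have h1 : a ≤ γ := h1
    have h2 : b ≤ a := h2
    have e1 : γ - b - (a - b) = γ - a := by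
      funext i
      have : a i ≤ γ i := h1 i
      have : b i ≤ a i := h2 i
      simp only [Pi.sub_apply]; omega
    rw [e1, toZ_sub h2, toZ_sub h1, toZ_sub (h2.trans h1)]
    have e2 : tq ^ (lam (toZ a) (toZ γ - toZ a)) * tq ^ (lam (toZ b) (toZ a - toZ b))
        = tq ^ (lam (toZ b) (toZ γ - toZ b)) *
          tq ^ (lam (toZ a - toZ b) (toZ γ - toZ a)) := by
      rw [← zpow_add₀ tq_ne, ← zpow_add₀ tq_ne]
      congr 1
      simp only [map_sub, LinearMap.sub_apply]
      ring
    linear_combination (f b * g (a - b) * h (γ - a)) * e2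

theorem prodL_append {n : ℕ} (lam : BF n) (L M : List (AQ n)) :
    prodL lam (L ++ M) = mulL lam (prodL lam L) (prodL lam M) := by
  induction L with
  | nil => simp [prodL, one_mulL]
  | cons a L ih =>
    have : prodL lam (a :: L ++ M) = mulL lam a (prodL lam (L ++ M)) := rfl
    rw [this, ih, ← mulL_assoc]; rfl

theorem prodL_cons {n : ℕ} (lam : BF n) (a : AQ n) (M : List (AQ n)) :
    prodL lam (a :: M) = mulL lam a (prodL lam M) := rfl

theorem prodL_single {n : ℕ} (lam : BF n) (a : AQ n) :
    prodL lam [a] = a := by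
  rw [prodL_cons]; exact mulL_one _ _

theorem mulL_zero_apply {n : ℕ} (lam : BF n) (f g : AQ n) :
    mulL lam f g 0 = f 0 * g 0 := by
  unfold mulL
  have : Finset.Iic (0 : Fin n → ℕ) = {0} := by
    ext x; simp
  rw [this]; simp [toZ_zero]

theorem prodL_zero_apply {n : ℕ} (lam : BF n) (L : List (AQ n)) (h : ∀ f ∈ L, f 0 = 1) :
    prodL lam L 0 = 1 := by
  induction L with
  | nil => simp [prodL, oneQ]
  | cons a L ih =>
    rw [prodL_cons, mulL_zero_apply, h a (by simp), ih (fun f hf => h f (by simp [hf]))]; simp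

theorem mulL_split {n : ℕ} (lam : BF n) (f g : AQ n) (hg : g 0 = 1) (γ : Fin n → ℕ) :
    mulL lam f g γ = f γ + ∑ γ₁ ∈ Finset.Iio γ,
      tq ^ (lam (toZ γ₁) (toZ (γ - γ₁))) * f γ₁ * g (γ - γ₁) := by
  unfold mulL
  rw [← Finset.Iio_insert, Finset.sum_insert (by simp)]
  simp [toZ_zero, hg]

theorem mulL_cancel {n : ℕ} (lam : BF n) (f f' g : AQ n) (hg : g 0 = 1)
    (h : mulL lam f g = mulL lam f' g) : f = f' := by
  funext γ
  induction γ using WellFoundedLT.induction with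
  | ind γ ih =>
  have := congrFun h γ
  rw [mulL_split _ _ _ hg, mulL_split _ _ _ hg] at this
  have e : ∑ γ₁ ∈ Finset.Iio γ, tq ^ (lam (toZ γ₁) (toZ (γ - γ₁))) * f γ₁ * g (γ - γ₁)
     = ∑ γ₁ ∈ Finset.Iio γ, tq ^ (lam (toZ γ₁) (toZ (γ - γ₁))) * f' γ₁ * g (γ - γ₁) := by
    apply Finset.sum_congr rfl
    intro x hx
    rw [ih x (Finset.mem_Iio.1 hx)]
  rw [e] at this
  exact add_right_cancel this

theorem exists_div {n : ℕ} (lam : BF n) (a g : AQ n) (hg : g 0 = 1) :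
    ∃ d, mulL lam d g = a := by
  have wf : WellFounded (fun x y : Fin n → ℕ => x < y) := wellFounded_lt
  let F : (γ : Fin n → ℕ) → ((δ : Fin n → ℕ) → δ < γ → RatFunc ℚ) → RatFunc ℚ := fun γ r =>
    a γ - ∑ x ∈ (Finset.Iio γ).attach,
      tq ^ (lam (toZ x.1) (toZ (γ - x.1))) * r x.1 (Finset.mem_Iio.1 x.2) * g (γ - x.1)
  refine ⟨wf.fix F, ?_⟩
  funext γ
  rw [mulL_split _ _ _ hg, wf.fix_eq]
  simp only [F]
  rw [Finset.sum_attach (Finset.Iio γ) (fun x =>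
    tq ^ (lam (toZ x) (toZ (γ - x))) * wf.fix F x * g (γ - x))]
  ring

/-- support in a predicate -/
def Supp {n : ℕ} (G : (Fin n → ℕ) → Prop) (f : AQ n) : Prop := ∀ γ, ¬ G γ → f γ = 0

theorem supp_mul {n : ℕ} (lam : BF n) {G : (Fin n → ℕ) → Prop}
    (hG : ∀ a b, G a → G b → G (a + b)) {f g : AQ n} (hf : Supp G f) (hg : Supp G g) :
    Supp G (mulL lam f g) := by
  intro γ hγ
  unfold mulL
  apply Finset.sum_eq_zero
  intro x hx
  have hx' : x ≤ γ := Finset.mem_Iic.1 hx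
  by_cases h1 : G x
  · by_cases h2 : G (γ - x)
    · exact absurd (by simpa [add_tsub_cancel_of_le hx'] using hG _ _ h1 h2) hγ
    · rw [hg _ h2]; simp
  · rw [hf _ h1]; simp

theorem supp_prod {n : ℕ} (lam : BF n) {G : (Fin n → ℕ) → Prop} (h0 : G 0)
    (hG : ∀ a b, G a → G b → G (a + b)) (L : List (AQ n)) (hL : ∀ f ∈ L, Supp G f) :
    Supp G (prodL lam L) := by
  induction L with
  | nil =>
    intro γ hγ
    have : γ ≠ 0 := by rintro rfl; exact hγ h0
    simp [prodL, oneQ, this]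
  | cons a L ih =>
    rw [prodL_cons]
    exact supp_mul lam hG (hL a (by simp)) (ih (fun f hf => hL f (by simp [hf])))

theorem supp_div {n : ℕ} (lam : BF n) {G : (Fin n → ℕ) → Prop}
    (hG : ∀ a b, G a → G b → G (a + b)) {d g a : AQ n} (hg0 : g 0 = 1)
    (hg : Supp G g) (ha : Supp G a) (h : mulL lam d g = a) : Supp G d := by
  intro γ
  induction γ using WellFoundedLT.induction with
  | ind γ ih =>
  intro hγ
  have := congrFun h γ
  rw [mulL_split _ _ _ hg0, ha _ hγ] at this
  have e : ∑ γ₁ ∈ Finset.Iio γ, tq ^ (lam (toZ γ₁) (toZ (γ - γ₁))) * d γ₁ * g (γ - γ₁) = 0 := by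
    apply Finset.sum_eq_zero
    intro x hx
    have hx' := Finset.mem_Iio.1 hx
    by_cases h1 : G x
    · by_cases h2 : G (γ - x)
      · exact absurd (by simpa [add_tsub_cancel_of_le hx'.le] using hG _ _ h1 h2) hγ
      · rw [hg _ h2]; simp
    · rw [ih _ hx' h1]; simp
  rw [e] at this
  simpa using this

theorem mulL_comm_of {n : ℕ} (lam : BF n) (f g : AQ n)
    (h : ∀ a b, f a ≠ 0 → g b ≠ 0 → lam (toZ a) (toZ b) = 0 ∧ lam (toZ b) (toZ a) = 0) :
    mulL lam f g = mulL lam g f := by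
  funext γ
  unfold mulL
  refine Finset.sum_bij' (fun x _ => γ - x) (fun x _ => γ - x) ?_ ?_ ?_ ?_ ?_
  · intro x hx; simp
  · intro x hx; simp
  · intro x hx; exact tsub_tsub_cancel_of_le (Finset.mem_Iic.1 hx)
  · intro x hx; exact tsub_tsub_cancel_of_le (Finset.mem_Iic.1 hx)
  · intro x hx
    rw [tsub_tsub_cancel_of_le (Finset.mem_Iic.1 hx)]
    by_cases h1 : f x = 0
    · simp [h1]
    by_cases h2 : g (γ - x) = 0
    · simp [h2]
    obtain ⟨e1, e2⟩ := h _ _ h1 h2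
    rw [e1, e2]; ring

/-! ### The dilogarithm coefficients -/

def cq (k : ℕ) : RatFunc ℚ := tq ^ (k ^ 2) * Pq k

theorem Edl_smul {n : ℕ} {u : Fin n → ℕ} (hu : u ≠ 0) (k : ℕ) : Edl u (k • u) = cq k := by
  unfold Edl
  obtain ⟨i, hi⟩ := Function.ne_iff.1 hu
  have hi' : 1 ≤ u i := Nat.one_le_iff_ne_zero.2 hi
  have hk : k ≤ ∑ i, (k • u) i := by
    calc k ≤ k * u i := Nat.le_mul_of_pos_right _ hi'
      _ = (k • u) i := by simp
      _ ≤ ∑ i, (k • u) i := Finset.single_le_sum (f := fun i => (k • u) i) (fun _ _ => Nat.zero_le _) (Finset.mem_univ i)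
  rw [Finset.sum_eq_single k]
  · simp [cq]
  · intro b _ hb
    rw [if_neg]
    intro h
    apply hb
    have := congrFun h i
    simp only [Pi.smul_apply, smul_eq_mul] at this
    exact (Nat.eq_of_mul_eq_mul_right hi' this).symm
  · intro h
    simp only [Finset.mem_range] at h
    omega

theorem Edl_ne {n : ℕ} {u δ : Fin n → ℕ} (h : ∀ k : ℕ, δ ≠ k • u) : Edl u δ = 0 := by
  unfold Edl
  apply Finset.sum_eq_zero
  intro k _
  rw [if_neg (h k)]

theorem Edl_zero {n : ℕ} (u : Fin n → ℕ) : Edl u 0 = 1 := by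
  simp [Edl, Pq]

theorem cq_zero : cq 0 = 1 := by simp [cq, Pq]

theorem exists_of_Edl_ne {n : ℕ} {u δ : Fin n → ℕ} (h : Edl u δ ≠ 0) : ∃ k : ℕ, δ = k • u := by
  by_contra hc
  push Not at hc
  exact h (Edl_ne hc)

theorem Edl_comm {n : ℕ} (lam : BF n) (u v : Fin n → ℕ) (h : lam (toZ u) (toZ v) = 0)
    (h' : lam (toZ v) (toZ u) = 0) :
    mulL lam (Edl u) (Edl v) = mulL lam (Edl v) (Edl u) := by
  apply mulL_comm_of
  intro a b ha hb
  obtain ⟨k, rfl⟩ := exists_of_Edl_ne ha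
  obtain ⟨l, rfl⟩ := exists_of_Edl_ne hb
  rw [toZ_smul, toZ_smul]
  simp only [map_smul, LinearMap.smul_apply, h, h', smul_zero, and_self]

theorem ksmul_single {n : ℕ} (i : Fin n) (k : ℕ) :
    k • (Pi.single i 1 : Fin n → ℕ) = Pi.single i k := by
  rw [← Pi.single_smul']; simp

theorem single1_ne {n : ℕ} (i : Fin n) : (Pi.single i 1 : Fin n → ℕ) ≠ 0 := by
  intro h
  have := congrFun h i
  simp at this

/-- left multiplication by `E(e_i)` -/
theorem Edl_mul_apply {n : ℕ} (lam : BF n) (i : Fin n) (g : AQ n) (γ : Fin n → ℕ) :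
    mulL lam (Edl (Pi.single i 1)) g γ = ∑ k ∈ Finset.range (γ i + 1),
      tq ^ (lam (toZ (Pi.single i k)) (toZ (γ - Pi.single i k))) * cq k * g (γ - Pi.single i k) := by
  unfold mulL
  symm
  have hinj : Function.Injective (fun k : ℕ => (Pi.single i k : Fin n → ℕ)) :=
    fun a b h => by simpa using congrFun h i
  rw [← Finset.sum_subset (s₁ := (Finset.range (γ i + 1)).image
    (fun k : ℕ => (Pi.single i k : Fin n → ℕ)))]
  · rw [Finset.sum_image (fun a _ b _ h => hinj h)]
    apply Finset.sum_congr rfl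
    intro k _
    rw [← ksmul_single, Edl_smul (single1_ne i)]
  · intro x hx
    simp only [Finset.mem_image, Finset.mem_range] at hx
    obtain ⟨k, hk, rfl⟩ := hx
    rw [Finset.mem_Iic]
    intro j
    by_cases h : j = i
    · subst h; simp; omega
    · simp [h]
  · intro x hx hx'
    rw [Edl_ne]
    · simp
    · rintro k rfl
      apply hx'
      rw [ksmul_single] at hx ⊢
      simp only [Finset.mem_image, Finset.mem_range]
      refine ⟨k, ?_, rfl⟩
      have := Finset.mem_Iic.1 hx i
      simp at this; omega

theorem mul_Edl_ne {n : ℕ} (lam : BF n) (u : Fin n → ℕ) (g : AQ n) (γ : Fin n → ℕ)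
    (h : mulL lam g (Edl u) γ ≠ 0) : ∃ k : ℕ, k • u ≤ γ ∧ g (γ - k • u) ≠ 0 := by
  unfold mulL at h
  obtain ⟨x, hx, hne⟩ := Finset.exists_ne_zero_of_sum_ne_zero h
  have hx' := Finset.mem_Iic.1 hx
  obtain ⟨k, hk⟩ := exists_of_Edl_ne (u := u) (δ := γ - x) (by
    intro h0; rw [h0] at hne; simp at hne)
  refine ⟨k, hk ▸ tsub_le_self, ?_⟩
  rw [← hk, tsub_tsub_cancel_of_le hx']
  intro h0; rw [h0] at hne; simp at hne

/-! ### The q-identity -/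

theorem one_sub_ne (k : ℕ) : (1 : RatFunc ℚ) - tq ^ (2 * (k + 1)) ≠ 0 := by
  intro h
  have h1 : tq ^ (2 * (k + 1)) = 1 := (sub_eq_zero.1 h).symm
  have h2 : algebraMap (Polynomial ℚ) (RatFunc ℚ) (Polynomial.X ^ (2 * (k + 1)))
      = algebraMap (Polynomial ℚ) (RatFunc ℚ) 1 := by
    rw [map_pow, RatFunc.algebraMap_X, map_one]; exact h1
  have h3 := RatFunc.algebraMap_injective ℚ h2
  have h4 := congrArg Polynomial.natDegree h3
  simp at h4

theorem Pq_succ (k : ℕ) : Pq (k + 1) * (1 - tq ^ (2 * (k + 1))) = Pq k := by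
  unfold Pq
  rw [Finset.prod_Icc_succ_top (by omega), mul_assoc, inv_mul_cancel₀ (one_sub_ne k), mul_one]

theorem Pq_zero : Pq 0 = 1 := by simp [Pq]

def FF (a b k : ℕ) : RatFunc ℚ :=
  if k ≤ a ∧ k ≤ b then tq ^ (2 * ((a - k) * (b - k))) * Pq (a - k) * Pq (b - k) * Pq k else 0

theorem FF_zero (a b : ℕ) :
    (1 - tq ^ (2 * (a + 1))) * FF (a + 1) b 0 = tq ^ (2 * b) * FF a b 0 := by
  simp only [FF, Nat.zero_le, and_self, if_true, Nat.sub_zero]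
  rw [← Pq_succ a]
  have : tq ^ (2 * ((a + 1) * b)) = tq ^ (2 * (a * b)) * tq ^ (2 * b) := by
    rw [← pow_add]; congr 1; ring
  rw [this]; ring

theorem FF_succ (a b k : ℕ) :
    (1 - tq ^ (2 * (a + 1))) * FF (a + 1) (b + 1) (k + 1) =
      FF a b k + tq ^ (2 * (b + 1)) * FF a (b + 1) (k + 1) := by
  by_cases hb : k ≤ b
  · obtain ⟨b', rfl⟩ := Nat.exists_eq_add_of_le hb
    by_cases ha : k ≤ a
    · obtain ⟨a', rfl⟩ := Nat.exists_eq_add_of_le ha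
      have e1 : FF (k + a' + 1) (k + b' + 1) (k + 1) =
          tq ^ (2 * (a' * b')) * Pq a' * Pq b' * Pq (k + 1) := by
        rw [FF, if_pos (by omega)]
        rw [show k + a' + 1 - (k + 1) = a' by omega, show k + b' + 1 - (k + 1) = b' by omega]
      have e2 : FF (k + a') (k + b') k = tq ^ (2 * (a' * b')) * Pq a' * Pq b' * Pq k := by
        rw [FF, if_pos (by omega)]
        rw [show k + a' - k = a' by omega, show k + b' - k = b' by omega]
      rw [e1, e2]
      cases a' with
      | zero =>
        have e3 : FF (k + 0) (k + b' + 1) (k + 1) = 0 := by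
          rw [FF, if_neg (by omega)]
        rw [e3, ← Pq_succ k]
        simp only [Nat.add_zero]
        ring
      | succ a' =>
        have e3 : FF (k + (a' + 1)) (k + b' + 1) (k + 1) =
            tq ^ (2 * (a' * b')) * Pq a' * Pq b' * Pq (k + 1) := by
          rw [FF, if_pos (by omega)]
          rw [show k + (a' + 1) - (k + 1) = a' by omega,
            show k + b' + 1 - (k + 1) = b' by omega]
        rw [e3, ← Pq_succ k, ← Pq_succ a']
        ring
    · have e1 : FF (a + 1) (k + b' + 1) (k + 1) = 0 := by rw [FF, if_neg (by omega)]
      have e2 : FF a (k + b') k = 0 := by rw [FF, if_neg (by omega)]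
      have e3 : FF a (k + b' + 1) (k + 1) = 0 := by rw [FF, if_neg (by omega)]
      rw [e1, e2, e3]; ring
  · have e1 : FF (a + 1) (b + 1) (k + 1) = 0 := by rw [FF, if_neg (by omega)]
    have e2 : FF a b k = 0 := by rw [FF, if_neg (by omega)]
    have e3 : FF a (b + 1) (k + 1) = 0 := by rw [FF, if_neg (by omega)]
    rw [e1, e2, e3]; ring

theorem sum_FF (a : ℕ) : ∀ b N : ℕ, a < N →
    ∑ k ∈ Finset.range N, FF a b k = Pq a * Pq b := by
  induction a with
  | zero =>
    intro b N hN
    rw [Finset.sum_eq_single 0]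
    · simp [FF, Pq_zero]
    · intro k _ hk
      rw [FF, if_neg (by omega)]
    · intro h; simp at h; omega
  | succ a ih =>
    intro b N hN
    cases b with
    | zero =>
      rw [Finset.sum_eq_single 0]
      · simp [FF, Pq_zero]
      · intro k _ hk
        rw [FF, if_neg (by omega)]
      · intro h; simp at h; omega
    | succ b =>
      obtain ⟨M, rfl⟩ : ∃ M, N = M + 1 := ⟨N - 1, by omega⟩
      have h1 := ih b M (by omega)
      have h2 := ih (b + 1) (M + 1) (by omega)
      apply mul_left_cancel₀ (one_sub_ne a)
      rw [Finset.mul_sum, Finset.sum_range_succ']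
      simp only [FF_succ, FF_zero]
      rw [Finset.sum_add_distrib, h1, add_assoc, ← Finset.mul_sum, ← mul_add,
        ← Finset.sum_range_succ' (fun k => FF a (b + 1) k), h2, ← Pq_succ a, ← Pq_succ b]
      ring

/-! ### Pentagon -/

theorem supp_Edl {n : ℕ} {G : (Fin n → ℕ) → Prop} (h0 : G 0)
    (hG : ∀ a b, G a → G b → G (a + b)) {u : Fin n → ℕ} (hu : G u) : Supp G (Edl u) := by
  have hk : ∀ k : ℕ, G (k • u) := by
    intro k
    induction k with
    | zero => rw [zero_smul]; exact h0
    | succ k ih => rw [succ_nsmul]; exact hG _ _ ih hu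
  intro γ hγ
  apply Edl_ne
  rintro k rfl
  exact hγ (hk k)

theorem pent_mid {n : ℕ} (lam : BF n) (i j : Fin n) (hij : i ≠ j)
    (h2 : lam (Pi.single j 1) (Pi.single i 1) = 1)
    (h3 : lam (Pi.single i 1) (Pi.single i 1) = 0) (a d : ℕ) :
    mulL lam (Edl (Pi.single i 1 + Pi.single j 1)) (Edl (Pi.single i 1))
      (Pi.single i a + Pi.single j d) =
    if d ≤ a then tq ^ (((d * (a - d) : ℕ) : ℤ)) * cq d * cq (a - d) else 0 := by
  have hji : j ≠ i := hij.symm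
  have hune : (Pi.single i 1 + Pi.single j 1 : Fin n → ℕ) ≠ 0 := by
    intro h
    have := congrFun h i
    simp [hij] at this
  have key : ∀ x : Fin n → ℕ, x ≤ Pi.single i a + Pi.single j d →
      Edl (Pi.single i 1 + Pi.single j 1) x ≠ 0 →
      Edl (Pi.single i 1) (Pi.single i a + Pi.single j d - x) ≠ 0 →
      x = d • (Pi.single i 1 + Pi.single j 1) ∧ d ≤ a := by
    intro x hx h5 h6
    obtain ⟨k, rfl⟩ := exists_of_Edl_ne h5
    obtain ⟨l, hl⟩ := exists_of_Edl_ne h6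
    have e1 := congrFun hl j
    have e2 := hx j
    have e3 := hx i
    simp [hij, hji] at e1 e2 e3
    have : k = d := by omega
    subst this
    exact ⟨rfl, e3⟩
  split_ifs with hd
  · unfold mulL
    obtain ⟨c, rfl⟩ := Nat.exists_eq_add_of_le hd
    have hle : d • (Pi.single i 1 + Pi.single j 1 : Fin n → ℕ)
        ≤ Pi.single i (d + c) + Pi.single j d := by
      intro m
      by_cases hm : m = i
      · subst hm; simp [hij]
      · by_cases hm' : m = j
        · subst hm'; simp [hm]
        · simp [hm, hm']
    have hsub : (Pi.single i (d + c) + Pi.single j d : Fin n → ℕ) -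
        d • (Pi.single i 1 + Pi.single j 1 : Fin n → ℕ) = c • (Pi.single i 1) := by
      funext m
      by_cases hm : m = i
      · subst hm; simp [hij]
      · by_cases hm' : m = j
        · subst hm'; simp [hm]
        · simp [hm, hm']
    rw [Finset.sum_eq_single (d • (Pi.single i 1 + Pi.single j 1))]
    · rw [hsub, Edl_smul hune, Edl_smul (single1_ne i), toZ_smul, toZ_smul, toZ_add,
        toZ_single, toZ_single]
      rw [show d + c - d = c by omega]
      congr 3
      simp only [map_smul, LinearMap.smul_apply, map_add, LinearMap.add_apply, Nat.cast_one, h2, h3]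
      simp [mul_comm]
    · intro x hx hne
      by_contra hc
      apply hne
      refine (key x (Finset.mem_Iic.1 hx) ?_ ?_).1
      · intro h; simp [h] at hc
      · intro h; simp [h] at hc
    · intro h
      exact absurd (Finset.mem_Iic.2 hle) h
  · unfold mulL
    apply Finset.sum_eq_zero
    intro x hx
    by_contra hc
    apply hd
    refine (key x (Finset.mem_Iic.1 hx) ?_ ?_).2
    · intro h; simp [h] at hc
    · intro h; simp [h] at hc

theorem pentagon {n : ℕ} (lam : BF n) (i j : Fin n) (hij : i ≠ j)
    (h1 : lam (Pi.single i 1) (Pi.single j 1) = -1)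
    (h2 : lam (Pi.single j 1) (Pi.single i 1) = 1)
    (h3 : lam (Pi.single i 1) (Pi.single i 1) = 0)
    (h4 : lam (Pi.single j 1) (Pi.single j 1) = 0) :
    mulL lam (Edl (Pi.single i 1)) (Edl (Pi.single j 1)) =
    mulL lam (mulL lam (Edl (Pi.single j 1)) (Edl (Pi.single i 1 + Pi.single j 1)))
      (Edl (Pi.single i 1)) := by
  have hji : j ≠ i := hij.symm
  rw [mulL_assoc]
  funext γ
  by_cases hγ : ∀ m, m ≠ i → m ≠ j → γ m = 0
  · obtain ⟨a, b, rfl⟩ : ∃ a b, γ = Pi.single i a + Pi.single j b := by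
      refine ⟨γ i, γ j, ?_⟩
      funext m
      by_cases hm : m = i
      · subst hm; simp [hij]
      · by_cases hm' : m = j
        · subst hm'; simp [hm]
        · simp [hm, hm', hγ]
    have hpi : (Pi.single i a + Pi.single j b : Fin n → ℕ) i = a := by simp [hij]
    have hpj : (Pi.single i a + Pi.single j b : Fin n → ℕ) j = b := by simp [hji]
    have sm : ∀ (m : Fin n) (k : ℕ), toZ (Pi.single m k : Fin n → ℕ)
        = (k : ℤ) • Pi.single m (1 : ℤ) := by
      intro m k
      rw [← ksmul_single, toZ_smul, toZ_single]; rfl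
    rw [Edl_mul_apply, Edl_mul_apply, hpi, hpj]
    rw [Finset.sum_eq_single a]
    · have hs : (Pi.single i a + Pi.single j b : Fin n → ℕ) - Pi.single i a = Pi.single j b := by
        simp
      rw [hs, ← ksmul_single j b, Edl_smul (single1_ne j), ksmul_single, sm, sm]
      simp only [map_smul, LinearMap.smul_apply, h1]
      rw [← Finset.sum_range_reflect]
      have hterm : ∀ k ∈ Finset.range (b + 1),
          tq ^ (lam (toZ (Pi.single j (b + 1 - 1 - k)))
            (toZ ((Pi.single i a + Pi.single j b : Fin n → ℕ) - Pi.single j (b + 1 - 1 - k)))) *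
            cq (b + 1 - 1 - k) *
            mulL lam (Edl (Pi.single i 1 + Pi.single j 1)) (Edl (Pi.single i 1))
              ((Pi.single i a + Pi.single j b : Fin n → ℕ) - Pi.single j (b + 1 - 1 - k)) =
          tq ^ ((a : ℤ) ^ 2 + (b : ℤ) ^ 2 - a * b) * FF b a k := by
        intro k hk
        have hkb : k ≤ b := by simp at hk; omega
        obtain ⟨c, rfl⟩ := Nat.exists_eq_add_of_le hkb
        rw [show k + c + 1 - 1 - k = c by omega]
        have hs : (Pi.single i a + Pi.single j (k + c) : Fin n → ℕ) - Pi.single j c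
            = Pi.single i a + Pi.single j k := by
          funext m
          by_cases hm : m = i
          · subst hm; simp [hij]
          · by_cases hm' : m = j
            · subst hm'; simp [hm]
            · simp [hm, hm']
        rw [hs, pent_mid lam i j hij h2 h3]
        by_cases hka : k ≤ a
        · obtain ⟨d, rfl⟩ := Nat.exists_eq_add_of_le hka
          rw [if_pos hka, FF, if_pos ⟨hkb, hka⟩]
          rw [show k + c - k = c by omega, show k + d - k = d by omega, toZ_add, sm, sm, sm]
          simp only [map_smul, LinearMap.smul_apply, map_add, h2, h4, cq, ← zpow_natCast]
          have e : ∀ x y z w v : ℤ, tq ^ x * (tq ^ y * Pq c) * (tq ^ z * (tq ^ w * Pq k)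
              * (tq ^ v * Pq d)) = tq ^ (x + y + z + w + v) * (Pq c * Pq d * Pq k) := by
            intro x y z w v
            simp only [zpow_add₀ tq_ne]; ring
          have e' : ∀ x y : ℤ, tq ^ x * (tq ^ y * Pq c * Pq d * Pq k)
              = tq ^ (x + y) * (Pq c * Pq d * Pq k) := by
            intro x y
            simp only [zpow_add₀ tq_ne]; ring
          rw [e, e']
          congr 2
          simp only [smul_eq_mul]
          push_cast
          ring
        · rw [if_neg hka, FF, if_neg (by omega)]; simp
      rw [Finset.sum_congr rfl hterm, ← Finset.mul_sum, sum_FF b a (b + 1) (by omega)]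
      simp only [cq, ← zpow_natCast]
      have e' : ∀ x y z : ℤ, tq ^ x * (tq ^ y * Pq a) * (tq ^ z * Pq b)
              = tq ^ (x + y + z) * (Pq b * Pq a) := by
        intro x y z
        simp only [zpow_add₀ tq_ne]; ring
      rw [e']
      congr 2
      simp only [smul_eq_mul]
      push_cast
      ring
    · intro k hk hne
      have : k < a := by simp at hk; omega
      rw [Edl_ne]
      · simp
      · intro l hl
        have := congrFun hl i
        simp [hij] at this
        omega
    · intro h; simp at h
  · have h0 : (fun δ : Fin n → ℕ => ∀ m, m ≠ i → m ≠ j → δ m = 0) 0 := by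
      intro m _ _; rfl
    have hG : ∀ a b : Fin n → ℕ, (fun δ : Fin n → ℕ => ∀ m, m ≠ i → m ≠ j → δ m = 0) a →
        (fun δ : Fin n → ℕ => ∀ m, m ≠ i → m ≠ j → δ m = 0) b →
        (fun δ : Fin n → ℕ => ∀ m, m ≠ i → m ≠ j → δ m = 0) (a + b) := by
      intro a b ha hb m h1 h2
      simp [ha m h1 h2, hb m h1 h2]
    have hi := supp_Edl h0 hG (u := Pi.single i 1) (by intro m h1 h2; simp [h1])
    have hj := supp_Edl h0 hG (u := Pi.single j 1) (by intro m h1 h2; simp [h2])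
    have hu := supp_Edl h0 hG (u := Pi.single i 1 + Pi.single j 1)
      (by intro m h1 h2; simp [h1, h2])
    rw [supp_mul lam hG hi hj γ hγ, supp_mul lam hG hj (supp_mul lam hG hu hi) γ hγ]

/-! ### Transport along a linear involution -/

def GG {n : ℕ} (s : (Fin n → ℤ) →ₗ[ℤ] (Fin n → ℤ)) (γ : Fin n → ℕ) : Prop := 0 ≤ s (toZ γ)

def sN {n : ℕ} (s : (Fin n → ℤ) →ₗ[ℤ] (Fin n → ℤ)) (γ : Fin n → ℕ) : Fin n → ℕ :=
  fun j => (s (toZ γ) j).toNat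

theorem toZ_sN {n : ℕ} {s : (Fin n → ℤ) →ₗ[ℤ] (Fin n → ℤ)} {γ : Fin n → ℕ} (h : GG s γ) :
    toZ (sN s γ) = s (toZ γ) := by
  funext j
  exact Int.toNat_of_nonneg (h j)

theorem GG_zero {n : ℕ} (s : (Fin n → ℤ) →ₗ[ℤ] (Fin n → ℤ)) : GG s 0 := by
  unfold GG; rw [toZ_zero, map_zero]

theorem GG_add {n : ℕ} (s : (Fin n → ℤ) →ₗ[ℤ] (Fin n → ℤ)) (a b : Fin n → ℕ)
    (ha : GG s a) (hb : GG s b) : GG s (a + b) := by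
  unfold GG at *; rw [toZ_add, map_add]; exact add_nonneg ha hb

theorem sN_add {n : ℕ} {s : (Fin n → ℤ) →ₗ[ℤ] (Fin n → ℤ)} {a b : Fin n → ℕ}
    (ha : GG s a) (hb : GG s b) : sN s (a + b) = sN s a + sN s b := by
  apply toZ_inj
  rw [toZ_sN (GG_add s a b ha hb), toZ_add, toZ_add, toZ_sN ha, toZ_sN hb, map_add]

theorem GG_sN {n : ℕ} {s : (Fin n → ℤ) →ₗ[ℤ] (Fin n → ℤ)} (hs : ∀ x, s (s x) = x)
    {γ : Fin n → ℕ} (h : GG s γ) : GG s (sN s γ) := by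
  unfold GG; rw [toZ_sN h, hs]; exact toZ_nonneg γ

theorem sN_sN {n : ℕ} {s : (Fin n → ℤ) →ₗ[ℤ] (Fin n → ℤ)} (hs : ∀ x, s (s x) = x)
    {γ : Fin n → ℕ} (h : GG s γ) : sN s (sN s γ) = γ := by
  apply toZ_inj
  rw [toZ_sN (GG_sN hs h), toZ_sN h, hs]

theorem GG_smul {n : ℕ} {s : (Fin n → ℤ) →ₗ[ℤ] (Fin n → ℤ)} {u : Fin n → ℕ} (h : GG s u)
    (k : ℕ) : GG s (k • u) := by
  unfold GG at *; rw [toZ_smul, map_smul]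
  exact smul_nonneg (by positivity) h

theorem sN_smul {n : ℕ} {s : (Fin n → ℤ) →ₗ[ℤ] (Fin n → ℤ)} {u : Fin n → ℕ} (h : GG s u)
    (k : ℕ) : sN s (k • u) = k • sN s u := by
  apply toZ_inj
  rw [toZ_sN (GG_smul h k), toZ_smul, toZ_smul, map_smul, toZ_sN h]

open Classical in
def TT {n : ℕ} (s : (Fin n → ℤ) →ₗ[ℤ] (Fin n → ℤ)) (f : AQ n) : AQ n := fun γ =>
  if GG s γ then f (sN s γ) else 0

theorem supp_TT {n : ℕ} (s : (Fin n → ℤ) →ₗ[ℤ] (Fin n → ℤ)) (f : AQ n) : Supp (GG s) (TT s f) := by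
  intro γ hγ
  simp [TT, hγ]

theorem TT_one {n : ℕ} {s : (Fin n → ℤ) →ₗ[ℤ] (Fin n → ℤ)} (hs : ∀ x, s (s x) = x) :
    TT s (oneQ : AQ n) = oneQ := by
  funext γ
  unfold TT oneQ
  have h0 : sN s (0 : Fin n → ℕ) = 0 := by
    apply toZ_inj; rw [toZ_sN (GG_zero s), toZ_zero, map_zero]
  by_cases h : γ = 0
  · subst h
    simp [GG_zero, h0]
  · simp only [h, if_false]
    split_ifs with h1 h2
    · exfalso; apply h
      rw [← sN_sN hs h1, h2, h0]
    · rfl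
    · rfl

theorem TT_mul {n : ℕ} {s : (Fin n → ℤ) →ₗ[ℤ] (Fin n → ℤ)} (hs : ∀ x, s (s x) = x)
    {lam lam' : BF n} (hl : ∀ x y, lam' x y = lam (s x) (s y)) {f g : AQ n}
    (hf : Supp (GG s) f) (hg : Supp (GG s) g) :
    TT s (mulL lam f g) = mulL lam' (TT s f) (TT s g) := by
  classical
  funext γ
  by_cases hγ : GG s γ
  · have e : TT s (mulL lam f g) γ = mulL lam f g (sN s γ) := by simp [TT, hγ]
    rw [e]
    unfold mulL
    rw [← Finset.sum_filter_of_ne (s := Finset.Iic γ) (p := fun x => GG s x ∧ GG s (γ - x)),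
      ← Finset.sum_filter_of_ne (s := Finset.Iic (sN s γ))
        (p := fun x => GG s x ∧ GG s (sN s γ - x))]
    · have key : ∀ δ x : Fin n → ℕ, x ≤ δ → GG s x → GG s (δ - x) →
          sN s x ≤ sN s δ ∧ sN s δ - sN s x = sN s (δ - x) := by
        intro δ x hx h1 h2
        have := sN_add h1 h2
        rw [add_tsub_cancel_of_le hx] at this
        rw [this]
        exact ⟨le_self_add, by simp⟩
      refine Finset.sum_bij' (fun x _ => sN s x) (fun x _ => sN s x) ?_ ?_ ?_ ?_ ?_
      · intro x hx
        simp only [Finset.mem_filter, Finset.mem_Iic] at hx ⊢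
        obtain ⟨h0, h1, h2⟩ := hx
        obtain ⟨k1, k2⟩ := key _ _ h0 h1 h2
        rw [sN_sN hs hγ] at k1 k2
        refine ⟨k1, GG_sN hs h1, ?_⟩
        rw [k2]; exact GG_sN hs h2
      · intro x hx
        simp only [Finset.mem_filter, Finset.mem_Iic] at hx ⊢
        obtain ⟨h0, h1, h2⟩ := hx
        obtain ⟨k1, k2⟩ := key _ _ h0 h1 h2
        refine ⟨k1, GG_sN hs h1, ?_⟩
        rw [k2]; exact GG_sN hs h2
      · intro x hx
        simp only [Finset.mem_filter, Finset.mem_Iic] at hx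
        exact sN_sN hs hx.2.1
      · intro x hx
        simp only [Finset.mem_filter, Finset.mem_Iic] at hx
        exact sN_sN hs hx.2.1
      · intro x hx
        simp only [Finset.mem_filter, Finset.mem_Iic] at hx
        obtain ⟨h0, h1, h2⟩ := hx
        obtain ⟨k1, k2⟩ := key _ _ h0 h1 h2
        rw [sN_sN hs hγ] at k1 k2
        rw [k2, hl, toZ_sN h1, toZ_sN h2, hs, hs]
        simp only [TT, GG_sN hs h1, GG_sN hs h2, if_true, sN_sN hs h1, sN_sN hs h2]
    · intro x _ hne
      constructor
      · by_contra hc; simp [hf _ hc] at hne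
      · by_contra hc; simp [hg _ hc] at hne
    · intro x _ hne
      constructor
      · by_contra hc; simp [supp_TT s f _ hc] at hne
      · by_contra hc; simp [supp_TT s g _ hc] at hne
  · rw [supp_TT s _ γ hγ, supp_mul lam' (GG_add s) (supp_TT s f) (supp_TT s g) γ hγ]

theorem TT_prod {n : ℕ} {s : (Fin n → ℤ) →ₗ[ℤ] (Fin n → ℤ)} (hs : ∀ x, s (s x) = x)
    {lam lam' : BF n} (hl : ∀ x y, lam' x y = lam (s x) (s y)) (L : List (AQ n))
    (hL : ∀ f ∈ L, Supp (GG s) f) :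
    TT s (prodL lam L) = prodL lam' (L.map (TT s)) := by
  induction L with
  | nil => exact TT_one hs
  | cons a L ih =>
    rw [prodL_cons, List.map_cons, prodL_cons,
      TT_mul hs hl (hL a (by simp))
        (supp_prod lam (GG_zero s) (GG_add s) L (fun f hf => hL f (by simp [hf]))),
      ih (fun f hf => hL f (by simp [hf]))]

theorem TT_Edl {n : ℕ} {s : (Fin n → ℤ) →ₗ[ℤ] (Fin n → ℤ)} (hs : ∀ x, s (s x) = x)
    {u : Fin n → ℕ} (hu : u ≠ 0) (h : GG s u) : TT s (Edl u) = Edl (sN s u) := by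
  have hu' : sN s u ≠ 0 := by
    intro h0
    apply hu
    apply toZ_inj
    rw [← hs (toZ u), ← toZ_sN h, h0, toZ_zero, map_zero]
  funext γ
  by_cases hγ : ∃ k : ℕ, γ = k • sN s u
  · obtain ⟨k, rfl⟩ := hγ
    rw [Edl_smul hu', TT, if_pos (GG_smul (GG_sN hs h) k), sN_smul (GG_sN hs h), sN_sN hs h,
      Edl_smul hu]
  · push Not at hγ
    rw [Edl_ne hγ, TT]
    split_ifs with h1
    · apply Edl_ne
      intro k hk
      apply hγ k
      rw [← sN_smul h, ← hk, sN_sN hs h1]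
    · rfl

/-! ### The Cartan form and reflections -/

/-- `e_i` as an integral vector -/
abbrev ez {n : ℕ} (i : Fin n) : Fin n → ℤ := Pi.single i 1

structure Cartan {n : ℕ} (C : BF n) : Prop where
  symm : ∀ x y, C x y = C y x
  pos : ∀ x, x ≠ 0 → 0 < C x x
  even : ∀ x, 2 ∣ C x x
  diag : ∀ i, C (ez i) (ez i) = 2
  off : ∀ i j, i ≠ j → C (ez i) (ez j) ≤ 0

/-- simple reflection -/
def refl {n : ℕ} (C : BF n) (i : Fin n) : (Fin n → ℤ) →ₗ[ℤ] (Fin n → ℤ) :=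
  LinearMap.id - (C (ez i)).smulRight (ez i)

theorem refl_apply {n : ℕ} (C : BF n) (i : Fin n) (x : Fin n → ℤ) :
    refl C i x = x - C (ez i) x • ez i := by
  simp [refl]

theorem refl_refl {n : ℕ} {C : BF n} (hC : Cartan C) (i : Fin n) (x : Fin n → ℤ) :
    refl C i (refl C i x) = x := by
  rw [refl_apply, refl_apply]
  simp only [map_sub, map_smul, hC.diag, smul_eq_mul]
  funext j
  simp only [Pi.sub_apply, Pi.smul_apply, smul_eq_mul]
  ring

theorem refl_self {n : ℕ} {C : BF n} (hC : Cartan C) (i : Fin n) :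
    refl C i (ez i) = - ez i := by
  rw [refl_apply, hC.diag]
  funext j
  simp only [Pi.sub_apply, Pi.smul_apply, smul_eq_mul, Pi.neg_apply]
  ring

theorem refl_form {n : ℕ} {C : BF n} (hC : Cartan C) (i : Fin n) (x y : Fin n → ℤ) :
    C (refl C i x) (refl C i y) = C x y := by
  rw [refl_apply, refl_apply]
  simp only [map_sub, map_smul, LinearMap.sub_apply, LinearMap.smul_apply, hC.diag, smul_eq_mul]
  rw [hC.symm x (ez i)]
  ring

theorem refl_coord {n : ℕ} (C : BF n) (i j : Fin n) (h : j ≠ i) (x : Fin n → ℤ) :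
    refl C i x j = x j := by
  rw [refl_apply]; simp [h]

theorem vec_sum {n : ℕ} (x : Fin n → ℤ) : x = ∑ i, x i • ez i := by
  funext j
  simp [Finset.sum_apply, Pi.single_apply]

theorem off_ge {n : ℕ} {C : BF n} (hC : Cartan C) (i j : Fin n) (h : i ≠ j) :
    C (ez i) (ez j) = 0 ∨ C (ez i) (ez j) = -1 := by
  have h1 := hC.off i j h
  have hne : ez i + ez j ≠ 0 := by
    intro h0
    have := congrFun h0 i
    simp [h] at this
  have h2 := hC.pos _ hne
  simp only [map_add, LinearMap.add_apply, hC.diag] at h2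
  rw [hC.symm (ez j) (ez i)] at h2
  omega

/-- nonneg vectors with disjoint supports pair nonpositively -/
theorem form_nonpos {n : ℕ} {C : BF n} (hC : Cartan C) (x y : Fin n → ℤ) (hx : 0 ≤ x)
    (hy : 0 ≤ y) (hd : ∀ i, x i * y i = 0) : C x y ≤ 0 := by
  rw [vec_sum x, vec_sum y]
  simp only [map_sum, LinearMap.sum_apply, map_smul, LinearMap.smul_apply, smul_eq_mul,
    Finset.mul_sum]
  apply Finset.sum_nonpos
  intro i _
  apply Finset.sum_nonpos
  intro j _
  by_cases h : j = i
  · subst h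
    rw [hC.diag]
    have := hd j
    nlinarith
  · have h1 := hC.off j i h
    have h2 := hx j
    have h3 := hy i
    simp only [Pi.zero_apply] at h2 h3
    nlinarith [mul_nonneg h2 h3]

/-- roots are positive or negative -/
theorem root_sign {n : ℕ} {C : BF n} (hC : Cartan C) (x : Fin n → ℤ) (hx : C x x = 2)
    (j : Fin n) (hj : 0 < x j) : 0 ≤ x := by
  by_contra hneg
  let p : Fin n → ℤ := fun i => max (x i) 0
  let m : Fin n → ℤ := fun i => max (- x i) 0
  have hxpm : x = p - m := by
    funext i
    simp only [p, m, Pi.sub_apply]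
    omega
  have hp0 : p ≠ 0 := by
    intro h
    have := congrFun h j
    simp only [p, Pi.zero_apply] at this
    omega
  have hm0 : m ≠ 0 := by
    intro h
    apply hneg
    intro i
    have := congrFun h i
    simp only [m, Pi.zero_apply] at this ⊢
    omega
  have h1 := hC.pos p hp0
  have h2 := hC.pos m hm0
  have h3 := hC.even p
  have h4 := hC.even m
  have h5 : C p m ≤ 0 := by
    apply form_nonpos hC
    · intro i; simp [p]
    · intro i; simp [m]
    · intro i
      simp only [p, m]
      rcases le_total (x i) 0 with h | h
      · rw [max_eq_right h]; simp
      · rw [max_eq_right (a := - x i) (by omega)]; simp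
  rw [hxpm] at hx
  simp only [map_sub, LinearMap.sub_apply] at hx
  rw [hC.symm m p] at hx
  omega

/-- natural-number positive roots -/
def IsRoot {n : ℕ} (C : BF n) (β : Fin n → ℕ) : Prop := C (toZ β) (toZ β) = 2

theorem toZ_e {n : ℕ} (i : Fin n) : toZ (Pi.single i 1 : Fin n → ℕ) = ez i := by
  rw [toZ_single]; rfl

theorem isRoot_single {n : ℕ} {C : BF n} (hC : Cartan C) (i : Fin n) :
    IsRoot C (Pi.single i 1) := by
  unfold IsRoot; rw [toZ_e, hC.diag]

theorem IsRoot.ne_zero {n : ℕ} {C : BF n} {β : Fin n → ℕ} (h : IsRoot C β) : β ≠ 0 := by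
  rintro rfl
  unfold IsRoot at h
  rw [toZ_zero] at h
  simp at h

theorem root_other {n : ℕ} {C : BF n} (hC : Cartan C) (i : Fin n) {β : Fin n → ℕ}
    (h : IsRoot C β) (hne : β ≠ Pi.single i 1) : ∃ j, j ≠ i ∧ 0 < β j := by
  by_contra hc
  push Not at hc
  have e : β = Pi.single i (β i) := by
    funext j
    by_cases hj : j = i
    · subst hj; simp
    · have := hc j hj
      simp [hj]; omega
  have e2 : toZ β = (β i : ℤ) • ez i := by
    rw [← toZ_e, ← toZ_smul, ksmul_single, ← e]
  unfold IsRoot at h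
  rw [e2] at h
  simp only [map_smul, LinearMap.smul_apply, hC.diag, smul_eq_mul] at h
  have h1 : (β i : ℤ) * β i = 1 := by linarith
  have h2 : β i * β i = 1 := by exact_mod_cast h1
  have h3 : β i = 1 := Nat.eq_one_of_mul_eq_one_right h2
  rw [h3] at e
  exact hne e

theorem GG_root {n : ℕ} {C : BF n} (hC : Cartan C) (i : Fin n) {β : Fin n → ℕ}
    (h : IsRoot C β) (hne : β ≠ Pi.single i 1) : GG (refl C i) β := by
  obtain ⟨j, hj, hpos⟩ := root_other hC i h hne
  apply root_sign hC _ _ j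
  · rw [refl_coord C i j hj]; simpa [toZ] using hpos
  · rw [refl_form hC]; exact h

theorem isRoot_sN {n : ℕ} {C : BF n} (hC : Cartan C) (i : Fin n) {β : Fin n → ℕ}
    (h : IsRoot C β) (hne : β ≠ Pi.single i 1) : IsRoot C (sN (refl C i) β) := by
  unfold IsRoot
  rw [toZ_sN (GG_root hC i h hne), refl_form hC]; exact h

theorem not_GG_single {n : ℕ} {C : BF n} (hC : Cartan C) (i : Fin n) :
    ¬ GG (refl C i) (Pi.single i 1) := by
  intro h
  have := h i
  rw [toZ_e, refl_self hC] at this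
  simp at this

/-! ### States and the reflection step -/

structure State {n : ℕ} (C lam : BF n) (L : List (Fin n)) (B : List (Fin n → ℕ)) : Prop where
  anti : ∀ x y, lam x y = - lam y x
  par : ∀ x y, 2 ∣ C x y - lam x y
  bd : ∀ i j, -1 ≤ lam (ez i) (ez j) ∧ lam (ez i) (ez j) ≤ 1
  Lnodup : L.Nodup
  Lmem : ∀ i, i ∈ L
  Lord : L.Pairwise (fun u v => lam (ez u) (ez v) ≤ 0)
  Bnodup : B.Nodup
  Bmem : ∀ β, β ∈ B ↔ IsRoot C β
  Bord : B.Pairwise (fun a b => 0 ≤ lam (toZ a) (toZ b))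

def AA {n : ℕ} (lam : BF n) (L : List (Fin n)) : AQ n :=
  prodL lam (L.map fun i => Edl (Pi.single i 1))

def RR {n : ℕ} (lam : BF n) (B : List (Fin n → ℕ)) : AQ n := prodL lam (B.map Edl)

theorem State.self {n : ℕ} {C lam : BF n} {L : List (Fin n)} {B : List (Fin n → ℕ)}
    (S : State C lam L B) (x : Fin n → ℤ) : lam x x = 0 := by
  have := S.anti x x; omega

theorem last_simple {n : ℕ} {C lam : BF n} (hC : Cartan C) {L : List (Fin n)}
    {B : List (Fin n → ℕ)} {b : Fin n → ℕ} (S : State C lam L (B ++ [b])) :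
    ∃ i, b = Pi.single i 1 ∧ ∀ j, 0 ≤ lam (ez j) (ez i) := by
  have hb : IsRoot C b := (S.Bmem b).1 (by simp)
  have hpos : ∀ v ∈ B ++ [b], 0 ≤ lam (toZ v) (toZ b) := by
    intro v hv
    rcases List.mem_append.1 hv with h | h
    · exact (List.pairwise_append.1 S.Bord).2.2 v h b (by simp)
    · simp only [List.mem_singleton] at h
      subst h
      rw [S.self]
  have hj : ∀ j, 0 ≤ lam (ez j) (toZ b) := by
    intro j
    have := hpos _ ((S.Bmem _).2 (isRoot_single hC j))
    rwa [toZ_e] at this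
  by_cases hs : ∃ i, b = Pi.single i 1
  · obtain ⟨i, rfl⟩ := hs
    refine ⟨i, rfl, ?_⟩
    intro j
    have := hj j
    rwa [toZ_e] at this
  · exfalso
    push Not at hs
    have hsum : ∑ j, toZ b j * lam (ez j) (toZ b) = 0 := by
      have h1 := S.self (toZ b)
      have h2 : lam (toZ b) (toZ b) = lam (∑ j, toZ b j • ez j) (toZ b) := by
        rw [← vec_sum]
      rw [h1] at h2
      simp only [map_sum, LinearMap.sum_apply, map_smul, LinearMap.smul_apply, smul_eq_mul] at h2
      exact h2.symm
    have hz := (Finset.sum_eq_zero_iff_of_nonneg (fun j _ =>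
      mul_nonneg (toZ_nonneg b j) (hj j))).1 hsum
    have hC0 : ∀ j, toZ b j * C (ez j) (toZ b) = 0 := by
      intro j
      rcases mul_eq_zero.1 (hz j (Finset.mem_univ j)) with h | h
      · rw [h]; simp
      · have hp := S.par (ez j) (toZ b)
        rw [h] at hp
        have n1 : toZ b - ez j ≠ 0 := by
          intro h0
          apply hs j
          apply toZ_inj
          rw [toZ_e]
          exact sub_eq_zero.1 h0
        have n2 : toZ b + ez j ≠ 0 := by
          intro h0
          have h1 := congrFun h0 j
          have h2 := toZ_nonneg b j
          simp at h1 h2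
          omega
        have p1 := hC.pos _ n1
        have p2 := hC.pos _ n2
        unfold IsRoot at hb
        simp only [map_sub, map_add, LinearMap.sub_apply, LinearMap.add_apply, hC.diag, hb] at p1 p2
        rw [hC.symm (toZ b) (ez j)] at p1 p2
        have : C (ez j) (toZ b) = 0 := by omega
        rw [this]; simp
    have h2 : C (toZ b) (toZ b) = C (∑ j, toZ b j • ez j) (toZ b) := by
      rw [← vec_sum]
    simp only [map_sum, LinearMap.sum_apply, map_smul, LinearMap.smul_apply, smul_eq_mul] at h2
    rw [Finset.sum_eq_zero (fun j _ => hC0 j)] at h2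
    unfold IsRoot at hb
    omega

theorem prod_intertwine {n : ℕ} {ι : Type*} (lam : BF n) (a : AQ n) (f g : ι → AQ n) (M : List ι)
    (h : ∀ j ∈ M, mulL lam a (f j) = mulL lam (g j) a) :
    mulL lam a (prodL lam (M.map f)) = mulL lam (prodL lam (M.map g)) a := by
  induction M with
  | nil => simp only [List.map_nil]; exact (mulL_one lam a).trans (one_mulL lam a).symm
  | cons x M ih =>
    simp only [List.map_cons, prodL_cons]
    rw [← mulL_assoc, h x (by simp), mulL_assoc, ih (fun j hj => h j (by simp [hj])), mulL_assoc]

theorem line_lemma {n : ℕ} (lam : BF n) (i : Fin n) (D F : AQ n)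
    (h : mulL lam D (Edl (Pi.single i 1)) = mulL lam (Edl (Pi.single i 1)) F) :
    ∀ (m : ℕ) (γ : Fin n → ℕ), γ i = m → F γ ≠ 0 →
      ∃ k : ℕ, Pi.single i k ≤ γ ∧ D (γ - Pi.single i k) ≠ 0 := by
  intro m
  induction m using Nat.strong_induction_on with
  | _ m ih =>
  intro γ hm hF
  by_cases h0 : mulL lam (Edl (Pi.single i 1)) F γ = 0
  · have : ∃ k, 0 < k ∧ k ≤ γ i ∧ F (γ - Pi.single i k) ≠ 0 := by
      by_contra hc
      push Not at hc
      rw [Edl_mul_apply, Finset.sum_eq_single 0] at h0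
      · simp [cq_zero, toZ_zero] at h0
        exact hF h0
      · intro k hk hne
        rw [hc k (by omega) (by simp at hk; omega)]; simp
      · intro h; simp at h
    obtain ⟨k, hk, hle, hne⟩ := this
    have hle' : Pi.single i k ≤ γ := by
      intro j
      by_cases hj : j = i
      · subst hj; simpa using hle
      · simp [hj]
    obtain ⟨l, hl1, hl2⟩ := ih (m - k) (by omega) (γ - Pi.single i k) (by simp [hm]) hne
    refine ⟨k + l, ?_, ?_⟩
    · rw [Pi.single_add]
      calc Pi.single i k + Pi.single i l ≤ Pi.single i k + (γ - Pi.single i k) := by gcongr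
        _ = γ := add_tsub_cancel_of_le hle'
    · rw [Pi.single_add, ← tsub_tsub]; exact hl2
  · rw [← h] at h0
    obtain ⟨k, h1, h2⟩ := mul_Edl_ne lam _ _ _ h0
    rw [ksmul_single] at h1 h2
    exact ⟨k, h1, h2⟩

theorem sink_val {n : ℕ} {C lam : BF n} (hC : Cartan C) {L : List (Fin n)}
    {B : List (Fin n → ℕ)} (S : State C lam L B) (i : Fin n)
    (hi : ∀ j, 0 ≤ lam (ez j) (ez i)) (j : Fin n) (hj : j ≠ i) :
    lam (ez j) (ez i) = - C (ez i) (ez j) := by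
  have h1 := hi j
  have h2 := S.bd j i
  have h3 := S.par (ez j) (ez i)
  have h4 := off_ge hC i j hj.symm
  rw [hC.symm] at h3
  rcases h4 with h | h <;> rw [h] at h3 ⊢ <;> omega

/-- reflected skew form -/
def lamR {n : ℕ} (C lam : BF n) (i : Fin n) : BF n := lam.compl₁₂ (refl C i) (refl C i)

theorem lamR_apply {n : ℕ} (C lam : BF n) (i : Fin n) (x y : Fin n → ℤ) :
    lamR C lam i x y = lam (refl C i x) (refl C i y) := rfl

theorem lamR_ji {n : ℕ} {C lam : BF n} (hC : Cartan C) {L : List (Fin n)}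
    {B : List (Fin n → ℕ)} (S : State C lam L B) (i : Fin n) (j : Fin n) :
    lamR C lam i (ez j) (ez i) = - lam (ez j) (ez i) := by
  rw [lamR_apply, refl_self hC, refl_apply]
  simp only [map_sub, map_neg, map_smul, LinearMap.sub_apply, LinearMap.smul_apply, S.self,
    smul_zero, sub_zero]

theorem lamR_jk {n : ℕ} {C lam : BF n} (hC : Cartan C) {L : List (Fin n)}
    {B : List (Fin n → ℕ)} (S : State C lam L B) (i : Fin n)
    (hi : ∀ j, 0 ≤ lam (ez j) (ez i)) (j k : Fin n) (hj : j ≠ i) (hk : k ≠ i) :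
    lamR C lam i (ez j) (ez k) = lam (ez j) (ez k) := by
  rw [lamR_apply, refl_apply, refl_apply]
  simp only [map_sub, map_smul, LinearMap.sub_apply, LinearMap.smul_apply, smul_eq_mul, S.self]
  rw [S.anti (ez i) (ez k), sink_val hC S i hi j hj, sink_val hC S i hi k hk]
  ring

theorem state_step {n : ℕ} {C lam : BF n} (hC : Cartan C) {L1 L2 : List (Fin n)}
    {B : List (Fin n → ℕ)} (i : Fin n)
    (S : State C lam (L1 ++ i :: L2) (B ++ [Pi.single i 1]))
    (hi : ∀ j, 0 ≤ lam (ez j) (ez i)) :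
    State C (lamR C lam i) (L1 ++ L2 ++ [i]) (Pi.single i 1 :: B.map (sN (refl C i))) := by
  have hperm : (L1 ++ L2 ++ [i]).Perm (L1 ++ i :: L2) := by
    rw [List.append_assoc]
    exact List.Perm.append_left L1 (List.perm_append_singleton i L2)
  have hnd : (L1 ++ L2 ++ [i]).Nodup := hperm.nodup_iff.2 S.Lnodup
  have hniL : ∀ u ∈ L1 ++ L2, u ≠ i := by
    intro u hu
    exact (List.nodup_append.1 hnd).2.2 u hu i (by simp)
  have hBnd := List.nodup_append.1 S.Bnodup
  have hne : ∀ b ∈ B, b ≠ Pi.single i 1 := fun b hb => hBnd.2.2 b hb _ (by simp)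
  have hroot : ∀ b ∈ B, IsRoot C b := fun b hb => (S.Bmem b).1 (by simp [hb])
  have hGG : ∀ b ∈ B, GG (refl C i) b := fun b hb => GG_root hC i (hroot b hb) (hne b hb)
  have hanti : ∀ x y, lamR C lam i x y = - lamR C lam i y x := by
    intro x y
    rw [lamR_apply, lamR_apply]; exact S.anti _ _
  refine ⟨hanti, ?_, ?_, hnd, ?_, ?_, ?_, ?_, ?_⟩
  · intro x y
    have := S.par (refl C i x) (refl C i y)
    rwa [refl_form hC] at this
  · intro j k
    by_cases hk : k = i
    · subst hk
      rw [lamR_ji hC S]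
      have := S.bd j k
      omega
    · by_cases hj : j = i
      · subst hj
        rw [hanti, lamR_ji hC S]
        have := S.bd k j
        omega
      · rw [lamR_jk hC S i hi j k hj hk]
        exact S.bd j k
  · intro j
    exact hperm.mem_iff.2 (S.Lmem j)
  · rw [List.pairwise_append]
    refine ⟨?_, by simp, ?_⟩
    · have hsub : (L1 ++ L2).Sublist (L1 ++ i :: L2) :=
        List.Sublist.append_left (List.sublist_cons_self i L2) L1
      have := S.Lord.sublist hsub
      refine this.imp_of_mem ?_
      intro u v hu hv huv
      rw [lamR_jk hC S i hi u v (hniL u hu) (hniL v hv)]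
      exact huv
    · intro u _ v hv
      simp only [List.mem_singleton] at hv
      subst hv
      rw [lamR_ji hC S]
      have := hi u
      omega
  · rw [List.nodup_cons]
    constructor
    · intro h
      obtain ⟨b, hb, hbe⟩ := List.mem_map.1 h
      apply not_GG_single hC i
      rw [← hbe]
      exact GG_sN (refl_refl hC i) (hGG b hb)
    · apply List.Nodup.map_on _ hBnd.1
      intro a ha b hb hab
      rw [← sN_sN (refl_refl hC i) (hGG a ha), hab, sN_sN (refl_refl hC i) (hGG b hb)]
  · intro β
    constructor
    · intro h
      rcases List.mem_cons.1 h with h | h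
      · rw [h]; exact isRoot_single hC i
      · obtain ⟨b, hb, rfl⟩ := List.mem_map.1 h
        exact isRoot_sN hC i (hroot b hb) (hne b hb)
    · intro h
      by_cases hβ : β = Pi.single i 1
      · rw [hβ]; simp
      · have h1 := GG_root hC i h hβ
        have h2 := (S.Bmem _).2 (isRoot_sN hC i h hβ)
        apply List.mem_cons_of_mem
        rw [List.mem_map]
        refine ⟨sN (refl C i) β, ?_, sN_sN (refl_refl hC i) h1⟩
        rcases List.mem_append.1 h2 with h3 | h3
        · exact h3
        · exfalso
          simp only [List.mem_singleton] at h3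
          apply not_GG_single hC i
          rw [← h3]
          exact GG_sN (refl_refl hC i) h1
  · rw [List.pairwise_cons]
    constructor
    · intro b hb
      obtain ⟨c, hc, rfl⟩ := List.mem_map.1 hb
      rw [lamR_apply, toZ_sN (hGG c hc), refl_refl hC, toZ_e, refl_self hC]
      have h1 := (List.pairwise_append.1 S.Bord).2.2 c hc (Pi.single i 1) (by simp)
      rw [toZ_e, S.anti] at h1
      simpa using h1
    · rw [List.pairwise_map]
      refine (List.pairwise_append.1 S.Bord).1.imp_of_mem ?_
      intro a b ha hb hab
      rw [lamR_apply, toZ_sN (hGG a ha), toZ_sN (hGG b hb), refl_refl hC, refl_refl hC]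
      exact hab

theorem algebra_step {n : ℕ} {C lam : BF n} (hC : Cartan C) {L1 L2 : List (Fin n)}
    {B : List (Fin n → ℕ)} (i : Fin n)
    (S : State C lam (L1 ++ i :: L2) (B ++ [Pi.single i 1]))
    (hi : ∀ j, 0 ≤ lam (ez j) (ez i)) (D D' : AQ n)
    (hD : mulL lam D (RR lam (B ++ [Pi.single i 1])) = AA lam (L1 ++ i :: L2))
    (hD' : mulL (lamR C lam i) D' (RR (lamR C lam i) (Pi.single i 1 :: B.map (sN (refl C i)))) =
      AA (lamR C lam i) (L1 ++ L2 ++ [i])) :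
    Supp (GG (refl C i)) D ∧
    mulL (lamR C lam i) D' (Edl (Pi.single i 1)) =
      mulL (lamR C lam i) (Edl (Pi.single i 1)) (TT (refl C i) D) := by
  set s := refl C i with hsdef
  set lam' := lamR C lam i with hlam'
  have hss : ∀ x, s (s x) = x := refl_refl hC i
  have S' := state_step hC i S hi
  have hniL : ∀ u ∈ L1 ++ L2, u ≠ i := by
    intro u hu
    exact (List.nodup_append.1 S'.Lnodup).2.2 u hu i (by simp)
  have hBnd := List.nodup_append.1 S.Bnodup
  have hne : ∀ b ∈ B, b ≠ Pi.single i 1 := fun b hb => hBnd.2.2 b hb _ (by simp)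
  have hroot : ∀ b ∈ B, IsRoot C b := fun b hb => (S.Bmem b).1 (by simp [hb])
  have hGG : ∀ b ∈ B, GG s b := fun b hb => GG_root hC i (hroot b hb) (hne b hb)
  have hl : ∀ x y, lam' x y = lam (s x) (s y) := fun x y => rfl
  let Xf : Fin n → AQ n := fun j => if C (ez i) (ez j) = 0 then Edl (Pi.single j 1) else
    mulL lam (Edl (Pi.single j 1)) (Edl (Pi.single i 1 + Pi.single j 1))
  have G1 : ∀ j, j ≠ i → GG s (Pi.single j 1) := by
    intro j hj
    apply GG_root hC i (isRoot_single hC j)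
    intro h
    have := congrFun h j
    simp [hj] at this
  have s1 : ∀ j, s (ez j) = ez j - C (ez i) (ez j) • ez i := fun j => refl_apply C i (ez j)
  have G2z : ∀ j, C (ez i) (ez j) = -1 → s (toZ (Pi.single i 1 + Pi.single j 1)) = ez j := by
    intro j h
    rw [toZ_add, toZ_e, toZ_e, map_add, s1 j, h, hsdef, refl_self hC]
    simp
  have G2 : ∀ j, C (ez i) (ez j) = -1 → GG s (Pi.single i 1 + Pi.single j 1) := by
    intro j h
    unfold GG
    rw [G2z j h, ← toZ_e]
    exact toZ_nonneg _
  have suppX : ∀ j, j ≠ i → Supp (GG s) (Xf j) := by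
    intro j hj
    simp only [Xf]
    split_ifs with h
    · exact supp_Edl (GG_zero s) (GG_add s) (G1 j hj)
    · exact supp_mul lam (GG_add s) (supp_Edl (GG_zero s) (GG_add s) (G1 j hj))
        (supp_Edl (GG_zero s) (GG_add s) (G2 j ((off_ge hC i j hj.symm).resolve_left h)))
  have int1 : ∀ j ∈ L1 ++ L2, mulL lam (Edl (Pi.single i 1)) (Edl (Pi.single j 1)) =
      mulL lam (Xf j) (Edl (Pi.single i 1)) := by
    intro j hjm
    have hj := hniL j hjm
    have hv := sink_val hC S i hi j hj
    have ha := S.anti (ez i) (ez j)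
    simp only [Xf]
    split_ifs with h
    · apply Edl_comm
      · rw [toZ_e, toZ_e]; omega
      · rw [toZ_e, toZ_e]; omega
    · have h' := (off_ge hC i j hj.symm).resolve_left h
      apply pentagon lam i j hj.symm
      · rw [ha, hv, h']; rfl
      · rw [hv, h']; rfl
      · exact S.self _
      · exact S.self _
  have int2 : ∀ j ∈ L1 ++ L2, mulL lam' (Edl (Pi.single i 1)) (TT s (Xf j)) =
      mulL lam' (Edl (Pi.single j 1)) (Edl (Pi.single i 1)) := by
    intro j hjm
    have hj := hniL j hjm
    have hv : lam' (ez j) (ez i) = - lam (ez j) (ez i) := lamR_ji hC S i j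
    rw [sink_val hC S i hi j hj] at hv
    have ha := S'.anti (ez i) (ez j)
    rw [← hlam'] at ha
    simp only [Xf]
    split_ifs with h
    · have hsj : sN s (Pi.single j 1) = Pi.single j 1 := by
        apply toZ_inj
        rw [toZ_sN (G1 j hj), toZ_e, s1, h]; simp
      rw [TT_Edl hss (single1_ne j) (G1 j hj), hsj]
      apply Edl_comm
      · rw [toZ_e, toZ_e]; omega
      · rw [toZ_e, toZ_e]; omega
    · have h' := (off_ge hC i j hj.symm).resolve_left h
      have hsj : sN s (Pi.single j 1) = Pi.single j 1 + Pi.single i 1 := by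
        apply toZ_inj
        rw [toZ_sN (G1 j hj), toZ_add, toZ_e, toZ_e, s1, h']; simp
      have hsij : sN s (Pi.single i 1 + Pi.single j 1) = Pi.single j 1 := by
        apply toZ_inj
        rw [toZ_sN (G2 j h'), G2z j h', toZ_e]
      have hune : (Pi.single i 1 + Pi.single j 1 : Fin n → ℕ) ≠ 0 := by
        intro h0
        have := congrFun h0 j
        simp [hj] at this
      rw [TT_mul hss hl (supp_Edl (GG_zero s) (GG_add s) (G1 j hj))
        (supp_Edl (GG_zero s) (GG_add s) (G2 j h')), TT_Edl hss (single1_ne j) (G1 j hj),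
        TT_Edl hss hune (G2 j h'), hsj, hsij, ← mulL_assoc]
      symm
      apply pentagon lam' j i hj
      · rw [hv, h']; rfl
      · rw [ha, hv, h']; rfl
      · exact S'.self _
      · exact S'.self _
  have A1 : AA lam (L1 ++ i :: L2) =
      mulL lam (prodL lam ((L1 ++ L2).map Xf)) (Edl (Pi.single i 1)) := by
    rw [← prod_intertwine lam _ (fun j => Edl (Pi.single j 1)) Xf (L1 ++ L2) int1]
    unfold AA
    rw [List.map_append, List.map_append, List.map_cons, prodL_append, prodL_append, prodL_cons,
      ← mulL_assoc, ← mulL_assoc]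
    congr 1
    symm
    apply prod_intertwine
    intro j hj
    have h1 := (List.pairwise_append.1 S.Lord).2.2 j hj i (by simp)
    have h2 := hi j
    have ha := S.anti (ez i) (ez j)
    apply Edl_comm
    · rw [toZ_e, toZ_e]; omega
    · rw [toZ_e, toZ_e]; omega
  have A2 : AA lam' (L1 ++ L2 ++ [i]) =
      mulL lam' (Edl (Pi.single i 1)) (TT s (prodL lam ((L1 ++ L2).map Xf))) := by
    rw [TT_prod hss hl]
    · rw [List.map_map]
      have := prod_intertwine lam' (Edl (Pi.single i 1)) (TT s ∘ Xf)
        (fun j => Edl (Pi.single j 1)) (L1 ++ L2) int2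
      rw [this]
      unfold AA
      rw [List.map_append, prodL_append]
      simp only [List.map_cons, List.map_nil, prodL_single]
    · intro f hf
      obtain ⟨j, hj, rfl⟩ := List.mem_map.1 hf
      exact suppX j (hniL j hj)
  have suppW : Supp (GG s) (RR lam B) := by
    apply supp_prod lam (GG_zero s) (GG_add s)
    intro f hf
    obtain ⟨b, hb, rfl⟩ := List.mem_map.1 hf
    exact supp_Edl (GG_zero s) (GG_add s) (hGG b hb)
  have R1 : RR lam (B ++ [Pi.single i 1]) = mulL lam (RR lam B) (Edl (Pi.single i 1)) := by
    unfold RR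
    rw [List.map_append, prodL_append]
    simp only [List.map_cons, List.map_nil, prodL_single]
  have TW : TT s (RR lam B) = RR lam' (B.map (sN s)) := by
    unfold RR
    rw [TT_prod hss hl]
    · congr 1
      rw [List.map_map, List.map_map]
      apply List.map_congr_left
      intro b hb
      exact TT_Edl hss (hroot b hb).ne_zero (hGG b hb)
    · intro f hf
      obtain ⟨b, hb, rfl⟩ := List.mem_map.1 hf
      exact supp_Edl (GG_zero s) (GG_add s) (hGG b hb)
  have R2 : RR lam' (Pi.single i 1 :: B.map (sN s)) =
      mulL lam' (Edl (Pi.single i 1)) (TT s (RR lam B)) := by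
    rw [TW]; rfl
  have R0 : ∀ (l : BF n) (M : List (Fin n → ℕ)), RR l M 0 = 1 := by
    intro l M
    apply prodL_zero_apply
    intro f hf
    obtain ⟨b, _, rfl⟩ := List.mem_map.1 hf
    exact Edl_zero b
  have hDW : mulL lam D (RR lam B) = prodL lam ((L1 ++ L2).map Xf) := by
    apply mulL_cancel lam _ _ (Edl (Pi.single i 1)) (Edl_zero _)
    rw [← A1, ← hD, R1, mulL_assoc]
  have suppXX : Supp (GG s) (prodL lam ((L1 ++ L2).map Xf)) := by
    apply supp_prod lam (GG_zero s) (GG_add s)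
    intro f hf
    obtain ⟨j, hj, rfl⟩ := List.mem_map.1 hf
    exact suppX j (hniL j hj)
  have suppD : Supp (GG s) D := supp_div lam (GG_add s) (R0 lam B) suppW suppXX hDW
  refine ⟨suppD, ?_⟩
  apply mulL_cancel lam' _ _ (TT s (RR lam B)) (by rw [TW]; exact R0 _ _)
  rw [mulL_assoc, ← R2, hD', A2, ← hDW, TT_mul hss hl suppD suppW, mulL_assoc]

theorem RR_zero {n : ℕ} (l : BF n) (M : List (Fin n → ℕ)) : RR l M 0 = 1 := by
  apply prodL_zero_apply
  intro f hf
  obtain ⟨b, _, rfl⟩ := List.mem_map.1 hf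
  exact Edl_zero b

theorem AA_zero {n : ℕ} (l : BF n) (M : List (Fin n)) : AA l M 0 = 1 := by
  apply prodL_zero_apply
  intro f hf
  obtain ⟨b, _, rfl⟩ := List.mem_map.1 hf
  exact Edl_zero _

theorem main_induction {n : ℕ} {C : BF n} (hC : Cartan C) : ∀ (N : ℕ) (lam : BF n)
    (L : List (Fin n)) (B1 B2 : List (Fin n → ℕ)) (f : (Fin n → ℤ) →ₗ[ℤ] ℤ), B2.length = N →
    State C lam L (B1 ++ B2) → (∀ b ∈ B1, 0 < f (toZ b)) → (∀ b ∈ B2, f (toZ b) < 0) →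
    ∀ D : AQ n, mulL lam D (RR lam (B1 ++ B2)) = AA lam L →
    ∀ γ, f (toZ γ) < 0 → D γ = 0 := by
  intro N
  induction N with
  | zero =>
    intro lam L B1 B2 f hlen S h1 _ D _ γ hγ
    exfalso
    have hB2 : B2 = [] := List.length_eq_zero_iff.1 hlen
    subst hB2
    have : 0 ≤ f (toZ γ) := by
      rw [vec_sum (toZ γ), map_sum]
      apply Finset.sum_nonneg
      intro i _
      rw [map_smul, smul_eq_mul]
      apply mul_nonneg (toZ_nonneg γ i)
      have := (S.Bmem _).2 (isRoot_single hC i)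
      have := h1 _ (by simpa using this)
      rw [toZ_e] at this
      exact this.le
    omega
  | succ N ih =>
    intro lam L B1 B2 f hlen S h1 h2 D hD γ hγ
    have hne : B2 ≠ [] := by rintro rfl; simp at hlen
    obtain ⟨B2', b, rfl⟩ : ∃ B2' b, B2 = B2' ++ [b] :=
      ⟨B2.dropLast, B2.getLast hne, (List.dropLast_append_getLast hne).symm⟩
    rw [← List.append_assoc] at S hD
    obtain ⟨i, rfl, hi⟩ := last_simple hC S
    obtain ⟨L1, L2, rfl⟩ := List.append_of_mem (S.Lmem i)
    have S' := state_step hC i S hi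
    obtain ⟨D', hD'⟩ := exists_div (lamR C lam i) (AA (lamR C lam i) (L1 ++ L2 ++ [i]))
      (RR (lamR C lam i) (Pi.single i 1 :: (B1 ++ B2').map (sN (refl C i)))) (RR_zero _ _)
    obtain ⟨suppD, hintw⟩ := algebra_step hC i S hi D D' hD hD'
    by_contra hDγ
    have hss := refl_refl hC i
    have hGγ : GG (refl C i) γ := by
      by_contra h
      exact hDγ (suppD γ h)
    have hTD : TT (refl C i) D (sN (refl C i) γ) ≠ 0 := by
      rw [TT, if_pos (GG_sN hss hGγ), sN_sN hss hGγ]; exact hDγ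
    obtain ⟨k, hk1, hk2⟩ := line_lemma (lamR C lam i) i D' (TT (refl C i) D) hintw _ _ rfl hTD
    apply hk2
    have hBnd := List.nodup_append.1 S.Bnodup
    have hGG : ∀ b ∈ B1 ++ B2', GG (refl C i) b := fun b hb =>
      GG_root hC i ((S.Bmem b).1 (List.mem_append_left _ hb)) (hBnd.2.2 b hb _ (by simp))
    have hfi : f (ez i) < 0 := by
      have := h2 (Pi.single i 1) (by simp)
      rwa [toZ_e] at this
    rw [List.map_append, ← List.cons_append] at S' hD'
    refine ih (lamR C lam i) _ (Pi.single i 1 :: B1.map (sN (refl C i)))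
      (B2'.map (sN (refl C i))) (f.comp (refl C i)) ?_ S' ?_ ?_ D' hD' _ ?_
    · simp at hlen ⊢; exact hlen
    · intro b hb
      rw [LinearMap.comp_apply]
      rcases List.mem_cons.1 hb with rfl | hb
      · rw [toZ_e, refl_self hC, map_neg]; omega
      · obtain ⟨c, hc, rfl⟩ := List.mem_map.1 hb
        rw [toZ_sN (hGG c (by simp [hc])), hss]
        exact h1 c hc
    · intro b hb
      rw [LinearMap.comp_apply]
      obtain ⟨c, hc, rfl⟩ := List.mem_map.1 hb
      rw [toZ_sN (hGG c (by simp [hc])), hss]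
      exact h2 c (by simp [hc])
    · rw [LinearMap.comp_apply, toZ_sub hk1, toZ_sN hGγ, ← ksmul_single, toZ_smul, toZ_e, map_sub,
        map_smul, hss, refl_self hC, map_sub, map_smul, map_neg, smul_eq_mul]
      have : (0 : ℤ) ≤ k := by positivity
      nlinarith

theorem identity {n : ℕ} {C lam : BF n} (hC : Cartan C) {L : List (Fin n)}
    {B : List (Fin n → ℕ)} (S : State C lam L B) : AA lam L = RR lam B := by
  obtain ⟨D, hD⟩ := exists_div lam (AA lam L) (RR lam B) (RR_zero _ _)
  let f : (Fin n → ℤ) →ₗ[ℤ] ℤ := - ∑ i, LinearMap.proj i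
  have hf : ∀ x, f x = - ∑ i, x i := by
    intro x; simp [f]
  have hneg : ∀ γ : Fin n → ℕ, γ ≠ 0 → f (toZ γ) < 0 := by
    intro γ hγ
    rw [hf]
    obtain ⟨i, hi⟩ := Function.ne_iff.1 hγ
    have h1 : 0 < toZ γ i := by
      simp only [toZ]
      have : γ i ≠ 0 := hi
      omega
    have h2 := Finset.single_le_sum (f := fun i => toZ γ i) (fun j _ => toZ_nonneg γ j)
      (Finset.mem_univ i)
    omega
  have key := main_induction hC B.length lam L [] B f rfl S (by simp)
    (fun b hb => hneg b ((S.Bmem b).1 hb).ne_zero) D hD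
  have hD1 : D = oneQ := by
    funext γ
    by_cases h : γ = 0
    · subst h
      have := congrFun hD 0
      rw [mulL_zero_apply, RR_zero, AA_zero, mul_one] at this
      simp [oneQ, this]
    · rw [key γ (hneg γ h)]
      simp [oneQ, h]
  rw [← hD, hD1, one_mulL]

/-! ### The quiver -/

/-- Euler form as a bilinear form -/
def chiB {n : ℕ} (Q : Quiv n) : BF n :=
  LinearMap.mk₂ ℤ Q.chi
    (by
      intro x y z
      simp only [chi, chiSub, Pi.add_apply, add_mul, Finset.sum_add_distrib]; ring)
    (by
      intro c x y
      simp only [chi, chiSub, Pi.smul_apply, smul_eq_mul, mul_sub, Finset.mul_sum, mul_assoc])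
    (by
      intro x y z
      simp only [chi, chiSub, Pi.add_apply, mul_add, Finset.sum_add_distrib]; ring)
    (by
      intro c x y
      simp only [chi, chiSub, Pi.smul_apply, smul_eq_mul, mul_sub, Finset.mul_sum]
      congr 1 <;> (apply Finset.sum_congr rfl; intro a _; ring))

theorem chiB_apply {n : ℕ} (Q : Quiv n) (x y : Fin n → ℤ) : chiB Q x y = Q.chi x y := rfl

def lamB {n : ℕ} (Q : Quiv n) : BF n := (chiB Q).flip - chiB Q
def carB {n : ℕ} (Q : Quiv n) : BF n := (chiB Q).flip + chiB Q

theorem lamB_apply {n : ℕ} (Q : Quiv n) (x y : Fin n → ℤ) : lamB Q x y = Q.lam x y := rfl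
theorem carB_apply {n : ℕ} (Q : Quiv n) (x y : Fin n → ℤ) :
    carB Q x y = Q.chi y x + Q.chi x y := rfl

theorem prodQ_eq {n : ℕ} (Q : Quiv n) (L : List (AQ n)) : prodQ Q L = prodL (lamB Q) L := rfl

theorem chi_ez {n : ℕ} (Q : Quiv n) (i j : Fin n) (h : i ≠ j) :
    Q.chi (ez i) (ez j) ≤ 0 := by
  unfold chi chiSub
  have h1 : ∑ k : Fin n, ez i k * ez j k = 0 := by
    apply Finset.sum_eq_zero
    intro k _
    by_cases hk : k = i
    · subst hk; simp [h]
    · simp [hk]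
  have h2 : 0 ≤ ∑ a : Fin Q.m, ez i (Q.ta a) * ez j (Q.ha a) := by
    apply Finset.sum_nonneg
    intro a _
    apply mul_nonneg
    · simp only [ez, Pi.single_apply]; split_ifs <;> simp
    · simp only [ez, Pi.single_apply]; split_ifs <;> simp
  omega

theorem chi_ez_self {n : ℕ} (Q : Quiv n) (hlt : ∀ a : Fin Q.m, Q.ha a < Q.ta a) (i : Fin n) :
    Q.chi (ez i) (ez i) = 1 := by
  unfold chi chiSub
  have h1 : ∑ k : Fin n, ez i k * ez i k = 1 := by
    simp [Pi.single_apply]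
  have h2 : ∑ a : Fin Q.m, ez i (Q.ta a) * ez i (Q.ha a) = 0 := by
    apply Finset.sum_eq_zero
    intro a _
    have := hlt a
    by_cases hk : Q.ta a = i
    · have h3 : Q.ha a ≠ i := by rw [← hk]; exact this.ne
      simp [h3]
    · simp [hk]
  omega

theorem chi_ez_lt {n : ℕ} (Q : Quiv n) (hlt : ∀ a : Fin Q.m, Q.ha a < Q.ta a) (i j : Fin n)
    (h : i < j) : Q.chi (ez i) (ez j) = 0 := by
  unfold chi chiSub
  have h1 : ∑ k : Fin n, ez i k * ez j k = 0 := by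
    apply Finset.sum_eq_zero
    intro k _
    by_cases hk : k = i
    · subst hk; simp [h.ne]
    · simp [hk]
  have h2 : ∑ a : Fin Q.m, ez i (Q.ta a) * ez j (Q.ha a) = 0 := by
    apply Finset.sum_eq_zero
    intro a _
    have := hlt a
    by_cases hk : Q.ta a = i
    · have h3 : Q.ha a ≠ j := by
        rw [hk] at this
        exact (this.trans h).ne
      simp [h3]
    · simp [hk]
  omega

theorem carB_cartan {n : ℕ} (Q : Quiv n) (hlt : ∀ a : Fin Q.m, Q.ha a < Q.ta a)
    (hpos : Q.PosDefOn Finset.univ Finset.univ) : Cartan (carB Q) := by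
  refine ⟨?_, ?_, ?_, ?_, ?_⟩
  · intro x y; rw [carB_apply, carB_apply]; ring
  · intro x hx
    have : 0 < Q.chi x x := hpos x (by simp) hx
    rw [carB_apply]; omega
  · intro x; rw [carB_apply]; omega
  · intro i; rw [carB_apply, chi_ez_self Q hlt]; rfl
  · intro i j h
    rw [carB_apply]
    have := chi_ez Q i j h
    have := chi_ez Q j i h.symm
    omega

theorem final {n N : ℕ} (Q : Quiv n)
    (hlt : ∀ a : Fin Q.m, Q.ha a < Q.ta a)
    (hdyn : Q.DynkinOn Finset.univ Finset.univ)
    (β : Fin N → (Fin n → ℕ)) (hinj : Function.Injective β)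
    (hrange : Set.range β = Q.PosRootsOn Finset.univ Finset.univ)
    (horder : ∀ u v : Fin N, u < v →
      0 ≤ Q.lam (Quiv.toZ (β u)) (Quiv.toZ (β v))) :
    prodQ Q (List.ofFn fun i : Fin n => Edl (Pi.single i 1)) =
      prodQ Q (List.ofFn fun u : Fin N => Edl (β u)) := by
  have hC := carB_cartan Q hlt hdyn.2.2.2.2
  have S : State (carB Q) (lamB Q) (List.finRange n) (List.ofFn β) := by
    refine ⟨?_, ?_, ?_, List.nodup_finRange n, List.mem_finRange, ?_, ?_, ?_, ?_⟩
    · intro x y; rw [lamB_apply, lamB_apply]; unfold lam; ring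
    · intro x y; rw [lamB_apply, carB_apply]; unfold lam; omega
    · intro i j
      rw [lamB_apply]
      unfold lam
      by_cases h : i = j
      · subst h; simp
      · have h1 := off_ge hC i j h
        rw [carB_apply] at h1
        have := chi_ez Q i j h
        have := chi_ez Q j i (Ne.symm h)
        omega
    · have h := List.pairwise_lt_finRange n
      refine h.imp ?_
      intro u v huv
      rw [lamB_apply]
      unfold lam
      rw [chi_ez_lt Q hlt u v huv]
      have := chi_ez Q v u huv.ne'
      omega
    · exact List.nodup_ofFn.2 hinj
    · intro b
      rw [List.mem_ofFn, ← Set.mem_range, hrange]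
      have e : IsRoot (carB Q) b ↔ Q.chi (toZ b) (toZ b) = 1 := by
        unfold IsRoot; rw [carB_apply]; omega
      constructor
      · rintro ⟨_, _, h⟩
        exact e.2 h
      · intro h
        exact ⟨h.ne_zero, by simp, e.1 h⟩
    · rw [List.pairwise_ofFn]
      intro u v huv
      exact horder u v huv
  have := identity hC S
  unfold AA RR at this
  rw [prodQ_eq, prodQ_eq]
  rw [List.map_ofFn, ← List.ofFn_eq_map] at this
  exact this

end Quiv

end Aux

/-- Reineke/Rimányi: For a Dynkin quiver `Q` labeled
head-before-tail, with positive roots enumerated `β₁,…,β_N` so that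
`λ(β_u,β_v) ≥ 0` for `u < v`,
`E(y_{e₁})⋯E(y_{e_n}) = E(y_{β₁})⋯E(y_{β_N})` in `Â_Q`. -/
theorem statement1 {n N : ℕ} (Q : Quiv n)
    (hlt : ∀ a : Fin Q.m, Q.ha a < Q.ta a)
    (hdyn : Q.DynkinOn Finset.univ Finset.univ)
    (β : Fin N → (Fin n → ℕ)) (hinj : Function.Injective β)
    (hrange : Set.range β = Q.PosRootsOn Finset.univ Finset.univ)
    (horder : ∀ u v : Fin N, u < v →
      0 ≤ Q.lam (Quiv.toZ (β u)) (Quiv.toZ (β v))) :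
    prodQ Q (List.ofFn fun i : Fin n => Edl (Pi.single i 1)) =
      prodQ Q (List.ofFn fun u : Fin N => Edl (β u)) := by
  exact Quiv.final Q hlt hdyn β hinj hrange horder
end
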